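/- arXiv:0901.1584 — 6 statements merged into one kernel-verified Lean document; each statement's English description precedes it below -/
import Mathlib

section
/- Let S be a Łukasiewicz logic, let φ ∈ S and let Σ ⊆ S be finite. Then Σ ⊨ φ if and only if Σ ⊢ φ in the deduction system consisting of the axiom schemes A1–A4 and Modus Ponens. -/
namespace Stmt3

/-- Formulas of Łukasiewicz logic, freely generated from atomic propositions indexed by `I`
by the binary connective `∸` and the unary connective `¬`. -/
inductive LukFormula (I : Type*) : Type _ where
  | atom : I → LukFormula I
  | neg : LukFormula I → LukFormula I
  | sub : LukFormula I → LukFormula I → LukFormula I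

namespace LukFormula

variable {I : Type*}

/-- The truth value of a formula under an assignment of truth values to the atoms. -/
def eval (v : I → ℝ) : LukFormula I → ℝ
  | atom i => v i
  | neg φ => 1 - eval v φ
  | sub φ ψ => max (eval v φ - eval v ψ) 0

/-- A truth assignment is determined by the truth values of the atoms, in `[0,1]`. -/
def IsAssignment (v : I → ℝ) : Prop := ∀ i, v i ∈ Set.Icc (0 : ℝ) 1

/-- `φ ∧ ψ` abbreviates `φ ∸ (φ ∸ ψ)`. -/
def land (φ ψ : LukFormula I) : LukFormula I := sub φ (sub φ ψ)

/-- The axiom schemes A1–A4 of the Rose–Rosser deduction system. -/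
inductive LukAxiom : LukFormula I → Prop where
  | a1 (φ ψ : LukFormula I) : LukAxiom (sub (sub φ ψ) φ)
  | a2 (φ ψ ρ : LukFormula I) : LukAxiom (sub (sub (sub ρ φ) (sub ρ ψ)) (sub ψ φ))
  | a3 (φ ψ : LukFormula I) : LukAxiom (sub (land φ ψ) (land ψ φ))
  | a4 (φ ψ : LukFormula I) : LukAxiom (sub (sub φ ψ) (sub (neg ψ) (neg φ)))

/-- Formal deduction from a set of premises `Γ`, using the axiom schemes A1–A4 and
Modus Ponens (from `φ` and `ψ ∸ φ` infer `ψ`). -/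
inductive Deduces (Γ : Set (LukFormula I)) : LukFormula I → Prop where
  | ax {φ : LukFormula I} : LukAxiom φ → Deduces Γ φ
  | prem {φ : LukFormula I} : φ ∈ Γ → Deduces Γ φ
  | mp {φ ψ : LukFormula I} : Deduces Γ φ → Deduces Γ (sub ψ φ) → Deduces Γ ψ

end LukFormula

open LukFormula

/-! ### Wajsberg algebras -/

/-- Wajsberg algebras, presented by truncated subtraction, complement and zero. -/
class WajsbergAlgebra (A : Type*) extends Zero A, Sub A, Compl A where
  sub_zero (x : A) : x - 0 = x
  zero_sub (x : A) : 0 - x = 0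
  sub_sub_sub (x y z : A) : z - x - (z - y) - (y - x) = 0
  inf_comm (x y : A) : x - (x - y) = y - (y - x)
  compl_sub_compl (x y : A) : yᶜ - xᶜ = x - y
  compl_compl (x : A) : xᶜᶜ = x

namespace WajsbergAlgebra

variable {A : Type*} [WajsbergAlgebra A]

theorem sub_self (x : A) : x - x = 0 := by
  simpa [sub_zero, zero_sub] using inf_comm x 0

/-- The natural order: `x ≤ y` when `x - y = 0`. -/
instance : PartialOrder A where
  le x y := x - y = 0
  le_refl := sub_self
  le_trans x y z hxy hyz := by
    have h := sub_sub_sub z y x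
    rwa [show y - z = 0 from hyz, show x - y = 0 from hxy, sub_zero, sub_zero] at h
  le_antisymm x y hxy hyx := by
    have h := inf_comm x y
    rwa [show y - x = 0 from hyx, show x - y = 0 from hxy, sub_zero, sub_zero] at h

theorem le_iff {x y : A} : x ≤ y ↔ x - y = 0 := Iff.rfl

theorem zero_le (x : A) : 0 ≤ x := zero_sub x

theorem le_zero_iff {x : A} : x ≤ 0 ↔ x = 0 := by
  rw [le_iff, sub_zero]

theorem sub_le (x y : A) : x - y ≤ x := by
  have h := sub_sub_sub y 0 x
  rwa [sub_zero, zero_sub, sub_zero] at h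

theorem sub_le_sub_left {x y : A} (h : y ≤ x) (z : A) : z - x ≤ z - y := by
  have h' := sub_sub_sub x y z
  rwa [le_iff.1 h, sub_zero] at h'

theorem sub_sub_self_le (x y : A) : x - (x - y) ≤ y := by
  rw [inf_comm]
  exact sub_le _ _

theorem sub_right_comm (x y z : A) : x - y - z = x - z - y := by
  have key (x y z : A) : x - y - z ≤ x - z - y :=
    (sub_le_sub_left (sub_sub_self_le x z) (x - y)).trans (sub_sub_sub y (x - z) x)
  exact le_antisymm (key x y z) (key x z y)

theorem sub_le_comm {x y z : A} : x - y ≤ z ↔ x - z ≤ y := by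
  rw [le_iff, le_iff, sub_right_comm]

theorem sub_le_sub_right {x y : A} (h : x ≤ y) (z : A) : x - z ≤ y - z := by
  have h' : x - z - (y - z) ≤ x - y := sub_le_comm.1 (sub_sub_sub z y x)
  rwa [le_iff.1 h, le_zero_iff] at h'

theorem compl_le_compl {x y : A} (h : x ≤ y) : yᶜ ≤ xᶜ := by
  rwa [le_iff, compl_sub_compl]

theorem le_compl_zero (x : A) : x ≤ 0ᶜ := by
  have h := compl_le_compl (zero_le xᶜ)
  rwa [compl_compl] at h

theorem compl_zero_sub (x : A) : 0ᶜ - x = xᶜ := by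
  rw [← compl_sub_compl, compl_compl, sub_zero]

theorem sub_compl_comm (x y : A) : x - yᶜ = y - xᶜ := by
  rw [← compl_sub_compl, compl_compl]

/-- Truncated addition. -/
def oplus (x y : A) : A := (xᶜ - y)ᶜ

local infixl:65 "∔" => oplus

theorem compl_oplus (x y : A) : (x ∔ y)ᶜ = xᶜ - y := compl_compl _

theorem oplus_comm (x y : A) : x ∔ y = y ∔ x := by
  rw [oplus, oplus, ← compl_sub_compl, compl_compl]

theorem sub_oplus (x y z : A) : x - (y ∔ z) = x - y - z := by
  rw [← compl_sub_compl, compl_oplus, sub_right_comm, compl_sub_compl]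

theorem oplus_assoc (x y z : A) : x ∔ y ∔ z = x ∔ (y ∔ z) := by
  rw [oplus, compl_oplus, ← sub_oplus]
  rfl

theorem oplus_zero (x : A) : x ∔ 0 = x := by
  rw [oplus, sub_zero, compl_compl]

theorem zero_oplus (x : A) : 0 ∔ x = x := by
  rw [oplus_comm, oplus_zero]

theorem oplus_sub_cancel {x y : A} (h : y ≤ x) : y ∔ (x - y) = x := by
  rw [oplus, ← compl_sub_compl x y, inf_comm, compl_sub_compl, le_iff.1 h, sub_zero, compl_compl]

theorem oplus_sub_eq {x y : A} (h : x ≤ yᶜ) : x ∔ y - y = x := by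
  rw [← compl_sub_compl, compl_oplus, ← compl_sub_compl xᶜ, compl_compl, inf_comm, le_iff.1 h,
    sub_zero]

theorem oplus_eq_compl_zero_iff {x y : A} : x ∔ y = 0ᶜ ↔ xᶜ ≤ y := by
  rw [le_iff, ← compl_oplus]
  constructor
  · intro h
    rw [h, compl_compl]
  · intro h
    rw [← h, compl_compl]

theorem oplus_compl_self (x : A) : x ∔ xᶜ = 0ᶜ := oplus_eq_compl_zero_iff.2 le_rfl

theorem sub_oplus_comm {x y z : A} (hx : y ≤ x) (hz : y ≤ z) :
    (x - y) ∔ z = x ∔ (z - y) := by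
  conv_lhs => rw [← oplus_sub_cancel hz]
  rw [← oplus_assoc, oplus_comm (x - y), oplus_sub_cancel hx]

/-- Prelinearity: the two differences of a pair of elements are disjoint. -/
theorem sub_sub_sub_symm (x y : A) : x - y - (y - x) = x - y := by
  obtain ⟨c, hc⟩ : ∃ c, c = x - (x - y) := ⟨_, rfl⟩
  have hcx : c ≤ x := hc ▸ sub_le _ _
  have hcy : c ≤ y := hc ▸ sub_sub_self_le x y
  have hy : y - x = y - c := by
    refine le_antisymm (sub_le_sub_left hcx y) ?_
    rw [hc, inf_comm]
    exact sub_sub_self_le _ _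
  have hx : x - y = x - c := by
    refine le_antisymm (sub_le_sub_left hcy x) ?_
    rw [hc]
    exact sub_sub_self_le _ _
  calc x - y - (y - x) = x - c - (y - c) := by rw [hx, hy]
    _ = x - y := by rw [← sub_oplus, oplus_sub_cancel hcy]

theorem iterate_sub_mono {x y : A} (h : x ≤ y) (p : A) (n : ℕ) :
    (· - p)^[n] x ≤ (· - p)^[n] y := by
  have hm : Monotone fun z : A => z - p := fun _ _ h => sub_le_sub_right h p
  exact hm.iterate n h

theorem iterate_sub_le (x p : A) (n : ℕ) : (· - p)^[n] x ≤ x := by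
  induction n with
  | zero => exact le_rfl
  | succ n ih =>
    rw [Function.iterate_succ_apply']
    exact (sub_le _ _).trans ih

theorem iterate_sub_sub (x y p : A) (n : ℕ) :
    (· - p)^[n] (x - y) = (· - p)^[n] x - y := by
  induction n with
  | zero => rfl
  | succ n ih => rw [Function.iterate_succ_apply', Function.iterate_succ_apply', ih, sub_right_comm]

/-- An element in the ideals generated by two disjoint elements is zero. -/
theorem eq_zero_of_iterate_sub {p q x : A} (hpq : p - q = p) {n m : ℕ}
    (hn : (· - p)^[n] x = 0) (hm : (· - q)^[m] x = 0) : x = 0 := by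
  induction n with
  | zero => exact hn
  | succ n ih =>
    refine ih ?_
    obtain ⟨y, hy⟩ : ∃ y, y = (· - p)^[n] x := ⟨_, rfl⟩
    rw [Function.iterate_succ_apply', ← hy] at hn
    rw [← hy]
    have hyq : y - q = y := by
      refine le_antisymm (sub_le y q) ?_
      have h1 : y - (y - q) ≤ p := (sub_le _ _).trans hn
      have h2 : y - (y - q) ≤ q := sub_sub_self_le y q
      have h3 : p - (p - (y - (y - q))) ≤ p - (p - q) :=
        sub_le_sub_left (sub_le_sub_left h2 p) p
      rw [inf_comm, le_iff.1 h1, sub_zero, hpq, sub_self, le_zero_iff] at h3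
      exact h3
    have hfix : (· - q)^[m] y = y := Function.iterate_fixed hyq m
    have hle := iterate_sub_mono (hy ▸ iterate_sub_le x p n : y ≤ x) q m
    rwa [hfix, hm, le_zero_iff] at hle

end WajsbergAlgebra

/-! ### The ordered group of a Wajsberg chain -/

/-- Nontrivial totally ordered Wajsberg algebras. -/
class WajsbergChain (A : Type*) extends WajsbergAlgebra A where
  le_total (x y : A) : x ≤ y ∨ y ≤ x
  zero_ne_compl_zero : (0 : A) ≠ 0ᶜ

namespace WajsbergAlgebra

local infixl:65 "∔" => oplus

/-- The Chang group of a Wajsberg chain `A`: an integer part together with a fractional part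
in `A` different from the top element. -/
@[ext]
structure ChangGroup (A : Type*) [WajsbergChain A] where
  /-- The integer part. -/
  int : ℤ
  /-- The fractional part. -/
  frac : A
  frac_ne : frac ≠ 0ᶜ

namespace ChangGroup

variable {A : Type*} [WajsbergChain A]

theorem ne_compl_zero_of_le {x y : A} (h : x ≤ y) (hy : y ≠ 0ᶜ) : x ≠ 0ᶜ :=
  fun hx => hy (le_antisymm (le_compl_zero y) (hx ▸ h))

theorem le_compl_of_oplus_ne {x y : A} (h : x ∔ y ≠ 0ᶜ) : y ≤ xᶜ :=
  (WajsbergChain.le_total y xᶜ).resolve_right fun h' => h (oplus_eq_compl_zero_iff.2 h')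

open Classical in
/-- Addition with carry. -/
noncomputable instance : Add (ChangGroup A) where
  add g h :=
    if hgh : g.frac ∔ h.frac = 0ᶜ then
      ⟨g.int + h.int + 1, g.frac - h.fracᶜ, ne_compl_zero_of_le (sub_le _ _) g.frac_ne⟩
    else ⟨g.int + h.int, g.frac ∔ h.frac, hgh⟩

instance : Zero (ChangGroup A) where
  zero := ⟨0, 0, WajsbergChain.zero_ne_compl_zero⟩

open Classical in
noncomputable instance : Neg (ChangGroup A) where
  neg g :=
    if hg : g.frac = 0 then ⟨-g.int, 0, WajsbergChain.zero_ne_compl_zero⟩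
    else ⟨-g.int - 1, g.fracᶜ, fun h => hg (by
      rw [← compl_compl g.frac, h, compl_compl])⟩

theorem int_zero : (0 : ChangGroup A).int = 0 := rfl

theorem frac_zero : (0 : ChangGroup A).frac = 0 := rfl

theorem int_add_of_eq {g h : ChangGroup A} (hgh : g.frac ∔ h.frac = 0ᶜ) :
    (g + h).int = g.int + h.int + 1 := congrArg int (dif_pos hgh)

theorem frac_add_of_eq {g h : ChangGroup A} (hgh : g.frac ∔ h.frac = 0ᶜ) :
    (g + h).frac = g.frac - h.fracᶜ := congrArg frac (dif_pos hgh)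

theorem int_add_of_ne {g h : ChangGroup A} (hgh : g.frac ∔ h.frac ≠ 0ᶜ) :
    (g + h).int = g.int + h.int := congrArg int (dif_neg hgh)

theorem frac_add_of_ne {g h : ChangGroup A} (hgh : g.frac ∔ h.frac ≠ 0ᶜ) :
    (g + h).frac = g.frac ∔ h.frac := congrArg frac (dif_neg hgh)

theorem neg_of_eq {g : ChangGroup A} (hg : g.frac = 0) :
    (-g).int = -g.int ∧ (-g).frac = 0 :=
  ⟨congrArg int (dif_pos hg), congrArg frac (dif_pos hg)⟩

theorem neg_of_ne {g : ChangGroup A} (hg : g.frac ≠ 0) :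
    (-g).int = -g.int - 1 ∧ (-g).frac = g.fracᶜ :=
  ⟨congrArg int (dif_neg hg), congrArg frac (dif_neg hg)⟩

protected theorem add_comm (g h : ChangGroup A) : g + h = h + g := by
  by_cases hgh : g.frac ∔ h.frac = 0ᶜ
  · have hhg := hgh
    rw [oplus_comm] at hhg
    ext
    · rw [int_add_of_eq hgh, int_add_of_eq hhg, _root_.add_comm g.int]
    · rw [frac_add_of_eq hgh, frac_add_of_eq hhg, sub_compl_comm]
  · have hhg := hgh
    rw [oplus_comm] at hhg
    ext
    · rw [int_add_of_ne hgh, int_add_of_ne hhg, _root_.add_comm g.int]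
    · rw [frac_add_of_ne hgh, frac_add_of_ne hhg, oplus_comm]

theorem add_assoc_of_ne_of_eq {g h k : ChangGroup A} (hgh : g.frac ∔ h.frac ≠ 0ᶜ)
    (hhk : h.frac ∔ k.frac = 0ᶜ) : g + h + k = g + (h + k) := by
  have hk : k.fracᶜ ≤ h.frac := by
    rwa [← oplus_eq_compl_zero_iff, oplus_comm]
  have hsum : g.frac ∔ h.frac = g.frac ∔ (h.frac - k.fracᶜ) ∔ k.fracᶜ := by
    rw [oplus_assoc, oplus_comm _ k.fracᶜ, oplus_sub_cancel hk]
  have hval : g.frac ∔ h.frac - k.fracᶜ = g.frac ∔ (h.frac - k.fracᶜ) := by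
    rw [hsum]
    refine oplus_sub_eq (le_compl_of_oplus_ne ?_)
    rwa [oplus_comm, ← hsum]
  have hleft : (g + h).frac ∔ k.frac = 0ᶜ := by
    rw [frac_add_of_ne hgh, oplus_assoc, hhk, oplus_comm, oplus_eq_compl_zero_iff, compl_compl]
    exact zero_le _
  have hright : g.frac ∔ (h + k).frac ≠ 0ᶜ := by
    rw [frac_add_of_eq hhk, ← hval]
    exact ne_compl_zero_of_le (sub_le _ _) hgh
  ext
  · rw [int_add_of_eq hleft, int_add_of_ne hright, int_add_of_ne hgh, int_add_of_eq hhk]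
    ring
  · rw [frac_add_of_eq hleft, frac_add_of_ne hright, frac_add_of_ne hgh, frac_add_of_eq hhk, hval]

theorem add_assoc_of_ne_of_ne {g h k : ChangGroup A} (hgh : g.frac ∔ h.frac ≠ 0ᶜ)
    (hhk : h.frac ∔ k.frac ≠ 0ᶜ) : g + h + k = g + (h + k) := by
  have hassoc : (g + h).frac ∔ k.frac = g.frac ∔ (h + k).frac := by
    rw [frac_add_of_ne hgh, frac_add_of_ne hhk, oplus_assoc]
  by_cases hleft : (g + h).frac ∔ k.frac = 0ᶜ
  · have hright := hassoc ▸ hleft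
    ext
    · rw [int_add_of_eq hleft, int_add_of_eq hright, int_add_of_ne hgh, int_add_of_ne hhk]
      ring
    · rw [frac_add_of_eq hleft, frac_add_of_eq hright, frac_add_of_ne hgh, frac_add_of_ne hhk]
      have hg : h.frac ≤ g.fracᶜ := le_compl_of_oplus_ne hgh
      have hk : h.frac ≤ k.fracᶜ := le_compl_of_oplus_ne (by rwa [oplus_comm])
      have key := congrArg Compl.compl (sub_oplus_comm hg hk)
      rw [compl_oplus, compl_oplus, compl_compl] at key
      rw [oplus_comm h.frac, compl_oplus]
      exact key
  · have hright := hassoc ▸ hleft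
    ext
    · rw [int_add_of_ne hleft, int_add_of_ne hright, int_add_of_ne hgh, int_add_of_ne hhk]
      ring
    · rw [frac_add_of_ne hleft, frac_add_of_ne hright, hassoc]

theorem add_assoc_of_eq_of_eq {g h k : ChangGroup A} (hgh : g.frac ∔ h.frac = 0ᶜ)
    (hhk : h.frac ∔ k.frac = 0ᶜ) : g + h + k = g + (h + k) := by
  have hg : h.fracᶜ ≤ g.frac := by
    rwa [← oplus_eq_compl_zero_iff, oplus_comm]
  have hk : h.fracᶜ ≤ k.frac := oplus_eq_compl_zero_iff.1 hhk
  have hassoc : (g + h).frac ∔ k.frac = g.frac ∔ (h + k).frac := by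
    rw [frac_add_of_eq hgh, frac_add_of_eq hhk, sub_oplus_comm hg hk, sub_compl_comm]
  by_cases hleft : (g + h).frac ∔ k.frac = 0ᶜ
  · have hright := hassoc ▸ hleft
    ext
    · rw [int_add_of_eq hleft, int_add_of_eq hright, int_add_of_eq hgh, int_add_of_eq hhk]
      ring
    · rw [frac_add_of_eq hleft, frac_add_of_eq hright, frac_add_of_eq hgh, frac_add_of_eq hhk,
        sub_compl_comm g.frac h.frac, sub_right_comm, sub_compl_comm g.frac]
  · have hright := hassoc ▸ hleft
    ext
    · rw [int_add_of_ne hleft, int_add_of_ne hright, int_add_of_eq hgh, int_add_of_eq hhk]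
      ring
    · rw [frac_add_of_ne hleft, frac_add_of_ne hright, hassoc]

protected theorem add_assoc (g h k : ChangGroup A) : g + h + k = g + (h + k) := by
  by_cases hgh : g.frac ∔ h.frac = 0ᶜ <;> by_cases hhk : h.frac ∔ k.frac = 0ᶜ
  · exact add_assoc_of_eq_of_eq hgh hhk
  · rw [oplus_comm] at hgh hhk
    rw [ChangGroup.add_comm g (h + k), ChangGroup.add_comm h k, add_assoc_of_ne_of_eq hhk hgh,
      ChangGroup.add_comm h g, ChangGroup.add_comm k]
  · exact add_assoc_of_ne_of_eq hgh hhk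
  · exact add_assoc_of_ne_of_ne hgh hhk

protected theorem zero_add (g : ChangGroup A) : 0 + g = g := by
  have h : (0 : ChangGroup A).frac ∔ g.frac ≠ 0ᶜ := by
    rw [frac_zero, zero_oplus]
    exact g.frac_ne
  ext
  · rw [int_add_of_ne h, int_zero, _root_.zero_add]
  · rw [frac_add_of_ne h, frac_zero, zero_oplus]

protected theorem neg_add_cancel (g : ChangGroup A) : -g + g = 0 := by
  by_cases hg : g.frac = 0
  · have h : (-g).frac ∔ g.frac ≠ 0ᶜ := by
      rw [(neg_of_eq hg).2, zero_oplus]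
      exact g.frac_ne
    ext
    · rw [int_add_of_ne h, (neg_of_eq hg).1, int_zero, _root_.neg_add_cancel]
    · rw [frac_add_of_ne h, (neg_of_eq hg).2, zero_oplus, hg, frac_zero]
  · have h : (-g).frac ∔ g.frac = 0ᶜ := by
      rw [(neg_of_ne hg).2, oplus_comm, oplus_compl_self]
    ext
    · rw [int_add_of_eq h, (neg_of_ne hg).1, int_zero]
      ring
    · rw [frac_add_of_eq h, (neg_of_ne hg).2, frac_zero, sub_self]

noncomputable instance : AddCommGroup (ChangGroup A) where
  add_assoc := ChangGroup.add_assoc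
  zero_add := ChangGroup.zero_add
  add_zero g := by rw [ChangGroup.add_comm, ChangGroup.zero_add]
  neg_add_cancel := ChangGroup.neg_add_cancel
  add_comm := ChangGroup.add_comm
  nsmul := nsmulRec
  zsmul := zsmulRec

/-- The cone of elements with nonnegative integer part. -/
def cone (A : Type*) [WajsbergChain A] : AddGroupCone (ChangGroup A) where
  carrier := {g | 0 ≤ g.int}
  zero_mem' := le_refl (0 : ℤ)
  add_mem' {g h} hg hh := by
    change 0 ≤ g.int at hg
    change 0 ≤ h.int at hh
    change 0 ≤ (g + h).int
    by_cases hgh : g.frac ∔ h.frac = 0ᶜ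
    · rw [int_add_of_eq hgh]
      omega
    · rw [int_add_of_ne hgh]
      omega
  eq_zero_of_mem_of_neg_mem' {g} hg hg' := by
    change 0 ≤ g.int at hg
    change 0 ≤ (-g).int at hg'
    by_cases h : g.frac = 0
    · rw [(neg_of_eq h).1] at hg'
      ext
      · rw [int_zero]
        omega
      · rw [h, frac_zero]
    · rw [(neg_of_ne h).1] at hg'
      omega

theorem mem_cone {g : ChangGroup A} : g ∈ cone A ↔ 0 ≤ g.int := Iff.rfl

instance : HasMemOrNegMem (cone A) where
  mem_or_neg_mem g := by
    rw [mem_cone, mem_cone]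
    by_cases h : g.frac = 0
    · rw [(neg_of_eq h).1]
      omega
    · rw [(neg_of_ne h).1]
      omega

instance : DecidablePred (· ∈ cone A) := fun g => Int.decLe 0 g.int

noncomputable instance : LinearOrder (ChangGroup A) := LinearOrder.mkOfAddGroupCone (cone A)

instance : IsOrderedAddMonoid (ChangGroup A) := IsOrderedAddMonoid.mkOfCone (cone A)

theorem nonneg_iff {g : ChangGroup A} : 0 ≤ g ↔ 0 ≤ g.int := by
  change g - 0 ∈ cone A ↔ _
  rw [_root_.sub_zero, mem_cone]

open Classical in
/-- The embedding of a Wajsberg chain as an initial interval of its Chang group. -/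
noncomputable def of (a : A) : ChangGroup A :=
  if h : a = 0ᶜ then ⟨1, 0, WajsbergChain.zero_ne_compl_zero⟩ else ⟨0, a, h⟩

theorem of_compl_zero : of (0ᶜ : A) = ⟨1, 0, WajsbergChain.zero_ne_compl_zero⟩ := dif_pos rfl

theorem of_of_ne {a : A} (h : a ≠ 0ᶜ) : of a = ⟨0, a, h⟩ := dif_neg h

theorem of_zero : of (0 : A) = 0 := of_of_ne WajsbergChain.zero_ne_compl_zero

theorem of_nonneg (a : A) : 0 ≤ of a := by
  rw [nonneg_iff]
  by_cases h : a = 0ᶜ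
  · rw [h, of_compl_zero]
    exact zero_le_one
  · rw [of_of_ne h]

theorem of_eq_zero_iff {a : A} : of a = 0 ↔ a = 0 := by
  refine ⟨fun h => ?_, fun h => h ▸ of_zero⟩
  by_cases ha : a = 0ᶜ
  · rw [ha, of_compl_zero] at h
    exact absurd (congrArg int h) one_ne_zero
  · rw [of_of_ne ha] at h
    exact congrArg frac h

theorem of_add_of_sub {a b : A} (hab : a ≤ b) : of a + of (b - a) = of b := by
  by_cases ha : a = 0ᶜ
  · obtain rfl : a = b := le_antisymm hab (ha ▸ le_compl_zero b)
    rw [sub_self, of_zero, add_zero]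
  by_cases ha0 : a = 0
  · rw [ha0, of_zero, sub_zero, zero_add]
  by_cases hb : b = 0ᶜ
  · have hac : aᶜ ≠ 0ᶜ := fun h => ha0 (by rw [← compl_compl a, h, compl_compl])
    rw [hb, compl_zero_sub, of_of_ne ha, of_of_ne hac, of_compl_zero]
    have h := oplus_compl_self a
    ext
    · exact int_add_of_eq h
    · exact (frac_add_of_eq h).trans (by rw [compl_compl, sub_self])
  · have hba : b - a ≠ 0ᶜ := ne_compl_zero_of_le (sub_le b a) hb
    have h : a ∔ (b - a) = b := oplus_sub_cancel hab
    rw [of_of_ne ha, of_of_ne hba, of_of_ne hb]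
    have h' : a ∔ (b - a) ≠ 0ᶜ := by rwa [h]
    ext
    · exact int_add_of_ne h'
    · exact (frac_add_of_ne h').trans h

theorem of_sub (a b : A) : of (a - b) = max (of a - of b) 0 := by
  rcases WajsbergChain.le_total a b with h | h
  · rw [le_iff.1 h, of_zero, ← of_add_of_sub h, max_eq_right]
    simpa using of_nonneg (b - a)
  · rw [← of_add_of_sub h, add_sub_cancel_left, max_eq_left (of_nonneg _)]

theorem of_compl (a : A) : of aᶜ = of 0ᶜ - of a := by
  rw [← of_add_of_sub (le_compl_zero a), compl_zero_sub, add_sub_cancel_left]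

end ChangGroup

end WajsbergAlgebra

/-! ### Finite subsets of ordered abelian groups embed in the reals -/

theorem exists_addMonoidHom_pos {G : Type*} [AddCommGroup G] [LinearOrder G]
    [IsOrderedAddMonoid G] (F : Finset G) (hF : ∀ g ∈ F, 0 < g) :
    ∃ f : G →+ ℝ, ∀ g ∈ F, 0 < f g := by
  obtain ⟨e, he, -⟩ := hahnEmbedding_isOrderedAddMonoid G
  have hlead (g : G) (hg : 0 < g) : ∃ c, (∀ d < c, (ofLex (e g)).coeff d = 0) ∧
      0 < (ofLex (e g)).coeff c := by
    have hlt : e 0 < e g := (e.monotone'.strictMono_of_injective he) hg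
    rw [map_zero, HahnSeries.lt_iff] at hlt
    obtain ⟨c, hc, hpos⟩ := hlt
    exact ⟨c, fun d hd => (hc d hd).symm, hpos⟩
  rcases F.eq_empty_or_nonempty with rfl | ⟨g, hg⟩
  · exact ⟨0, by simp⟩
  have : Nonempty (FiniteArchimedeanClass G) := (hlead g (hF g hg)).nonempty
  clear hg g
  choose! c hc hpos using hlead
  induction F using Finset.strongInduction with
  | H F ih =>
    rcases F.eq_empty_or_nonempty with rfl | hne
    · exact ⟨0, by simp⟩
    obtain ⟨g₀, hg₀, hmin⟩ := F.exists_min_image c hne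
    let k : G →+ ℝ :=
      { toFun := fun g => (ofLex (e g)).coeff (c g₀)
        map_zero' := by simp
        map_add' := by simp }
    have hk : ∀ g ∈ F, 0 ≤ k g := by
      intro g hg
      rcases (hmin g hg).eq_or_lt with h | h
      · change 0 ≤ (ofLex (e g)).coeff (c g₀)
        rw [h]
        exact (hpos g (hF g hg)).le
      · exact (hc g (hF g hg) _ h).ge
    obtain ⟨f, hf⟩ := ih (F.filter fun g => k g = 0)
      (Finset.filter_ssubset.2 ⟨g₀, hg₀, (hpos g₀ (hF g₀ hg₀)).ne'⟩)
      (fun g hg => hF g (Finset.mem_filter.1 hg).1)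
    obtain ⟨N, hN⟩ : ∃ N : ℕ, ∀ g ∈ F, k g ≠ 0 → 0 < N * k g + f g := by
      have hev : ∀ g ∈ F, ∀ᶠ N : ℕ in Filter.atTop, k g ≠ 0 → 0 < N * k g + f g := by
        intro g hg
        by_cases h0 : k g = 0
        · simp [h0]
        have hkg : 0 < k g := (hk g hg).lt_of_ne' h0
        have ht : Filter.Tendsto (fun N : ℕ => (N : ℝ) * k g + f g) Filter.atTop Filter.atTop :=
          Filter.tendsto_atTop_add_const_right _ _
            (tendsto_natCast_atTop_atTop.atTop_mul_const hkg)
        filter_upwards [ht.eventually_gt_atTop 0] with N hN _ using hN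
      exact ((Filter.eventually_all_finset F).2 hev).exists
    refine ⟨N • k + f, fun g hg => ?_⟩
    by_cases h0 : k g = 0
    · simpa [h0] using hf g (Finset.mem_filter.2 ⟨hg, h0⟩)
    · simpa using hN g hg h0

theorem exists_addMonoidHom_strictMonoOn {G : Type*} [AddCommGroup G] [LinearOrder G]
    [IsOrderedAddMonoid G] {Y : Set G} (hY : Y.Finite) :
    ∃ f : G →+ ℝ, StrictMonoOn f Y := by
  classical
  obtain ⟨f, hf⟩ := exists_addMonoidHom_pos
    (((hY.toFinset ×ˢ hY.toFinset).image fun p => p.1 - p.2).filter (0 < ·))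
    (fun g hg => (Finset.mem_filter.1 hg).2)
  refine ⟨f, fun x hx y hy hxy => ?_⟩
  have h : 0 < f (y - x) := by
    refine hf _ (Finset.mem_filter.2 ⟨Finset.mem_image.2 ⟨(y, x), ?_, rfl⟩, sub_pos.2 hxy⟩)
    simp [hx, hy]
  rwa [map_sub, sub_pos] at h

/-! ### Lindenbaum algebras -/

namespace LukFormula

variable {I : Type*} {Γ Δ : Set (LukFormula I)} {φ ψ χ : LukFormula I}

namespace Deduces

theorem mono (h : Γ ⊆ Δ) (hφ : Deduces Γ φ) : Deduces Δ φ := by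
  induction hφ with
  | ax h => exact ax h
  | prem h' => exact prem (h h')
  | mp _ _ ih₁ ih₂ => exact mp ih₁ ih₂

theorem sub_antitone (h : Deduces Γ (sub ψ φ)) (χ : LukFormula I) :
    Deduces Γ (sub (sub χ φ) (sub χ ψ)) := mp h (ax (.a2 φ ψ χ))

theorem trans (h₁ : Deduces Γ (sub φ ψ)) (h₂ : Deduces Γ (sub ψ χ)) : Deduces Γ (sub φ χ) :=
  mp h₁ (sub_antitone h₂ φ)

theorem land_right (φ ψ : LukFormula I) : Deduces Γ (sub (land φ ψ) ψ) :=
  trans (ax (.a3 φ ψ)) (ax (.a1 ψ (sub ψ φ)))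

theorem sub_deduced (h : Deduces Γ ψ) (φ : LukFormula I) : Deduces Γ (sub φ (sub φ ψ)) :=
  mp h (land_right φ ψ)

theorem refl (φ : LukFormula I) : Deduces Γ (sub φ φ) :=
  trans (sub_deduced (ax (.a1 φ φ)) φ) (ax (.a1 φ _))

theorem exchange (φ ψ χ : LukFormula I) :
    Deduces Γ (sub (sub (sub φ ψ) χ) (sub (sub φ χ) ψ)) :=
  trans (sub_antitone (land_right φ χ) (sub φ ψ)) (ax (.a2 ψ (sub φ χ) φ))

theorem sub_monotone (h : Deduces Γ (sub φ ψ)) (χ : LukFormula I) :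
    Deduces Γ (sub (sub φ χ) (sub ψ χ)) :=
  mp h (mp (ax (.a2 χ ψ φ)) (exchange (sub φ χ) (sub ψ χ) (sub φ ψ)))

theorem le_neg_neg (φ : LukFormula I) : Deduces Γ (sub φ (neg (neg φ))) := by
  have h : Deduces Γ (sub φ φ) := refl φ
  exact trans (sub_deduced h φ) (trans (ax (.a4 _ _)) (trans (ax (.a4 _ _)) (ax (.a1 _ _))))

theorem neg_neg_le (φ : LukFormula I) : Deduces Γ (sub (neg (neg φ)) φ) :=
  mp (le_neg_neg (neg φ)) (ax (.a4 _ _))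

theorem neg_sub_neg (φ ψ : LukFormula I) :
    Deduces Γ (sub (sub (neg ψ) (neg φ)) (sub φ ψ)) :=
  trans (ax (.a4 _ _)) (trans (sub_monotone (neg_neg_le φ) _) (sub_antitone (le_neg_neg ψ) φ))

theorem neg_antitone (h : Deduces Γ (sub φ ψ)) : Deduces Γ (sub (neg ψ) (neg φ)) :=
  mp h (neg_sub_neg φ ψ)

theorem sub_of_deduced (h : Deduces Γ φ) (ψ : LukFormula I) : Deduces Γ (sub φ ψ) :=
  mp h (ax (.a1 φ ψ))

end Deduces

/-- Provable equivalence from `Γ`. -/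
def lindenbaumSetoid (Γ : Set (LukFormula I)) : Setoid (LukFormula I) where
  r φ ψ := Deduces Γ (sub φ ψ) ∧ Deduces Γ (sub ψ φ)
  iseqv :=
    { refl := fun φ => ⟨.refl φ, .refl φ⟩
      symm := fun h => ⟨h.2, h.1⟩
      trans := fun h₁ h₂ => ⟨h₁.1.trans h₂.1, h₂.2.trans h₁.2⟩ }

/-- The algebra of formulas modulo provable equivalence from `Γ`. -/
def Lindenbaum (Γ : Set (LukFormula I)) : Type _ := Quotient (lindenbaumSetoid Γ)

namespace Lindenbaum

/-- The class of a formula. -/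
def mk (Γ : Set (LukFormula I)) (φ : LukFormula I) : Lindenbaum Γ :=
  Quotient.mk (lindenbaumSetoid Γ) φ

theorem mk_eq_mk : mk Γ φ = mk Γ ψ ↔ Deduces Γ (sub φ ψ) ∧ Deduces Γ (sub ψ φ) :=
  Quotient.eq (r := lindenbaumSetoid Γ)

theorem mk_eq_mk_of_deduces (hφ : Deduces Γ φ) (hψ : Deduces Γ ψ) : mk Γ φ = mk Γ ψ :=
  mk_eq_mk.2 ⟨.sub_of_deduced hφ ψ, .sub_of_deduced hψ φ⟩

variable [Nonempty (LukFormula I)]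

noncomputable instance : WajsbergAlgebra (Lindenbaum Γ) where
  zero := mk Γ (sub (Classical.arbitrary _) (Classical.arbitrary _))
  sub := Quotient.map₂ sub fun _ _ h₁ _ _ h₂ =>
    ⟨(h₁.1.sub_monotone _).trans (h₂.2.sub_antitone _),
      (h₁.2.sub_monotone _).trans (h₂.1.sub_antitone _)⟩
  compl := Quotient.map neg fun _ _ h => ⟨h.2.neg_antitone, h.1.neg_antitone⟩
  sub_zero := Quotient.ind fun _ => mk_eq_mk.2 ⟨.ax (.a1 _ _), .sub_deduced (.refl _) _⟩
  zero_sub := Quotient.ind fun _ => mk_eq_mk_of_deduces (.sub_of_deduced (.refl _) _) (.refl _)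
  sub_sub_sub := by
    rintro ⟨φ⟩ ⟨ψ⟩ ⟨χ⟩
    exact mk_eq_mk_of_deduces (.ax (.a2 φ ψ χ)) (.refl _)
  inf_comm := Quotient.ind₂ fun _ _ => mk_eq_mk.2 ⟨.ax (.a3 _ _), .ax (.a3 _ _)⟩
  compl_sub_compl := Quotient.ind₂ fun _ _ => mk_eq_mk.2 ⟨.neg_sub_neg _ _, .ax (.a4 _ _)⟩
  compl_compl := Quotient.ind fun _ => mk_eq_mk.2 ⟨.neg_neg_le _, .le_neg_neg _⟩

theorem mk_sub (φ ψ : LukFormula I) : mk Γ (sub φ ψ) = mk Γ φ - mk Γ ψ := rfl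

theorem mk_neg (φ : LukFormula I) : mk Γ (neg φ) = (mk Γ φ)ᶜ := rfl

theorem mk_eq_zero_iff : mk Γ φ = 0 ↔ Deduces Γ φ :=
  ⟨fun h => .mp (.refl _) (mk_eq_mk.1 h).1, fun h => mk_eq_mk_of_deduces h (.refl _)⟩

theorem mk_le_mk_iff : mk Γ φ ≤ mk Γ ψ ↔ Deduces Γ (sub φ ψ) := mk_eq_zero_iff

/-- The local deduction theorem. -/
theorem exists_iterate_sub_eq_zero (h : Deduces (insert χ Γ) φ) :
    ∃ n : ℕ, (· - mk Γ χ)^[n] (mk Γ φ) = 0 := by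
  induction h with
  | ax h => exact ⟨0, mk_eq_zero_iff.2 (.ax h)⟩
  | prem h =>
    rcases h with rfl | h
    · exact ⟨1, WajsbergAlgebra.sub_self _⟩
    · exact ⟨0, mk_eq_zero_iff.2 (.prem h)⟩
  | @mp φ ψ _ _ ih₁ ih₂ =>
    obtain ⟨n, hn⟩ := ih₁
    obtain ⟨m, hm⟩ := ih₂
    refine ⟨n + m, ?_⟩
    rw [mk_sub, WajsbergAlgebra.iterate_sub_sub, ← WajsbergAlgebra.le_iff] at hm
    have h := WajsbergAlgebra.iterate_sub_mono hm (mk Γ χ) n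
    rwa [hn, WajsbergAlgebra.le_zero_iff, ← Function.iterate_add_apply] at h

end Lindenbaum

/-! ### Prime extensions -/

theorem Deduces.exists_mem_of_sUnion {c : Set (Set (LukFormula I))} (hc : IsChain (· ⊆ ·) c)
    (hne : c.Nonempty) (h : Deduces (⋃₀ c) φ) : ∃ s ∈ c, Deduces s φ := by
  induction h with
  | ax h =>
    obtain ⟨s, hs⟩ := hne
    exact ⟨s, hs, .ax h⟩
  | prem h =>
    obtain ⟨s, hs, h⟩ := h
    exact ⟨s, hs, .prem h⟩
  | mp _ _ ih₁ ih₂ =>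
    obtain ⟨s, hs, h₁⟩ := ih₁
    obtain ⟨t, ht, h₂⟩ := ih₂
    rcases hc.total hs ht with h | h
    · exact ⟨t, ht, (h₁.mono h).mp h₂⟩
    · exact ⟨s, hs, h₁.mp (h₂.mono h)⟩

theorem exists_prime_extension (h : ¬ Deduces Γ φ) :
    ∃ Δ, Γ ⊆ Δ ∧ ¬ Deduces Δ φ ∧ ∀ α β, Deduces Δ (sub α β) ∨ Deduces Δ (sub β α) := by
  have : Nonempty (LukFormula I) := ⟨φ⟩
  obtain ⟨Δ, hΓΔ, hΔ⟩ := zorn_subset_nonempty {Δ | ¬ Deduces Δ φ}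
    (fun c hcS hc hne => ⟨⋃₀ c, fun hφ => by
      obtain ⟨s, hs, hφ⟩ := hφ.exists_mem_of_sUnion hc hne
      exact hcS hs hφ, fun s hs => Set.subset_sUnion_of_mem hs⟩) Γ h
  refine ⟨Δ, hΓΔ, hΔ.prop, fun α β => ?_⟩
  have key (χ : LukFormula I) (hχ : ¬ Deduces Δ χ) : Deduces (insert χ Δ) φ := by
    by_contra hφ
    exact hχ (.prem (hΔ.le_of_ge hφ (Set.subset_insert χ Δ) (Set.mem_insert χ Δ)))
  by_contra! hαβ
  obtain ⟨n, hn⟩ := Lindenbaum.exists_iterate_sub_eq_zero (key _ hαβ.1)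
  obtain ⟨m, hm⟩ := Lindenbaum.exists_iterate_sub_eq_zero (key _ hαβ.2)
  rw [Lindenbaum.mk_sub] at hn hm
  exact hΔ.prop (Lindenbaum.mk_eq_zero_iff.1
    (WajsbergAlgebra.eq_zero_of_iterate_sub (WajsbergAlgebra.sub_sub_sub_symm _ _) hn hm))

/-! ### Real-valued models -/

/-- The set of subformulas of a formula, including the formula itself. -/
def subformulas : LukFormula I → Set (LukFormula I)
  | atom i => {atom i}
  | neg φ => insert (neg φ) (subformulas φ)
  | sub φ ψ => insert (sub φ ψ) (subformulas φ ∪ subformulas ψ)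

theorem finite_subformulas (φ : LukFormula I) : φ.subformulas.Finite := by
  induction φ with
  | atom i => exact Set.finite_singleton _
  | neg φ ih => exact ih.insert _
  | sub φ ψ ih₁ ih₂ => exact (ih₁.union ih₂).insert _

theorem self_mem_subformulas (φ : LukFormula I) : φ ∈ φ.subformulas := by
  cases φ <;> simp [subformulas]

open WajsbergAlgebra ChangGroup in
theorem exists_assignment_of_chain {A : Type*} [WajsbergChain A] (w : LukFormula I → A)
    (hneg : ∀ φ, w (neg φ) = (w φ)ᶜ) (hsub : ∀ φ ψ, w (sub φ ψ) = w φ - w ψ)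
    {X : Set (LukFormula I)} (hX : X.Finite) :
    ∃ v : I → ℝ, IsAssignment v ∧ ∀ φ ∈ X, eval v φ = 0 ↔ w φ = 0 := by
  classical
  let Y : Set (ChangGroup A) :=
    {0, of 0ᶜ} ∪ (fun φ => of (w φ)) '' ⋃ φ ∈ X, φ.subformulas
  have hYfin : Y.Finite := (Set.toFinite _).union
    ((hX.biUnion fun φ _ => finite_subformulas φ).image _)
  obtain ⟨f, hf⟩ := exists_addMonoidHom_strictMonoOn hYfin
  have h0 : (0 : ChangGroup A) ∈ Y := by simp [Y]
  have h1 : of (0ᶜ : A) ∈ Y := by simp [Y]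
  have hupper (a : A) : of a ≤ of 0ᶜ := by
    rw [← sub_nonneg, ← of_compl]
    exact of_nonneg _
  have hpos : 0 < f (of 0ᶜ) := by
    have hne : of (0ᶜ : A) ≠ 0 := fun h =>
      WajsbergChain.zero_ne_compl_zero (of_eq_zero_iff.1 h).symm
    simpa using hf h0 h1 ((of_nonneg _).lt_of_ne' hne)
  let v : I → ℝ := fun i =>
    if of (w (atom i)) ∈ Y then f (of (w (atom i))) / f (of 0ᶜ) else 0
  have heval (φ : LukFormula I) (hφ : ∀ ψ ∈ φ.subformulas, of (w ψ) ∈ Y) :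
      eval v φ = f (of (w φ)) / f (of 0ᶜ) := by
    induction φ with
    | atom i => exact if_pos (hφ _ (self_mem_subformulas _))
    | neg φ ih =>
      rw [eval, ih fun ψ hψ => hφ ψ (Set.mem_insert_of_mem _ hψ), hneg, of_compl (w φ),
        map_sub, sub_div, div_self hpos.ne']
    | sub φ ψ ih₁ ih₂ =>
      have hφ' : ∀ χ ∈ φ.subformulas, of (w χ) ∈ Y := fun χ hχ =>
        hφ χ (Set.mem_insert_of_mem _ (Or.inl hχ))
      have hψ' : ∀ χ ∈ ψ.subformulas, of (w χ) ∈ Y := fun χ hχ =>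
        hφ χ (Set.mem_insert_of_mem _ (Or.inr hχ))
      have hφY := hφ' φ (self_mem_subformulas φ)
      have hψY := hψ' ψ (self_mem_subformulas ψ)
      rw [eval, ih₁ hφ', ih₂ hψ', hsub, of_sub, ← sub_div]
      rcases le_total (of (w φ)) (of (w ψ)) with h | h
      · rw [max_eq_right (sub_nonpos.2 h), map_zero, zero_div, max_eq_right]
        exact div_nonpos_of_nonpos_of_nonneg (sub_nonpos.2 (hf.monotoneOn hφY hψY h)) hpos.le
      · rw [max_eq_left (sub_nonneg.2 h), map_sub, max_eq_left]
        exact div_nonneg (sub_nonneg.2 (hf.monotoneOn hψY hφY h)) hpos.le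
  refine ⟨v, fun i => ?_, fun φ hφ => ?_⟩
  · by_cases hi : of (w (atom i)) ∈ Y
    · have hv : v i = f (of (w (atom i))) / f (of 0ᶜ) := if_pos hi
      rw [hv, Set.mem_Icc, le_div_iff₀ hpos, div_le_one hpos, zero_mul]
      refine ⟨?_, hf.monotoneOn hi h1 (hupper _)⟩
      simpa using hf.monotoneOn h0 hi (of_nonneg _)
    · have hv : v i = 0 := if_neg hi
      simp [hv]
  · have hY : ∀ ψ ∈ φ.subformulas, of (w ψ) ∈ Y := fun ψ hψ =>
      Or.inr ⟨ψ, Set.mem_biUnion hφ hψ, rfl⟩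
    rw [heval φ hY, div_eq_zero_iff, or_iff_left hpos.ne', ← map_zero f,
      hf.injOn.eq_iff (hY φ (self_mem_subformulas φ)) h0, of_eq_zero_iff]

theorem eval_mem_Icc {v : I → ℝ} (hv : IsAssignment v) (φ : LukFormula I) :
    eval v φ ∈ Set.Icc (0 : ℝ) 1 := by
  induction φ with
  | atom i => exact hv i
  | neg φ ih => exact ⟨sub_nonneg.2 ih.2, sub_le_self 1 ih.1⟩
  | sub φ ψ ih₁ ih₂ =>
    exact ⟨le_max_right _ _, max_le (by linarith [ih₁.2, ih₂.1]) zero_le_one⟩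

theorem Deduces.eval_eq_zero {v : I → ℝ} (hv : IsAssignment v) (hΓ : ∀ ψ ∈ Γ, eval v ψ = 0)
    (h : Deduces Γ φ) : eval v φ = 0 := by
  induction h with
  | prem h => exact hΓ _ h
  | @mp φ ψ _ _ ih₁ ih₂ =>
    rw [eval, ih₁, sub_zero, max_eq_right_iff] at ih₂
    exact le_antisymm ih₂ (eval_mem_Icc hv ψ).1
  | ax h =>
    cases h with
    | a1 φ ψ =>
      have := eval_mem_Icc hv φ
      have := eval_mem_Icc hv ψ
      simp only [eval, Set.mem_Icc] at *
      grind
    | a2 φ ψ χ =>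
      simp only [eval]
      grind
    | a3 φ ψ =>
      have := eval_mem_Icc hv φ
      have := eval_mem_Icc hv ψ
      simp only [eval, land, Set.mem_Icc] at *
      grind
    | a4 φ ψ =>
      simp only [eval]
      grind

end LukFormula

/-- Completeness with finitely many premises: for finite `Γ`, `Γ ⊨ φ` iff `Γ ⊢ φ`. -/
theorem completeness_finite_premises {I : Type*} (Γ : Set (LukFormula I)) (hΓ : Γ.Finite)
    (φ : LukFormula I) :
    (∀ v : I → ℝ, IsAssignment v → (∀ ψ ∈ Γ, eval v ψ = 0) → eval v φ = 0) ↔ Deduces Γ φ := by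
  refine ⟨fun h => ?_, fun h v hv hvΓ => h.eval_eq_zero hv hvΓ⟩
  by_contra hφ
  obtain ⟨Δ, hΓΔ, hΔ, htotal⟩ := exists_prime_extension hφ
  have : Nonempty (LukFormula I) := ⟨φ⟩
  let chain : WajsbergChain (Lindenbaum Δ) :=
    { le_total := Quotient.ind₂ fun α β =>
        (htotal α β).imp Lindenbaum.mk_le_mk_iff.2 Lindenbaum.mk_le_mk_iff.2
      zero_ne_compl_zero := fun h01 => hΔ <| Lindenbaum.mk_eq_zero_iff.1 <|
        WajsbergAlgebra.le_zero_iff.1 (h01 ▸ WajsbergAlgebra.le_compl_zero _) }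
  obtain ⟨v, hv, hX⟩ := exists_assignment_of_chain (Lindenbaum.mk Δ) Lindenbaum.mk_neg
    Lindenbaum.mk_sub (hΓ.insert φ)
  refine hΔ (Lindenbaum.mk_eq_zero_iff.1 ((hX φ (Set.mem_insert φ Γ)).1 (h v hv fun ψ hψ => ?_)))
  exact (hX ψ (Set.mem_insert_of_mem φ hψ)).2 (Lindenbaum.mk_eq_zero_iff.2 (.prem (hΓΔ hψ)))

end Stmt3
end

section
/- Let S be a Łukasiewicz logic and let Σ ⊆ S be an arbitrary set of formulas. Then Σ is consistent (in the deduction system A1–A4 with Modus Ponens) if and only if Σ has a model, i.e. there is a truth assignment v with v(φ) = 0 for all φ ∈ Σ. -/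
namespace Stmt4

/-- Formulas of Łukasiewicz logic, freely generated from atomic propositions indexed by `I`
by the binary connective `∸` and the unary connective `¬`. -/
inductive LukFormula (I : Type*) : Type _ where
  | atom : I → LukFormula I
  | neg : LukFormula I → LukFormula I
  | sub : LukFormula I → LukFormula I → LukFormula I

namespace LukFormula

variable {I : Type*}

/-- The truth value of a formula under an assignment of truth values to the atoms. -/
def eval (v : I → ℝ) : LukFormula I → ℝ
  | atom i => v i
  | neg φ => 1 - eval v φ
  | sub φ ψ => max (eval v φ - eval v ψ) 0

/-- A truth assignment is determined by the truth values of the atoms, in `[0,1]`. -/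
def IsAssignment (v : I → ℝ) : Prop := ∀ i, v i ∈ Set.Icc (0 : ℝ) 1

/-- `φ ∧ ψ` abbreviates `φ ∸ (φ ∸ ψ)`. -/
def land (φ ψ : LukFormula I) : LukFormula I := sub φ (sub φ ψ)

/-- The axiom schemes A1–A4 of the Rose–Rosser deduction system. -/
inductive LukAxiom : LukFormula I → Prop where
  | a1 (φ ψ : LukFormula I) : LukAxiom (sub (sub φ ψ) φ)
  | a2 (φ ψ ρ : LukFormula I) : LukAxiom (sub (sub (sub ρ φ) (sub ρ ψ)) (sub ψ φ))
  | a3 (φ ψ : LukFormula I) : LukAxiom (sub (land φ ψ) (land ψ φ))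
  | a4 (φ ψ : LukFormula I) : LukAxiom (sub (sub φ ψ) (sub (neg ψ) (neg φ)))

/-- Formal deduction from a set of premises `Γ`, using the axiom schemes A1–A4 and
Modus Ponens (from `φ` and `ψ ∸ φ` infer `ψ`). -/
inductive Deduces (Γ : Set (LukFormula I)) : LukFormula I → Prop where
  | ax {φ : LukFormula I} : LukAxiom φ → Deduces Γ φ
  | prem {φ : LukFormula I} : φ ∈ Γ → Deduces Γ φ
  | mp {φ ψ : LukFormula I} : Deduces Γ φ → Deduces Γ (sub ψ φ) → Deduces Γ ψ

end LukFormula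

/-- Bounded commutative BCK-algebras, the algebras of Łukasiewicz logic: `0` is the class of the
theorems, `1` the class of their negations, and the negation of `x` is `1 - x`. -/
class LukAlgebra (A : Type*) extends Sub A, Zero A, One A where
  sub_self (x : A) : x - x = 0
  sub_zero (x : A) : x - 0 = x
  zero_sub (x : A) : 0 - x = 0
  sub_one (x : A) : x - 1 = 0
  inf_comm (x y : A) : x - (x - y) = y - (y - x)
  sub_right_comm (x y z : A) : x - y - z = x - z - y

namespace LukAlgebra

variable {A : Type*} [LukAlgebra A]

theorem sub_sub_sub_sub (x y z : A) : z - x - (z - y) - (y - x) = 0 := by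
  rw [sub_right_comm z, inf_comm, sub_right_comm y, sub_right_comm, sub_self, zero_sub]

instance : PartialOrder A where
  le x y := x - y = 0
  le_refl := sub_self
  le_trans x y z hxy hyz := by
    have h := sub_sub_sub_sub z y x
    rwa [hxy, hyz, sub_zero, sub_zero] at h
  le_antisymm x y hxy hyx := by
    have h := inf_comm x y
    rwa [hxy, hyx, sub_zero, sub_zero] at h

theorem le_def {x y : A} : x ≤ y ↔ x - y = 0 := Iff.rfl

theorem zero_le (x : A) : 0 ≤ x := zero_sub x

theorem le_one (x : A) : x ≤ 1 := sub_one x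

theorem le_zero_iff {x : A} : x ≤ 0 ↔ x = 0 := by rw [le_def, sub_zero]

theorem sub_le (x y : A) : x - y ≤ x := by
  rw [le_def, sub_right_comm, sub_self, zero_sub]

theorem sub_sub_sub_le (x y z : A) : z - x - (z - y) ≤ y - x := sub_sub_sub_sub x y z

theorem sub_le_sub_left {x y : A} (h : x ≤ y) (z : A) : z - y ≤ z - x := by
  have := sub_sub_sub_le y x z
  rwa [le_def.1 h, le_zero_iff] at this

theorem sub_sub_le (x y : A) : x - (x - y) ≤ y := by
  rw [inf_comm]
  exact sub_le _ _

theorem sub_le_iff {x y z : A} : x - y ≤ z ↔ x - z ≤ y := by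
  rw [le_def, le_def, sub_right_comm]

theorem sub_le_sub_right {x y : A} (h : x ≤ y) (z : A) : x - z ≤ y - z := by
  have := sub_le_iff.1 (sub_sub_sub_le z y x)
  rwa [le_def.1 h, le_zero_iff] at this

theorem sub_sub_cancel {x y : A} (h : y ≤ x) : x - (x - y) = y := by
  rw [inf_comm, le_def.1 h, sub_zero]

/-- Subtracting a common lower bound does not change a difference. -/
theorem sub_sub_sub_cancel {e x z : A} (hez : e ≤ z) (hzx : z ≤ x) :
    x - e - (z - e) = x - z := by
  have h : z - e = x - e - (x - z) := by
    rw [sub_right_comm, sub_sub_cancel hzx]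
  rw [h]
  exact sub_sub_cancel (sub_le_sub_left hez x)

theorem one_sub_one_sub (x : A) : 1 - (1 - x) = x := sub_sub_cancel (le_one x)

theorem one_sub_sub_one_sub (x y : A) : 1 - y - (1 - x) = x - y := by
  rw [sub_right_comm, one_sub_one_sub]

/-- The differences `x - y` and `y - x` are disjoint. -/
theorem eq_zero_of_le_sub_of_le_sub {t x y : A} (hxy : t ≤ x - y) (hyx : t ≤ y - x) :
    t = 0 := by
  -- `u` is the supremum of `x` and `y`
  obtain ⟨u, hu⟩ : ∃ u : A, u = 1 - (1 - y - (1 - y - (1 - x))) := ⟨_, rfl⟩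
  have hu' : u = 1 - (1 - x - (1 - x - (1 - y))) := by rw [hu, inf_comm (1 - y)]
  have sub_eq (x y : A) : 1 - (1 - y - (1 - y - (1 - x))) - y = x - y := by
    rw [sub_right_comm, sub_sub_cancel (sub_le _ _), one_sub_sub_one_sub]
  have huy : u - y = x - y := by rw [hu, sub_eq]
  have hux : u - x = y - x := by rw [hu', sub_eq]
  have le_sup (x y : A) : y ≤ 1 - (1 - y - (1 - y - (1 - x))) := by
    simpa only [one_sub_one_sub] using sub_le_sub_left (sub_le (1 - y) (1 - y - (1 - x))) 1
  have hyu : y ≤ u := hu ▸ le_sup x y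
  have hxu : x ≤ u := hu' ▸ le_sup y x
  have sup_le {w : A} (hx : x ≤ w) (hy : y ≤ w) : u ≤ w := by
    have h : 1 - w ≤ 1 - y - (1 - y - (1 - x)) := by
      rw [← sub_sub_cancel (sub_le_sub_left hy 1)]
      exact sub_le_sub_left (sub_le_sub_left (sub_le_sub_left hx 1) _) _
    simpa only [one_sub_one_sub, ← hu] using sub_le_sub_left h 1
  have htu : t ≤ u := hxy.trans (huy ▸ sub_le u y)
  have hut : u ≤ u - t := by
    apply sup_le
    · rw [← sub_sub_cancel hxu, hux]
      exact sub_le_sub_left hyx u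
    · rw [← sub_sub_cancel hyu, huy]
      exact sub_le_sub_left hxy u
  rw [← sub_sub_cancel htu]
  exact hut

/-- Subtract `e` from `x` repeatedly, `n` times. -/
def iterSub (e : A) (n : ℕ) (x : A) : A := (fun z => z - e)^[n] x

theorem iterSub_succ (e : A) (n : ℕ) (x : A) : iterSub e (n + 1) x = iterSub e n x - e :=
  Function.iterate_succ_apply' _ _ _

theorem iterSub_add (e : A) (m n : ℕ) (x : A) :
    iterSub e (m + n) x = iterSub e m (iterSub e n x) :=
  Function.iterate_add_apply _ _ _ _

theorem iterSub_mono (e : A) (n : ℕ) {x y : A} (h : x ≤ y) : iterSub e n x ≤ iterSub e n y := by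
  induction n with
  | zero => exact h
  | succ n ih => simpa only [iterSub_succ] using sub_le_sub_right ih e

theorem iterSub_sub (e : A) (n : ℕ) (x y : A) : iterSub e n (x - y) = iterSub e n x - y := by
  induction n with
  | zero => rfl
  | succ n ih => rw [iterSub_succ, iterSub_succ, ih, sub_right_comm]

theorem iterSub_le (e : A) (n : ℕ) (x : A) : iterSub e n x ≤ x := by
  induction n with
  | zero => exact le_rfl
  | succ n ih => rw [iterSub_succ]; exact (sub_le _ _).trans ih

theorem iterSub_eq_zero_of_le {e x : A} {m n : ℕ} (hmn : m ≤ n) (h : iterSub e m x = 0) :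
    iterSub e n x = 0 := by
  obtain ⟨k, rfl⟩ := Nat.exists_eq_add_of_le' hmn
  rw [iterSub_add, h]
  exact le_zero_iff.1 (iterSub_le _ _ _)

theorem iterSub_add_eq_zero {e x y : A} {m n : ℕ} (hx : iterSub e m x = 0)
    (hyx : iterSub e n (y - x) = 0) : iterSub e (m + n) y = 0 := by
  rw [iterSub_sub] at hyx
  rw [iterSub_add, ← le_zero_iff, ← hx]
  exact iterSub_mono e m hyx

theorem iterSub_sub_iterSub {e x z : A} {n : ℕ} (he : ∀ j < n, e ≤ iterSub e j z) (hzx : z ≤ x) :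
    iterSub e n x - iterSub e n z = x - z := by
  induction n with
  | zero => rfl
  | succ n ih =>
    rw [iterSub_succ, iterSub_succ,
      sub_sub_sub_cancel (he n n.lt_succ_self) (iterSub_mono e n hzx),
      ih fun j hj => he j (hj.trans n.lt_succ_self)]

variable (A) in
/-- Every nonzero element has a multiple that reaches `1`. -/
def IsSimple : Prop := ∀ e : A, e ≠ 0 → ∃ n, iterSub e n 1 = 0

theorem IsSimple.le_total (hA : IsSimple A) (x y : A) : x ≤ y ∨ y ≤ x := by
  by_contra! h
  obtain ⟨hxy, hyx⟩ := h
  have h : (y - x) - (x - y) = y - x := by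
    refine le_antisymm (sub_le _ _) ?_
    exact eq_zero_of_le_sub_of_le_sub (sub_sub_le _ _) (sub_le _ _)
  have hfix (n : ℕ) : iterSub (x - y) n (y - x) = y - x := by
    induction n with
    | zero => rfl
    | succ n ih => rw [iterSub_succ, ih, h]
  obtain ⟨n, hn⟩ := hA (x - y) hxy
  refine hyx (le_zero_iff.1 ?_)
  rw [← hn]
  nth_rw 1 [← hfix n]
  exact iterSub_mono _ _ (le_one _)

/-- The least `n` such that subtracting `e` from `x` repeatedly, `n` times, gives `0`. -/
noncomputable def count (e x : A) : ℕ := sInf {n | iterSub e n x = 0}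

theorem IsSimple.iterSub_count (hA : IsSimple A) {e : A} (he : e ≠ 0) (x : A) :
    iterSub e (count e x) x = 0 := by
  obtain ⟨n, hn⟩ := hA e he
  refine Nat.sInf_mem (s := {n | iterSub e n x = 0}) ⟨n, ?_⟩
  exact le_zero_iff.1 (hn ▸ iterSub_mono e n (le_one x))

theorem count_le {e x : A} {n : ℕ} (h : iterSub e n x = 0) : count e x ≤ n := Nat.sInf_le h

theorem iterSub_ne_zero {e x : A} {n : ℕ} (h : n < count e x) : iterSub e n x ≠ 0 :=
  fun h0 => (count_le h0).not_gt h

theorem IsSimple.lt_count (hA : IsSimple A) {e : A} (he : e ≠ 0) {x : A} {n : ℕ}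
    (h : iterSub e n x ≠ 0) : n < count e x := by
  by_contra! hn
  exact h (iterSub_eq_zero_of_le hn (hA.iterSub_count he x))

theorem IsSimple.count_mono (hA : IsSimple A) {e : A} (he : e ≠ 0) {x y : A} (h : x ≤ y) :
    count e x ≤ count e y :=
  count_le (le_zero_iff.1 (hA.iterSub_count he y ▸ iterSub_mono e _ h))

theorem IsSimple.count_le_add (hA : IsSimple A) {e : A} (he : e ≠ 0) (x y : A) :
    count e x ≤ count e y + count e (x - y) :=
  count_le (iterSub_add_eq_zero (hA.iterSub_count he y) (hA.iterSub_count he (x - y)))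

theorem IsSimple.le_iterSub (hA : IsSimple A) {e x : A} {n : ℕ} (h : n + 1 < count e x) :
    e ≤ iterSub e n x := by
  refine (hA.le_total _ _).resolve_right fun hle => iterSub_ne_zero h ?_
  rw [iterSub_succ]
  exact hle

theorem IsSimple.add_le_count_add_one (hA : IsSimple A) {e : A} (he : e ≠ 0) {x y : A}
    (hyx : y ≤ x) : count e y + count e (x - y) ≤ count e x + 1 := by
  rcases hk : count e (x - y) with _ | k
  · have := hA.count_mono he hyx
    omega
  rcases hl : count e y with _ | l
  · have := hA.count_mono he (sub_le x y)
    omega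
  have h : y ≤ iterSub e k x := by
    rw [← sub_sub_cancel hyx, ← iterSub_sub_iterSub (e := e) (n := k) _ (sub_le x y)]
    · exact sub_le _ _
    · exact fun j hj => hA.le_iterSub (by omega)
  have hlk : l + k < count e x := by
    refine hA.lt_count he fun h0 => iterSub_ne_zero (e := e) (x := y) (n := l) (by omega) ?_
    rw [← le_zero_iff, ← h0, iterSub_add]
    exact iterSub_mono e l h
  omega

theorem IsSimple.count_one_pos (hA : IsSimple A) {e : A} (he : e ≠ 0) : 0 < count e 1 :=
  hA.lt_count he fun h => he (le_zero_iff.1 (h ▸ le_one e))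

/-- Counting multiples of an atom is additive. -/
theorem IsSimple.count_eq_add (hA : IsSimple A) {e : A} (he : e ≠ 0)
    (hmin : ∀ z, z ≤ e → z ≠ 0 → z = e) {x y : A} (hyx : y ≤ x) :
    count e x = count e y + count e (x - y) := by
  refine le_antisymm (hA.count_le_add he x y) ?_
  have hle (j : ℕ) (hj : j < count e (x - y)) : e ≤ iterSub e j (x - y) :=
    (hA.le_total _ _).elim id fun h => (hmin _ h (iterSub_ne_zero hj)).ge
  have h := iterSub_sub_iterSub hle (sub_le x y)
  rw [hA.iterSub_count he, sub_zero, sub_sub_cancel hyx] at h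
  by_contra! hlt
  have hk : count e (x - y) ≤ count e x := hA.count_mono he (sub_le x y)
  refine iterSub_ne_zero (e := e) (x := y) (n := count e x - count e (x - y)) (by omega) ?_
  have hadd := iterSub_add e (count e x - count e (x - y)) (count e (x - y)) x
  rw [Nat.sub_add_cancel hk, hA.iterSub_count he, h] at hadd
  exact hadd.symm

/-- Without atoms, arbitrarily many multiples of a nonzero element fit below `1`. -/
theorem IsSimple.exists_le_iterSub (hA : IsSimple A) (h1 : (1 : A) ≠ 0)
    (hmin : ∀ e : A, e ≠ 0 → ∃ z, z ≤ e ∧ z ≠ 0 ∧ z ≠ e) (m : ℕ) :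
    ∃ e : A, e ≠ 0 ∧ e ≤ iterSub e m 1 := by
  induction m with
  | zero => exact ⟨1, h1, le_rfl⟩
  | succ m ih =>
    obtain ⟨e, he, hem⟩ := ih
    obtain ⟨d, hd, hde⟩ : ∃ d : A, d ≠ 0 ∧ d ≤ e - d := by
      obtain ⟨z, hze, hz, hne⟩ := hmin e he
      rcases hA.le_total z (e - z) with h | h
      · exact ⟨z, hz, h⟩
      · refine ⟨e - z, fun h0 => hne (le_antisymm hze h0), ?_⟩
        rwa [sub_sub_cancel hze]
    refine ⟨d, hd, ?_⟩
    have two {x y : A} (hxy : x ≤ y) : x - e ≤ y - d - d := by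
      rcases hA.le_total x e with hxe | hex
      · rw [le_def.1 hxe]
        exact zero_le _
      · rw [← sub_sub_sub_cancel (hde.trans (sub_le e d)) hex]
        exact (sub_le_sub_left hde _).trans (sub_le_sub_right (sub_le_sub_right hxy d) d)
    have hstep (n : ℕ) : iterSub e n 1 ≤ iterSub d (2 * n) 1 := by
      induction n with
      | zero => exact le_rfl
      | succ n ih =>
        rw [mul_add, mul_one, iterSub_succ, iterSub_succ, iterSub_succ]
        exact two ih
    calc d ≤ e - d := hde
      _ ≤ iterSub d (2 * m) 1 - d := sub_le_sub_right (hem.trans (hstep m)) d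
      _ = iterSub d m (iterSub d (m + 1) 1) := by
        rw [← iterSub_succ, ← iterSub_add, two_mul, add_assoc]
      _ ≤ iterSub d (m + 1) 1 := iterSub_le _ _ _

/-- A state that is additive on comparable elements. -/
structure IsState (v : A → ℝ) : Prop where
  map_one : v 1 = 1
  mem_Icc (x : A) : v x ∈ Set.Icc (0 : ℝ) 1
  map_sub_of_le {x y : A} : y ≤ x → v (x - y) = v x - v y

theorem IsSimple.count_div_mem_Icc (hA : IsSimple A) {e : A} (he : e ≠ 0) (x : A) :
    (count e x / count e 1 : ℝ) ∈ Set.Icc (0 : ℝ) 1 :=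
  ⟨by positivity, div_le_one_of_le₀ (by exact_mod_cast hA.count_mono he (le_one x))
    (by positivity)⟩

theorem IsSimple.count_one_div_self (hA : IsSimple A) {e : A} (he : e ≠ 0) :
    (count e (1 : A) / count e (1 : A) : ℝ) = 1 :=
  div_self (by exact_mod_cast (hA.count_one_pos he).ne')

theorem IsSimple.exists_isState_of_atom (hA : IsSimple A) {e : A} (he : e ≠ 0)
    (hmin : ∀ z, z ≤ e → z ≠ 0 → z = e) : ∃ v : A → ℝ, IsState v := by
  refine ⟨fun x => count e x / count e 1, hA.count_one_div_self he, hA.count_div_mem_Icc he, ?_⟩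
  intro x y hyx
  simp only [hA.count_eq_add he hmin hyx]
  push_cast
  ring

open Filter Topology in
theorem IsSimple.exists_isState_of_no_atom (hA : IsSimple A) (h1 : (1 : A) ≠ 0)
    (hmin : ∀ e : A, e ≠ 0 → ∃ z, z ≤ e ∧ z ≠ 0 ∧ z ≠ e) : ∃ v : A → ℝ, IsState v := by
  choose e he hem using hA.exists_le_iterSub h1 hmin
  have hcount (n : ℕ) : n < count (e n) 1 :=
    hA.lt_count (he n) fun h => he n (le_zero_iff.1 (h ▸ hem n))
  let f (x : A) (n : ℕ) : ℝ := count (e n) x / count (e n) 1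
  have hf (x : A) (n : ℕ) : f x n ∈ Set.Icc (0 : ℝ) 1 := hA.count_div_mem_Icc (he n) x
  have hlim (x : A) : ∃ r ∈ Set.Icc (0 : ℝ) 1, Tendsto (f x) (hyperfilter ℕ) (𝓝 r) :=
    isCompact_Icc.ultrafilter_le_nhds ((hyperfilter ℕ).map (f x))
      (tendsto_principal.2 (.of_forall (hf x)))
  choose v hv hlim using hlim
  refine ⟨v, ?_, hv, fun {x y} hyx => ?_⟩
  · refine tendsto_nhds_unique (hlim 1) (tendsto_const_nhds.congr fun n => ?_)
    exact (hA.count_one_div_self (he n)).symm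
  · have hbound (n : ℕ) : |f (x - y) n - (f x n - f y n)| ≤ 1 / ((n : ℝ) + 1) := by
      have hN : (n : ℝ) + 1 ≤ count (e n) (1 : A) := by exact_mod_cast hcount n
      have hpos : (0 : ℝ) < n + 1 := by positivity
      have hle : (count (e n) x : ℝ) ≤ count (e n) y + count (e n) (x - y) := by
        exact_mod_cast hA.count_le_add (he n) x y
      have hge : (count (e n) y + count (e n) (x - y) : ℝ) ≤ count (e n) x + 1 := by
        exact_mod_cast hA.add_le_count_add_one (he n) hyx
      simp only [f]
      rw [← sub_div, ← sub_div, abs_div, abs_of_pos (hpos.trans_le hN)]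
      refine div_le_div₀ zero_le_one (abs_le.2 ⟨?_, ?_⟩) hpos hN <;> linarith
    have hzero : Tendsto (fun n => f (x - y) n - (f x n - f y n)) (hyperfilter ℕ) (𝓝 0) :=
      (squeeze_zero_norm hbound tendsto_one_div_add_atTop_nhds_zero_nat).mono_left
        Nat.hyperfilter_le_atTop
    have hsub := tendsto_nhds_unique ((hlim (x - y)).sub ((hlim x).sub (hlim y))) hzero
    linarith

theorem IsSimple.exists_isState (hA : IsSimple A) (h1 : (1 : A) ≠ 0) :
    ∃ v : A → ℝ, IsState v := by
  by_cases h : ∃ e : A, e ≠ 0 ∧ ∀ z, z ≤ e → z ≠ 0 → z = e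
  · obtain ⟨e, he, hmin⟩ := h
    exact hA.exists_isState_of_atom he hmin
  · push Not at h
    exact hA.exists_isState_of_no_atom h1 h

theorem IsState.map_zero {v : A → ℝ} (hv : IsState v) : v 0 = 0 := by
  have h := hv.map_sub_of_le (le_refl (0 : A))
  rwa [sub_self, _root_.sub_self] at h

theorem IsState.map_one_sub {v : A → ℝ} (hv : IsState v) (x : A) : v (1 - x) = 1 - v x := by
  rw [hv.map_sub_of_le (le_one x), hv.map_one]

theorem IsState.map_sub {v : A → ℝ} (hv : IsState v) (hA : IsSimple A) (x y : A) :
    v (x - y) = max (v x - v y) 0 := by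
  rcases hA.le_total x y with h | h
  · have h' := hv.map_sub_of_le h
    rw [le_def.1 h, hv.map_zero, max_eq_right]
    linarith [(hv.mem_Icc (y - x)).1]
  · rw [← hv.map_sub_of_le h, max_eq_left (hv.mem_Icc _).1]

end LukAlgebra

namespace LukFormula

variable {I : Type*}

/-- A set of formulas that contains the axioms and is closed under Modus Ponens. -/
structure IsTheory (T : Set (LukFormula I)) : Prop where
  ax_mem {φ : LukFormula I} : LukAxiom φ → φ ∈ T
  mp_mem {φ ψ : LukFormula I} : φ ∈ T → sub ψ φ ∈ T → ψ ∈ T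

theorem isTheory_deduces (Γ : Set (LukFormula I)) : IsTheory {φ | Deduces Γ φ} :=
  ⟨.ax, .mp⟩

namespace IsTheory

variable {T : Set (LukFormula I)}

theorem sub_mem (hT : IsTheory T) {φ : LukFormula I} (h : φ ∈ T) (ψ : LukFormula I) :
    sub φ ψ ∈ T :=
  hT.mp_mem h (hT.ax_mem (.a1 φ ψ))

theorem sub_trans (hT : IsTheory T) {φ ψ χ : LukFormula I} (h₁ : sub φ ψ ∈ T)
    (h₂ : sub ψ χ ∈ T) : sub φ χ ∈ T :=
  hT.mp_mem h₁ (hT.mp_mem h₂ (hT.ax_mem (.a2 χ ψ φ)))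

theorem land_sub_right_mem (hT : IsTheory T) (φ ψ : LukFormula I) : sub (land φ ψ) ψ ∈ T :=
  hT.sub_trans (hT.ax_mem (.a3 φ ψ)) (hT.ax_mem (.a1 ψ (sub ψ φ)))

theorem sub_self_mem (hT : IsTheory T) (φ : LukFormula I) : sub φ φ ∈ T := by
  have hax := hT.ax_mem (.a1 φ φ)
  have h : sub φ (sub φ (sub (sub φ φ) φ)) ∈ T := hT.mp_mem hax (hT.land_sub_right_mem φ _)
  exact hT.sub_trans h (hT.ax_mem (.a1 _ _))

theorem sub_sub_sub_mem_left (hT : IsTheory T) {φ ψ : LukFormula I} (h : sub φ ψ ∈ T)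
    (χ : LukFormula I) : sub (sub χ ψ) (sub χ φ) ∈ T :=
  hT.mp_mem h (hT.ax_mem (.a2 ψ φ χ))

theorem sub_right_comm_mem (hT : IsTheory T) (φ ψ χ : LukFormula I) :
    sub (sub (sub φ ψ) χ) (sub (sub φ χ) ψ) ∈ T :=
  hT.sub_trans (hT.sub_sub_sub_mem_left (hT.land_sub_right_mem φ χ) (sub φ ψ))
    (hT.ax_mem (.a2 ψ (sub φ χ) φ))

theorem sub_sub_sub_mem_right (hT : IsTheory T) {φ ψ : LukFormula I} (h : sub φ ψ ∈ T)
    (χ : LukFormula I) : sub (sub φ χ) (sub ψ χ) ∈ T :=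
  hT.mp_mem h (hT.mp_mem (hT.ax_mem (.a2 χ ψ φ)) (hT.sub_right_comm_mem _ _ _))

theorem sub_sub_of_mem (hT : IsTheory T) {θ : LukFormula I} (hθ : θ ∈ T) (φ : LukFormula I) :
    sub φ (sub φ θ) ∈ T :=
  hT.mp_mem hθ (hT.land_sub_right_mem φ θ)

theorem sub_neg_mem (hT : IsTheory T) (φ ψ : LukFormula I) : sub (sub φ ψ) (neg ψ) ∈ T :=
  hT.sub_trans (hT.ax_mem (.a4 φ ψ)) (hT.ax_mem (.a1 _ _))

theorem sub_neg_of_mem (hT : IsTheory T) {θ : LukFormula I} (hθ : θ ∈ T)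
    (φ : LukFormula I) : sub φ (neg θ) ∈ T :=
  hT.sub_trans (hT.sub_sub_of_mem hθ φ) (hT.sub_neg_mem φ θ)

theorem neg_sub_mem (hT : IsTheory T) {θ : LukFormula I} (hθ : θ ∈ T) (φ : LukFormula I) :
    sub (neg φ) (sub (neg θ) φ) ∈ T := by
  have key (ψ : LukFormula I) : sub ψ (sub (neg θ) (neg ψ)) ∈ T :=
    hT.sub_trans (hT.sub_sub_of_mem hθ ψ) (hT.ax_mem (.a4 ψ θ))
  exact hT.sub_trans (key (neg φ))
    (hT.sub_sub_sub_mem_left (hT.sub_trans (key φ) (hT.sub_neg_mem _ _)) _)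

/-- Provable equivalence relative to a theory. -/
def setoid (hT : IsTheory T) : Setoid (LukFormula I) where
  r φ ψ := sub φ ψ ∈ T ∧ sub ψ φ ∈ T
  iseqv :=
    { refl := fun φ => ⟨hT.sub_self_mem φ, hT.sub_self_mem φ⟩
      symm := And.symm
      trans := fun h₁ h₂ => ⟨hT.sub_trans h₁.1 h₂.1, hT.sub_trans h₂.2 h₁.2⟩ }

/-- The Lindenbaum algebra of a theory. -/
def Lindenbaum (hT : IsTheory T) : Type _ := Quotient hT.setoid

/-- The class of a formula in the Lindenbaum algebra. -/
def cls (hT : IsTheory T) (φ : LukFormula I) : hT.Lindenbaum := Quotient.mk hT.setoid φ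

theorem cls_eq_cls (hT : IsTheory T) {φ ψ : LukFormula I} :
    hT.cls φ = hT.cls ψ ↔ sub φ ψ ∈ T ∧ sub ψ φ ∈ T :=
  Quotient.eq (r := hT.setoid)

theorem cls_surjective (hT : IsTheory T) : Function.Surjective hT.cls := Quotient.mk_surjective

theorem cls_eq_cls_of_mem (hT : IsTheory T) {φ ψ : LukFormula I} (hφ : φ ∈ T) (hψ : ψ ∈ T) :
    hT.cls φ = hT.cls ψ :=
  hT.cls_eq_cls.2 ⟨hT.sub_mem hφ ψ, hT.sub_mem hψ φ⟩

instance (hT : IsTheory T) : Sub hT.Lindenbaum :=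
  ⟨Quotient.map₂ sub fun _ φ' h _ _ h' =>
    ⟨hT.sub_trans (hT.sub_sub_sub_mem_right h.1 _) (hT.sub_sub_sub_mem_left h'.2 φ'),
      hT.sub_trans (hT.sub_sub_sub_mem_left h'.1 φ') (hT.sub_sub_sub_mem_right h.2 _)⟩⟩

theorem cls_sub (hT : IsTheory T) (φ ψ : LukFormula I) :
    hT.cls (sub φ ψ) = hT.cls φ - hT.cls ψ := rfl

end IsTheory

/-- A fixed formula that belongs to every theory. -/
noncomputable def verum [Nonempty I] : LukFormula I :=
  sub (atom (Classical.arbitrary I)) (atom (Classical.arbitrary I))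

namespace IsTheory

variable [Nonempty I] {T : Set (LukFormula I)}

noncomputable instance (hT : IsTheory T) : Zero hT.Lindenbaum := ⟨hT.cls verum⟩

noncomputable instance (hT : IsTheory T) : One hT.Lindenbaum := ⟨hT.cls (neg verum)⟩

theorem verum_mem (hT : IsTheory T) : verum ∈ T := hT.sub_self_mem _

theorem cls_eq_zero (hT : IsTheory T) {φ : LukFormula I} : hT.cls φ = 0 ↔ φ ∈ T :=
  ⟨fun h => hT.mp_mem hT.verum_mem (hT.cls_eq_cls.1 h).1,
    fun h => hT.cls_eq_cls_of_mem h hT.verum_mem⟩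

noncomputable instance (hT : IsTheory T) : LukAlgebra hT.Lindenbaum where
  sub_self := hT.cls_surjective.forall.2 fun φ => hT.cls_eq_zero.2 (hT.sub_self_mem φ)
  sub_zero := hT.cls_surjective.forall.2 fun φ =>
    hT.cls_eq_cls.2 ⟨hT.ax_mem (.a1 _ _), hT.sub_sub_of_mem hT.verum_mem φ⟩
  zero_sub := hT.cls_surjective.forall.2 fun φ => hT.cls_eq_zero.2 (hT.sub_mem hT.verum_mem φ)
  sub_one := hT.cls_surjective.forall.2 fun φ =>
    hT.cls_eq_zero.2 (hT.sub_neg_of_mem hT.verum_mem φ)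
  inf_comm := hT.cls_surjective.forall₂.2 fun φ ψ =>
    hT.cls_eq_cls.2 ⟨hT.ax_mem (.a3 φ ψ), hT.ax_mem (.a3 ψ φ)⟩
  sub_right_comm := hT.cls_surjective.forall₃.2 fun φ ψ χ =>
    hT.cls_eq_cls.2 ⟨hT.sub_right_comm_mem φ ψ χ, hT.sub_right_comm_mem φ χ ψ⟩

theorem cls_neg (hT : IsTheory T) (φ : LukFormula I) : hT.cls (neg φ) = 1 - hT.cls φ :=
  hT.cls_eq_cls.2 ⟨hT.neg_sub_mem hT.verum_mem φ, hT.sub_neg_mem _ _⟩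

theorem eval_eq (hT : IsTheory T) (hA : LukAlgebra.IsSimple hT.Lindenbaum)
    {v : hT.Lindenbaum → ℝ} (hv : LukAlgebra.IsState v) (φ : LukFormula I) :
    eval (fun i => v (hT.cls (atom i))) φ = v (hT.cls φ) := by
  induction φ with
  | atom i => rfl
  | neg φ ih => rw [eval, ih, hT.cls_neg, hv.map_one_sub]
  | sub φ ψ ihφ ihψ => rw [eval, ihφ, ihψ, hT.cls_sub, hv.map_sub hA]

open LukAlgebra in
/-- The theory generated by a theory and one more formula. -/
theorem adjoin (hT : IsTheory T) (φ : LukFormula I) :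
    IsTheory {ψ | ∃ n, iterSub (hT.cls φ) n (hT.cls ψ) = 0} where
  ax_mem h := ⟨0, hT.cls_eq_zero.2 (hT.ax_mem h)⟩
  mp_mem := by
    rintro ψ χ ⟨m, hm⟩ ⟨n, hn⟩
    exact ⟨m + n, iterSub_add_eq_zero hm hn⟩

open LukAlgebra in
theorem isSimple_of_maximal (hT : IsTheory T)
    (hmax : ∀ U, IsTheory U → neg verum ∉ U → T ⊆ U → U ⊆ T) :
    IsSimple hT.Lindenbaum := by
  refine hT.cls_surjective.forall.2 fun φ hφ => ?_
  by_contra h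
  refine hφ (hT.cls_eq_zero.2 (hmax _ (hT.adjoin φ) h ?_ ⟨1, LukAlgebra.sub_self (hT.cls φ)⟩))
  exact fun ψ hψ => ⟨0, hT.cls_eq_zero.2 hψ⟩

theorem exists_maximal (hT : IsTheory T) (hcons : neg verum ∉ T) :
    ∃ M, T ⊆ M ∧ IsTheory M ∧ neg verum ∉ M ∧
      ∀ U, IsTheory U → neg verum ∉ U → M ⊆ U → U ⊆ M := by
  suffices ∃ M, T ⊆ M ∧ Maximal (· ∈ {U | IsTheory U ∧ neg verum ∉ U}) M by
    obtain ⟨M, hTM, hM⟩ := this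
    exact ⟨M, hTM, hM.prop.1, hM.prop.2, fun U hU hU' hMU => hM.le_of_ge ⟨hU, hU'⟩ hMU⟩
  refine zorn_subset_nonempty _ ?_ T ⟨hT, hcons⟩
  rintro c hc hchain ⟨U₀, hU₀⟩
  refine ⟨⋃₀ c, ⟨⟨fun h => ⟨U₀, hU₀, (hc hU₀).1.ax_mem h⟩, ?_⟩, ?_⟩,
    fun U hU => Set.subset_sUnion_of_mem hU⟩
  · rintro φ ψ ⟨U, hU, hφ⟩ ⟨V, hV, hψ⟩
    rcases hchain.total hU hV with hUV | hVU
    · exact ⟨V, hV, (hc hV).1.mp_mem (hUV hφ) hψ⟩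
    · exact ⟨U, hU, (hc hU).1.mp_mem hφ (hVU hψ)⟩
  · rintro ⟨U, hU, h⟩
    exact (hc hU).2 h

end IsTheory

theorem eval_mem_Icc {v : I → ℝ} (hv : IsAssignment v) (φ : LukFormula I) :
    eval v φ ∈ Set.Icc (0 : ℝ) 1 := by
  induction φ with
  | atom i => exact hv i
  | neg φ ih => exact ⟨sub_nonneg.2 ih.2, sub_le_self _ ih.1⟩
  | sub φ ψ ihφ ihψ =>
    exact ⟨le_max_right _ _, max_le ((sub_le_self _ ihψ.1).trans ihφ.2) zero_le_one⟩

theorem eval_sub_eq_zero {v : I → ℝ} {φ ψ : LukFormula I} :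
    eval v (sub φ ψ) = 0 ↔ eval v φ ≤ eval v ψ := by
  rw [eval, max_eq_right_iff, sub_nonpos]

theorem LukAxiom.eval_eq_zero {v : I → ℝ} (hv : IsAssignment v) {φ : LukFormula I}
    (h : LukAxiom φ) : eval v φ = 0 := by
  cases h <;> rw [eval_sub_eq_zero]
  case a1 φ ψ =>
    have := eval_mem_Icc hv φ
    have := eval_mem_Icc hv ψ
    simp only [eval, Set.mem_Icc] at *
    grind
  all_goals
    simp only [eval, land]
    grind

theorem Deduces.eval_eq_zero {v : I → ℝ} (hv : IsAssignment v) {Γ : Set (LukFormula I)}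
    (hΓ : ∀ φ ∈ Γ, eval v φ = 0) {φ : LukFormula I} (h : Deduces Γ φ) : eval v φ = 0 := by
  induction h with
  | ax h => exact h.eval_eq_zero hv
  | prem h => exact hΓ _ h
  | mp _ _ ih ih' =>
    exact le_antisymm (ih ▸ eval_sub_eq_zero.1 ih') (eval_mem_Icc hv _).1

end LukFormula

open LukFormula

open LukFormula

/-- A set `Γ` of Łukasiewicz formulas is consistent (does not deduce every formula)
if and only if it has a model. -/
theorem consistent_iff_satisfiable {I : Type*} [Nonempty I] (Γ : Set (LukFormula I)) :
    (¬ ∀ φ : LukFormula I, Deduces Γ φ) ↔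
      ∃ v : I → ℝ, IsAssignment v ∧ ∀ φ ∈ Γ, eval v φ = 0 := by
  constructor
  · intro hcons
    have hD := isTheory_deduces Γ
    have hbot : neg verum ∉ {φ | Deduces Γ φ} := fun h =>
      hcons fun φ => hD.mp_mem h (hD.sub_neg_of_mem hD.verum_mem φ)
    obtain ⟨M, hDM, hM, hM', hmax⟩ := hD.exists_maximal hbot
    have hA := hM.isSimple_of_maximal hmax
    obtain ⟨v, hv⟩ := hA.exists_isState fun h => hM' (hM.cls_eq_zero.1 h)
    refine ⟨fun i => v (hM.cls (atom i)), fun i => hv.mem_Icc _, fun φ hφ => ?_⟩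
    rw [hM.eval_eq hA hv, hM.cls_eq_zero.2 (hDM (.prem hφ)), hv.map_zero]
  · rintro ⟨v, hv, hΓ⟩ h
    have h₀ := (h verum).eval_eq_zero hv hΓ
    have h₁ := (h (neg verum)).eval_eq_zero hv hΓ
    rw [eval, h₀] at h₁
    norm_num at h₁

end Stmt4
end

section
/- Let S be a free continuous propositional logic, let Σ ⊆ S be finite and let φ ∈ S. Then Σ ⊨ φ if and only if Σ ⊢ φ in the deduction system consisting of the axiom schemes A1–A6 and Modus Ponens. -/
namespace Stmt5

/-- The free continuous propositional logic generated by atomic propositions indexed by `α`: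
formulas are freely generated by the connectives `∸`, `¬` and `½`. -/
inductive CFormula (α : Type*) : Type _ where
  | atom : α → CFormula α
  | neg : CFormula α → CFormula α
  | half : CFormula α → CFormula α
  | sub : CFormula α → CFormula α → CFormula α

namespace CFormula

variable {α : Type*}

/-- A truth assignment is a map into `[0,1]` respecting the connectives. -/
def IsTruthAssignment (v : CFormula α → ℝ) : Prop :=
  (∀ φ : CFormula α, v φ ∈ Set.Icc (0 : ℝ) 1) ∧
  (∀ φ : CFormula α, v (neg φ) = 1 - v φ) ∧
  (∀ φ : CFormula α, v (half φ) = v φ / 2) ∧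
  (∀ φ ψ : CFormula α, v (sub φ ψ) = max (v φ - v ψ) 0)

/-- `φ ∧ ψ` abbreviates `φ ∸ (φ ∸ ψ)`. -/
def land (φ ψ : CFormula α) : CFormula α := sub φ (sub φ ψ)

/-- The axiom schemes A1–A6 of continuous propositional logic. -/
inductive CAxiom : CFormula α → Prop where
  | a1 (φ ψ : CFormula α) : CAxiom (sub (sub φ ψ) φ)
  | a2 (φ ψ ρ : CFormula α) : CAxiom (sub (sub (sub ρ φ) (sub ρ ψ)) (sub ψ φ))
  | a3 (φ ψ : CFormula α) : CAxiom (sub (land φ ψ) (land ψ φ))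
  | a4 (φ ψ : CFormula α) : CAxiom (sub (sub φ ψ) (sub (neg ψ) (neg φ)))
  | a5 (φ : CFormula α) : CAxiom (sub (half φ) (sub φ (half φ)))
  | a6 (φ : CFormula α) : CAxiom (sub (sub φ (half φ)) (half φ))

/-- Formal deduction from a set of premises `Γ`, using the axiom schemes A1–A6 and
Modus Ponens (from `φ` and `ψ ∸ φ` infer `ψ`). -/
inductive Deduces (Γ : Set (CFormula α)) : CFormula α → Prop where
  | ax {φ : CFormula α} : CAxiom φ → Deduces Γ φ
  | prem {φ : CFormula α} : φ ∈ Γ → Deduces Γ φ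
  | mp {φ ψ : CFormula α} : Deduces Γ φ → Deduces Γ (sub ψ φ) → Deduces Γ ψ

end CFormula

open CFormula

/-- Finitely many positive Hahn series are simultaneously positive under some additive real-valued
functional. -/
theorem exists_addMonoidHom_pos_of_hahnSeries {Λ : Type*} [LinearOrder Λ]
    (s : Finset (Lex (HahnSeries Λ ℝ))) (hs : ∀ x ∈ s, 0 < x) :
    ∃ f : HahnSeries Λ ℝ →+ ℝ, ∀ x ∈ s, 0 < f (ofLex x) := by
  classical
  induction s using Finset.strongInduction with
  | H s ih =>
    rcases s.eq_empty_or_nonempty with rfl | hne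
    · exact ⟨0, by simp⟩
    obtain ⟨x₀, hx₀, hmin⟩ := s.exists_min_image (fun x => (ofLex x).orderTop) hne
    have hlead := HahnSeries.leadingCoeff_pos_iff.mpr (hs x₀ hx₀)
    have hx₀' : ofLex x₀ ≠ 0 := HahnSeries.leadingCoeff_ne_zero.mp hlead.ne'
    obtain ⟨c, hc⟩ := WithTop.ne_top_iff_exists.mp (HahnSeries.orderTop_ne_top.mpr hx₀')
    have coeff_pos : ∀ x ∈ s, (ofLex x).orderTop = c → 0 < (ofLex x).coeff c := by
      intro x hx h
      have hl := HahnSeries.leadingCoeff_pos_iff.mpr (hs x hx)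
      rwa [HahnSeries.leadingCoeff, h] at hl
    have coeff_nonneg : ∀ x ∈ s, 0 ≤ (ofLex x).coeff c := by
      intro x hx
      rcases (hmin x hx).eq_or_lt with h | h
      · exact (coeff_pos x hx (h.symm.trans hc.symm)).le
      · exact (HahnSeries.coeff_eq_zero_of_lt_orderTop (hc ▸ h)).ge
    have hssub : s.filter (fun x => (ofLex x).coeff c = 0) ⊂ s :=
      Finset.filter_ssubset.mpr ⟨x₀, hx₀, (coeff_pos x₀ hx₀ hc.symm).ne'⟩
    obtain ⟨f, hf⟩ := ih _ hssub fun x hx => hs x (Finset.mem_filter.mp hx).1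
    have large : ∀ᶠ N : ℝ in Filter.atTop, ∀ x ∈ s, 0 < N * (ofLex x).coeff c + f (ofLex x) := by
      rw [Filter.eventually_all_finset]
      intro x hx
      rcases (coeff_nonneg x hx).eq_or_lt with h | h
      · exact .of_forall fun N => by
          simpa [← h] using hf x (Finset.mem_filter.mpr ⟨hx, h.symm⟩)
      · exact (Filter.tendsto_atTop_add_const_right _ _
          (Filter.tendsto_id.atTop_mul_const h)).eventually_gt_atTop 0
    obtain ⟨N, hN⟩ := large.exists
    exact ⟨(AddMonoidHom.mulLeft N).comp (HahnSeries.coeff.addMonoidHom c) + f, hN⟩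

/-- Finitely many strict inequalities in a linearly ordered cancellative commutative monoid are
preserved by some real-valued additive homomorphism. -/
theorem exists_addMonoidHom_real_lt {M : Type*} [AddCommMonoid M] [LinearOrder M]
    [IsOrderedCancelAddMonoid M] (P : Set (M × M)) (hP : P.Finite) (hlt : ∀ p ∈ P, p.1 < p.2) :
    ∃ f : M →+ ℝ, ∀ p ∈ P, f p.1 < f p.2 := by
  classical
  obtain ⟨e, he, -⟩ := hahnEmbedding_isOrderedAddMonoid (Algebra.GrothendieckAddGroup M)
  have hmono : StrictMono e := e.monotone'.strictMono_of_injective he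
  have hof : ∀ a b : M, a < b →
      Algebra.GrothendieckAddGroup.of a < Algebra.GrothendieckAddGroup.of b := by
    intro a b hab
    simpa [← AddLocalization.mk_zero_eq_addMonoidOf_mk] using
      (AddLocalization.mkOrderEmbedding (0 : (⊤ : AddSubmonoid M))).strictMono hab
  let g : M →+ Lex (HahnSeries (FiniteArchimedeanClass (Algebra.GrothendieckAddGroup M)) ℝ) :=
    (e : Algebra.GrothendieckAddGroup M →+ _).comp Algebra.GrothendieckAddGroup.of
  have hg : ∀ a b, a < b → g a < g b := fun a b hab => hmono (hof a b hab)
  obtain ⟨f, hf⟩ := exists_addMonoidHom_pos_of_hahnSeries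
    (hP.toFinset.image fun p => g p.2 - g p.1) (by
      simp only [Finset.mem_image, Set.Finite.mem_toFinset]
      rintro _ ⟨p, hp, rfl⟩
      exact sub_pos.mpr (hg _ _ (hlt p hp)))
  refine ⟨(f : _ →+ ℝ).comp g, fun p hp => ?_⟩
  have := hf _ (Finset.mem_image_of_mem _ (hP.mem_toFinset.mpr hp))
  rw [ofLex_sub, map_sub, sub_pos] at this
  exact this

/-- A presentation of MV-algebras by truncated subtraction and complement. -/
class TruncSubAlgebra (A : Type*) extends Zero A, Sub A, Compl A where
  eq_zero_of_sub_eq_zero {a b : A} : a = 0 → b - a = 0 → b = 0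
  eq_of_sub_eq_zero {a b : A} : a - b = 0 → b - a = 0 → a = b
  sub_sub_left_self (a b : A) : a - b - a = 0
  sub_sub_sub (a b c : A) : c - a - (c - b) - (b - a) = 0
  sub_sub_comm_self (a b : A) : a - (a - b) = b - (b - a)
  sub_sub_compl (a b : A) : a - b - (bᶜ - aᶜ) = 0

namespace TruncSubAlgebra

variable {A : Type*} [TruncSubAlgebra A] {a b c : A}

theorem zero_sub_eq (a : A) : 0 - a = 0 :=
  eq_zero_of_sub_eq_zero rfl (sub_sub_left_self 0 a)

theorem sub_zero_eq (a : A) : a - 0 = a :=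
  eq_of_sub_eq_zero (sub_sub_left_self a 0) (by rw [sub_sub_comm_self, zero_sub_eq])

theorem sub_self_eq (a : A) : a - a = 0 := by
  have h := sub_sub_left_self a 0
  rwa [sub_zero_eq] at h

instance : PartialOrder A where
  le a b := a - b = 0
  le_refl := sub_self_eq
  le_trans a b c hab hbc := by
    have h := sub_sub_sub c b a
    rwa [hab, hbc, sub_zero_eq, sub_zero_eq] at h
  le_antisymm _ _ := eq_of_sub_eq_zero

theorem le_iff_sub : a ≤ b ↔ a - b = 0 := Iff.rfl

theorem zero_le' (a : A) : 0 ≤ a := zero_sub_eq a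

theorem le_zero_iff' : a ≤ 0 ↔ a = 0 := by rw [le_iff_sub, sub_zero_eq]

theorem sub_le_left (a b : A) : a - b ≤ a := sub_sub_left_self a b

theorem sub_le_sub_left' (h : a ≤ b) (c : A) : c - b ≤ c - a := by
  have h' := sub_sub_sub b a c
  rwa [le_iff_sub.mp h, sub_zero_eq] at h'

theorem sub_sub_le (a b : A) : a - (a - b) ≤ b := by
  rw [sub_sub_comm_self]
  exact sub_le_left _ _

theorem sub_sub_of_le (h : b ≤ a) : a - (a - b) = b := by
  rw [sub_sub_comm_self, le_iff_sub.mp h, sub_zero_eq]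

theorem sub_right_comm' (a b c : A) : a - b - c = a - c - b := by
  have key : ∀ b c : A, a - b - c ≤ a - c - b := fun b c =>
    (sub_le_sub_left' (sub_sub_le a c) _).trans (sub_sub_sub _ _ _)
  exact (key b c).antisymm (key c b)

theorem sub_le_comm : a - b ≤ c ↔ a - c ≤ b := by
  rw [le_iff_sub, le_iff_sub, sub_right_comm']

theorem sub_le_sub_right' (h : a ≤ b) (c : A) : a - c ≤ b - c := by
  have h' : a - c - (b - c) ≤ a - b := sub_le_comm.mp (sub_sub_sub c b a)
  rw [le_iff_sub.mp h] at h'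
  exact le_zero_iff'.mp h'

theorem eq_zero_of_le_of_le (h : a - (a - b) = 0) (ha : c ≤ a) (hb : c ≤ b) : c = 0 := by
  rw [← le_zero_iff', ← h]
  calc c = a - (a - c) := (sub_sub_of_le ha).symm
    _ ≤ a - (a - b) := sub_le_sub_left' (sub_le_sub_left' hb a) a

instance : One A := ⟨0ᶜ⟩

theorem sub_le_compl (a b : A) : a - b ≤ bᶜ :=
  le_trans (show a - b ≤ bᶜ - aᶜ from sub_sub_compl a b) (sub_le_left _ _)

theorem le_one' (a : A) : a ≤ 1 := by
  rw [← sub_zero_eq a]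
  exact sub_le_compl a 0

theorem one_sub (a : A) : 1 - a = aᶜ := by
  refine (sub_le_compl _ _).antisymm ?_
  have h : a ≤ 1 - aᶜ := by
    conv_lhs => rw [← sub_zero_eq a]
    exact sub_sub_compl a 0
  calc aᶜ = 1 - (1 - aᶜ) := (sub_sub_of_le (le_one' _)).symm
    _ ≤ 1 - a := sub_le_sub_left' h 1

theorem compl_compl' (a : A) : aᶜᶜ = a := by
  rw [← one_sub, ← one_sub, sub_sub_of_le (le_one' a)]

theorem compl_sub_compl (a b : A) : bᶜ - aᶜ = a - b := by
  refine le_antisymm ?_ (sub_sub_compl a b)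
  have h : bᶜ - aᶜ ≤ aᶜᶜ - bᶜᶜ := sub_sub_compl _ _
  rwa [compl_compl', compl_compl'] at h

theorem compl_sub_comm (a b : A) : aᶜ - b = bᶜ - a := by
  rw [← one_sub, ← one_sub, sub_right_comm']

theorem le_compl_comm' : a ≤ bᶜ ↔ b ≤ aᶜ := by
  rw [le_iff_sub, le_iff_sub, ← compl_sub_compl, compl_compl']

instance : Add A := ⟨fun a b => (aᶜ - b)ᶜ⟩

theorem add_def (a b : A) : a + b = (aᶜ - b)ᶜ := rfl

theorem compl_add (a b : A) : (a + b)ᶜ = aᶜ - b := compl_compl' _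

theorem sub_add_eq (a b c : A) : a - (b + c) = a - b - c := by
  rw [← compl_sub_compl, compl_add, sub_right_comm', compl_sub_compl]

theorem compl_injective' : Function.Injective (compl : A → A) := fun a b h => by
  rw [← compl_compl' a, h, compl_compl']

instance : AddCommMonoid A where
  add_assoc a b c := compl_injective' (by simp only [compl_add, sub_add_eq])
  zero_add a := by rw [add_def, ← one_sub 0, sub_zero_eq, one_sub, compl_compl']
  add_zero a := by rw [add_def, sub_zero_eq, compl_compl']
  add_comm a b := by rw [add_def, add_def, compl_sub_comm]
  nsmul := nsmulRec

theorem sub_le_iff_le_add' : a - b ≤ c ↔ a ≤ b + c := by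
  rw [le_iff_sub, le_iff_sub, sub_add_eq]

instance : IsOrderedAddMonoid A where
  add_le_add_left a b h c := by
    rw [add_comm a, add_comm b, ← sub_le_iff_le_add']
    exact (sub_le_iff_le_add'.mpr le_rfl).trans h

theorem add_sub_of_le_compl (h : a ≤ bᶜ) : a + b - b = a := by
  rw [← compl_sub_compl, add_comm, compl_add, sub_sub_of_le h]

theorem sub_add_of_le (h : b ≤ a) : a - b + b = a := by
  refine compl_injective' ?_
  rw [add_comm, compl_add, ← compl_sub_compl a b, sub_sub_of_le]
  rwa [le_compl_comm', compl_compl']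


theorem prelinear (a b : A) : (a - b) - ((a - b) - (b - a)) = 0 := by
  set m := a - (a - b) with hm
  set z := (a - b) - ((a - b) - (b - a)) with hz
  have hzab : z ≤ a - b := sub_le_left _ _
  have hzba : z ≤ b - a := sub_sub_le _ _
  have hma : m ≤ a := sub_le_left _ _
  have hmb : m ≤ b := sub_sub_le _ _
  have sub_m : ∀ x y : A, x - (x - (x - y)) = x - y := fun x y => sub_sub_of_le (sub_le_left _ _)
  have ha : z + m ≤ a := by
    calc z + m ≤ (a - m) + m := by rw [hm, sub_m]; gcongr
      _ = a := sub_add_of_le hma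
  have hb : z + m ≤ b := by
    calc z + m ≤ (b - m) + m := by rw [hm, sub_sub_comm_self, sub_m]; gcongr
      _ = b := sub_add_of_le hmb
  have hzm : z + m ≤ m := by
    calc z + m = a - (a - (z + m)) := (sub_sub_of_le ha).symm
      _ ≤ a - (a - b) := sub_le_sub_left' (sub_le_sub_left' hb a) a
  have hzc : z ≤ mᶜ := by
    have : z ≤ a - m := by rwa [hm, sub_m]
    exact this.trans (sub_le_compl _ _)
  calc z = z + m - m := (add_sub_of_le_compl hzc).symm
    _ = 0 := hzm

theorem iterate_sub_mono (x : A) (n : ℕ) : Monotone ((· - x)^[n]) :=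
  Monotone.iterate (fun _ _ h => sub_le_sub_right' h x) n

theorem iterate_sub_sub (x y a : A) (n : ℕ) : (· - x)^[n] (a - y) = (· - x)^[n] a - y := by
  induction n generalizing a with
  | zero => rfl
  | succ n ih => rw [Function.iterate_succ_apply, Function.iterate_succ_apply, sub_right_comm', ih]

/-- If `x` and `y` have trivial meet, an element bounded by multiples of both vanishes. -/
theorem eq_zero_of_iterate_sub {x y : A} (hxy : x - (x - y) = 0) (n m : ℕ) (a : A)
    (hx : (· - x)^[n] a = 0) (hy : (· - y)^[m] a = 0) : a = 0 := by
  induction n generalizing m a with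
  | zero => exact hx
  | succ n ihn =>
    induction m generalizing a with
    | zero => exact hy
    | succ m ihm =>
      refine eq_zero_of_le_of_le hxy ?_ ?_
      · exact ihn (m + 1) (a - x) hx (by rw [iterate_sub_sub, hy, zero_sub_eq])
      · exact ihm (a - y) (by rw [iterate_sub_sub, hx, zero_sub_eq]) hy

theorem le_compl_add (hab : a ≤ bᶜ) (h : a + b ≤ cᶜ) : a ≤ (b + c)ᶜ := by
  calc a = a + b - b := (add_sub_of_le_compl hab).symm
    _ ≤ cᶜ - b := sub_le_sub_right' h b
    _ = (b + c)ᶜ := by rw [add_comm, compl_add]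

theorem le_add_left' (a b : A) : a ≤ b + a := by
  rw [← sub_le_iff_le_add']
  exact sub_le_left a b

theorem eq_of_sub_eq_self (hb : a - b = b) (hc : a - c = c) : b = c := by
  have sub_le : ∀ x y : A, a - x = x → a - y = y → x - y ≤ y - x := by
    intro x y hx hy
    have h := sub_sub_sub x y a
    rwa [hx, hy] at h
  have symm_sub : b - c = c - b := (sub_le b c hb hc).antisymm (sub_le c b hc hb)
  have h : b - c = 0 := by
    have h := prelinear b c
    rwa [← symm_sub, sub_self_eq, sub_zero_eq] at h
  exact eq_of_sub_eq_zero h (symm_sub ▸ h)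

end TruncSubAlgebra

/-- A truncated subtraction algebra with a halving operation. -/
class HalvingAlgebra (A : Type*) extends TruncSubAlgebra A where
  /-- The halving operation. -/
  half : A → A
  sub_half (a : A) : a - half a = half a

namespace HalvingAlgebra

open TruncSubAlgebra

variable {A : Type*} [HalvingAlgebra A] {a b : A}

theorem half_le_self (a : A) : half a ≤ a := by
  rw [← sub_half]
  exact sub_le_left _ _

theorem half_le_compl_half (a : A) : half a ≤ (half a)ᶜ := by
  conv_lhs => rw [← sub_half]
  exact sub_le_compl _ _

theorem half_add_half (a : A) : half a + half a = a := by
  have h := sub_add_of_le (half_le_self a)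
  rwa [sub_half] at h

theorem half_add (h : a ≤ bᶜ) : half (a + b) = half a + half b := by
  symm
  refine eq_of_sub_eq_self ?_ (sub_half _)
  have haa := half_le_compl_half a
  have h₁ : half a ≤ (half a + b)ᶜ := le_compl_add haa (by rwa [half_add_half])
  have h₂ : half a ≤ (half b + half b)ᶜ := by
    rw [half_add_half]
    exact (half_le_self a).trans h
  have h₃ : half a + half b ≤ (half b)ᶜ := by
    rw [le_compl_comm', add_comm]
    exact le_compl_add (half_le_compl_half b) (le_compl_comm'.mp h₂)
  have h₄ : half a + b - half b = half a + half b := by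
    calc half a + b - half b = half a + half b + half b - half b := by
          rw [add_assoc, half_add_half]
      _ = half a + half b := add_sub_of_le_compl h₃
  calc a + b - (half a + half b) = (half a + b) + half a - half a - half b := by
        rw [sub_add_eq, add_right_comm, half_add_half]
    _ = half a + b - half b := by rw [add_sub_of_le_compl (le_compl_comm'.mp h₁)]
    _ = half a + half b := h₄

theorem half_mono : Monotone (half : A → A) := by
  intro a b h
  have hb := sub_add_of_le h
  rw [← hb, half_add (sub_le_compl _ _)]
  exact le_add_left' _ _

theorem half_le_half_iff : half a ≤ half b ↔ a ≤ b := by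
  refine ⟨fun h => ?_, fun h => half_mono h⟩
  rw [← half_add_half a, ← half_add_half b]
  exact add_le_add h h

theorem half_zero : half (0 : A) = 0 := le_zero_iff'.mp (half_le_self 0)

open Filter

/-- Sequences that are eventually halved have eventually no overflowing sums. -/
theorem eventually_le_compl {f g : ℕ → A} (hf : ∀ᶠ n in atTop, f (n + 1) = half (f n))
    (hg : ∀ᶠ n in atTop, g (n + 1) = half (g n)) : ∀ᶠ n in atTop, f n ≤ (g n)ᶜ := by
  have bound : ∀ f : ℕ → A, (∀ᶠ n in atTop, f (n + 1) = half (f n)) →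
      ∀ᶠ n in atTop, f n ≤ half 1 := by
    intro f hf
    rw [← map_add_atTop_eq_nat 1, eventually_map]
    filter_upwards [hf] with n hn
    rw [hn]
    exact half_mono (le_one' _)
  filter_upwards [bound f hf, bound g hg] with n hfn hgn
  refine hfn.trans ((half_le_compl_half 1).trans ?_)
  rw [le_compl_comm', compl_compl']
  exact hgn

variable (A) in
/-- Germs at infinity of sequences in `A` that are eventually halved at each step. Such a sequence
stands for an element of the ordered monoid generated by `A`, scaled down by powers of two. -/
def halvingGerms : AddSubmonoid (Germ (atTop : Filter ℕ) A) where
  carrier := {g | ∃ f : ℕ → A, g = f ∧ ∀ᶠ n in atTop, f (n + 1) = half (f n)}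
  zero_mem' := ⟨fun _ => 0, rfl, .of_forall fun _ => half_zero.symm⟩
  add_mem' := by
    rintro _ _ ⟨f, rfl, hf⟩ ⟨g, rfl, hg⟩
    refine ⟨f + g, rfl, ?_⟩
    filter_upwards [hf, hg, eventually_le_compl hf hg] with n hfn hgn hle
    simp only [Pi.add_apply, hfn, hgn, half_add hle]

instance : IsOrderedCancelAddMonoid (halvingGerms A) where
  add_le_add_left a b h c := add_le_add_left (α := Germ (atTop : Filter ℕ) A) h c
  le_of_add_le_add_left := by
    rintro ⟨_, f, rfl, hf⟩ ⟨_, g, rfl, hg⟩ ⟨_, h, rfl, hh⟩ hle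
    have hle' : ∀ᶠ n in atTop, f n + g n ≤ f n + h n := hle
    change ∀ᶠ n in atTop, g n ≤ h n
    filter_upwards [hle', eventually_le_compl hg hf, eventually_le_compl hh hf] with n hn hgf hhf
    rw [← add_sub_of_le_compl hgf, ← add_sub_of_le_compl hhf, add_comm (g n), add_comm (h n)]
    exact sub_le_sub_right' hn _

theorem halvingGerms_le_total (htot : ∀ a b : A, a ≤ b ∨ b ≤ a) (x y : halvingGerms A) :
    x ≤ y ∨ y ≤ x := by
  have step : ∀ (f g : ℕ → A) (N : ℕ), (∀ n ≥ N, f (n + 1) = half (f n)) →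
      (∀ n ≥ N, g (n + 1) = half (g n)) → f N ≤ g N → ∀ᶠ n in atTop, f n ≤ g n := by
    intro f g N hf hg hN
    filter_upwards [eventually_ge_atTop N] with n hn
    induction n, hn using Nat.le_induction with
    | base => exact hN
    | succ n hn ih => rw [hf n hn, hg n hn]; exact half_mono ih
  obtain ⟨_, f, rfl, hf⟩ := x
  obtain ⟨_, g, rfl, hg⟩ := y
  obtain ⟨N, hN⟩ := eventually_atTop.mp (hf.and hg)
  have hfN : ∀ n ≥ N, f (n + 1) = half (f n) := fun n hn => (hN n hn).1
  have hgN : ∀ n ≥ N, g (n + 1) = half (g n) := fun n hn => (hN n hn).2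
  exact (htot (f N) (g N)).imp (step f g N hfN hgN) (step g f N hgN hfN)

/-- The embedding of `A` into its monoid of halving germs. -/
def toHalvingGerms (a : A) : halvingGerms A :=
  ⟨((fun n => half^[n] a : ℕ → A) : Germ (atTop : Filter ℕ) A), _, rfl,
    .of_forall fun n => Function.iterate_succ_apply' half n a⟩

theorem toHalvingGerms_le_iff : toHalvingGerms a ≤ toHalvingGerms b ↔ a ≤ b := by
  have iterate_iff : ∀ n : ℕ, half^[n] a ≤ half^[n] b ↔ a ≤ b := by
    intro n
    induction n with
    | zero => rfl
    | succ n ih => rw [Function.iterate_succ_apply', Function.iterate_succ_apply',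
        half_le_half_iff, ih]
  change (∀ᶠ n in atTop, half^[n] a ≤ half^[n] b) ↔ a ≤ b
  simp only [iterate_iff, eventually_const]

theorem toHalvingGerms_add (h : a ≤ bᶜ) :
    toHalvingGerms (a + b) = toHalvingGerms a + toHalvingGerms b := by
  have iterate_add : ∀ n : ℕ, half^[n] (a + b) = half^[n] a + half^[n] b := by
    intro n
    induction n generalizing a b with
    | zero => rfl
    | succ n ih =>
      rw [Function.iterate_succ_apply, half_add h, ih]
      · rfl
      · refine (half_le_self a).trans (h.trans ?_)
        rw [le_compl_comm', compl_compl']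
        exact half_le_self b
  exact Subtype.ext (congrArg (Germ.ofFun : (ℕ → A) → Germ (atTop : Filter ℕ) A)
    (funext iterate_add))

/-- On a totally ordered halving algebra there is a real-valued map that respects differences and
halves and preserves the strict order on a given finite set. -/
theorem exists_real_map (htot : ∀ a b : A, a ≤ b ∨ b ≤ a) (s : Set A) (hs : s.Finite) :
    ∃ w : A → ℝ, (∀ a, w (half a) + w (half a) = w a) ∧
      (∀ a b, b ≤ a → w (a - b) + w b = w a) ∧ ∀ a ∈ s, ∀ b ∈ s, a < b → w a < w b := by
  classical
  let _ : LinearOrder (halvingGerms A) :=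
    { (inferInstance : PartialOrder (halvingGerms A)) with
      le_total := halvingGerms_le_total htot
      toDecidableLE := Classical.decRel _ }
  have hlt : ∀ a b : A, a < b → toHalvingGerms a < toHalvingGerms b := fun a b h =>
    lt_of_le_not_ge (toHalvingGerms_le_iff.mpr h.le) (mt toHalvingGerms_le_iff.mp h.not_ge)
  obtain ⟨f, hf⟩ := exists_addMonoidHom_real_lt
    ((fun p : A × A => (toHalvingGerms p.1, toHalvingGerms p.2)) ''
      {p ∈ s ×ˢ s | p.1 < p.2}) (((hs.prod hs).subset fun _ h => h.1).image _) (by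
        rintro _ ⟨p, ⟨-, hp⟩, rfl⟩
        exact hlt _ _ hp)
  refine ⟨fun a => f (toHalvingGerms a), fun a => ?_, fun a b h => ?_, fun a ha b hb h => ?_⟩
  · rw [← map_add, ← toHalvingGerms_add (half_le_compl_half a), half_add_half]
  · rw [← map_add, ← toHalvingGerms_add (sub_le_compl a b), sub_add_of_le h]
  · exact hf _ ⟨(a, b), ⟨⟨ha, hb⟩, h⟩, rfl⟩

end HalvingAlgebra

namespace CFormula

variable {α : Type*} {Γ : Set (CFormula α)} {φ ψ χ ρ : CFormula α}

namespace Deduces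

theorem mono {Δ : Set (CFormula α)} (h : Γ ⊆ Δ) (hφ : Deduces Γ φ) : Deduces Δ φ := by
  induction hφ with
  | ax h => exact .ax h
  | prem hm => exact .prem (h hm)
  | mp _ _ ih₁ ih₂ => exact .mp ih₁ ih₂

theorem exists_of_sUnion {c : Set (Set (CFormula α))} (hc : IsChain (· ⊆ ·) c) (hne : c.Nonempty)
    (h : Deduces (⋃₀ c) φ) : ∃ Δ ∈ c, Deduces Δ φ := by
  induction h with
  | ax h => exact hne.imp fun Δ hΔ => ⟨hΔ, .ax h⟩
  | prem hm => exact hm.imp fun Δ hΔ => ⟨hΔ.1, .prem hΔ.2⟩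
  | mp _ _ ih₁ ih₂ =>
    obtain ⟨Δ₁, h₁, d₁⟩ := ih₁
    obtain ⟨Δ₂, h₂, d₂⟩ := ih₂
    rcases hc.total h₁ h₂ with h | h
    · exact ⟨Δ₂, h₂, .mp (d₁.mono h) d₂⟩
    · exact ⟨Δ₁, h₁, .mp d₁ (d₂.mono h)⟩

theorem trans (h₁ : Deduces Γ (sub φ ψ)) (h₂ : Deduces Γ (sub ψ χ)) : Deduces Γ (sub φ χ) :=
  .mp h₁ (.mp h₂ (.ax (.a2 χ ψ φ)))

theorem sub_congr_right (h : Deduces Γ (sub ψ φ)) (ρ : CFormula α) :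
    Deduces Γ (sub (sub ρ φ) (sub ρ ψ)) :=
  .mp h (.ax (.a2 φ ψ ρ))

theorem sub_sub_le (φ ψ : CFormula α) : Deduces Γ (sub (sub φ (sub φ ψ)) ψ) :=
  trans (.ax (.a3 φ ψ)) (.ax (.a1 ψ _))

theorem sub_right_comm (φ ψ χ : CFormula α) :
    Deduces Γ (sub (sub (sub φ ψ) χ) (sub (sub φ χ) ψ)) :=
  trans (sub_congr_right (sub_sub_le φ χ) _) (.ax (.a2 ψ (sub φ χ) φ))

theorem sub_congr_left (h : Deduces Γ (sub φ ψ)) (ρ : CFormula α) :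
    Deduces Γ (sub (sub φ ρ) (sub ψ ρ)) :=
  .mp h (.mp (.ax (.a2 ρ ψ φ)) (sub_right_comm (sub φ ρ) (sub ψ ρ) (sub φ ψ)))

theorem le_sub (h : Deduces Γ ψ) (φ : CFormula α) : Deduces Γ (sub φ (sub φ ψ)) :=
  .mp h (sub_sub_le φ ψ)

theorem sub_self (φ : CFormula α) : Deduces Γ (sub φ φ) :=
  trans (le_sub (.ax (.a1 φ φ)) φ) (.ax (.a1 φ _))

theorem sub_of_deduces (h : Deduces Γ φ) (ψ : CFormula α) : Deduces Γ (sub φ ψ) :=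
  .mp h (.ax (.a1 φ ψ))

theorem sub_le_neg (φ ψ : CFormula α) : Deduces Γ (sub (sub φ ψ) (neg ψ)) :=
  trans (.ax (.a4 φ ψ)) (.ax (.a1 _ _))

theorem le_neg_of_deduces (h : Deduces Γ ψ) (φ : CFormula α) : Deduces Γ (sub φ (neg ψ)) :=
  trans (le_sub h φ) (sub_le_neg φ ψ)

theorem neg_le (h : Deduces Γ ψ) (φ : CFormula α) :
    Deduces Γ (sub (neg φ) (sub (neg ψ) φ)) := by
  have hle : Deduces Γ (sub φ (sub (neg ψ) (neg φ))) := trans (le_sub h φ) (.ax (.a4 φ ψ))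
  have hmeet : Deduces Γ (sub (neg φ) (sub (neg ψ) (sub (neg ψ) (neg φ)))) :=
    trans (le_sub (le_neg_of_deduces h (neg φ)) _) (.ax (.a3 _ _))
  exact trans hmeet (sub_congr_right hle _)

theorem neg_congr (h : Deduces Γ (sub φ ψ)) : Deduces Γ (sub (neg ψ) (neg φ)) :=
  trans (neg_le h ψ) (trans (sub_congr_right h _) (sub_le_neg _ φ))

end Deduces

/-- Provable equivalence relative to the premises `Γ`. -/
def deductionSetoid (Γ : Set (CFormula α)) : Setoid (CFormula α) where
  r φ ψ := Deduces Γ (sub φ ψ) ∧ Deduces Γ (sub ψ φ)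
  iseqv := ⟨fun φ => ⟨.sub_self φ, .sub_self φ⟩, fun h => h.symm,
    fun h₁ h₂ => ⟨h₁.1.trans h₂.1, h₂.2.trans h₁.2⟩⟩

/-- The Lindenbaum algebra of the premises `Γ`. -/
def Lindenbaum (Γ : Set (CFormula α)) : Type _ := Quotient (deductionSetoid Γ)

namespace Lindenbaum

/-- The class of a formula in the Lindenbaum algebra. -/
def mk (Γ : Set (CFormula α)) (φ : CFormula α) : Lindenbaum Γ := Quotient.mk (deductionSetoid Γ) φ

theorem mk_surjective : Function.Surjective (mk Γ) := Quotient.mk_surjective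

theorem mk_eq_mk_iff : mk Γ φ = mk Γ ψ ↔ Deduces Γ (sub φ ψ) ∧ Deduces Γ (sub ψ φ) :=
  Quotient.eq (r := deductionSetoid Γ)

instance : Sub (Lindenbaum Γ) :=
  ⟨Quotient.map₂ sub fun _ _ h₁ _ _ h₂ =>
    ⟨(h₁.1.sub_congr_left _).trans (h₂.2.sub_congr_right _),
      (h₁.2.sub_congr_left _).trans (h₂.1.sub_congr_right _)⟩⟩

instance : Compl (Lindenbaum Γ) :=
  ⟨Quotient.map neg fun _ _ h => ⟨h.2.neg_congr, h.1.neg_congr⟩⟩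

theorem mk_sub (φ ψ : CFormula α) : mk Γ (sub φ ψ) = mk Γ φ - mk Γ ψ := rfl

theorem mk_neg (φ : CFormula α) : mk Γ (neg φ) = (mk Γ φ)ᶜ := rfl

theorem mk_sub_mk_half (φ : CFormula α) : mk Γ φ - mk Γ (half φ) = mk Γ (half φ) :=
  mk_eq_mk_iff.mpr ⟨.ax (.a6 φ), .ax (.a5 φ)⟩

variable [Inhabited (CFormula α)]

instance : Zero (Lindenbaum Γ) := ⟨mk Γ (sub default default)⟩

theorem mk_eq_zero_iff : mk Γ φ = 0 ↔ Deduces Γ φ :=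
  mk_eq_mk_iff.trans ⟨fun h => .mp (.sub_self _) h.1,
    fun h => ⟨h.sub_of_deduces _, (Deduces.sub_self _).sub_of_deduces _⟩⟩

instance : TruncSubAlgebra (Lindenbaum Γ) where
  eq_zero_of_sub_eq_zero {a b} := by
    obtain ⟨φ, rfl⟩ := mk_surjective a
    obtain ⟨ψ, rfl⟩ := mk_surjective b
    simp only [← mk_sub, mk_eq_zero_iff]
    exact .mp
  eq_of_sub_eq_zero {a b} := by
    obtain ⟨φ, rfl⟩ := mk_surjective a
    obtain ⟨ψ, rfl⟩ := mk_surjective b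
    simp only [← mk_sub, mk_eq_zero_iff, mk_eq_mk_iff]
    exact And.intro
  sub_sub_left_self a b := by
    obtain ⟨φ, rfl⟩ := mk_surjective a
    obtain ⟨ψ, rfl⟩ := mk_surjective b
    exact mk_eq_zero_iff.mpr (.ax (.a1 φ ψ))
  sub_sub_sub a b c := by
    obtain ⟨φ, rfl⟩ := mk_surjective a
    obtain ⟨ψ, rfl⟩ := mk_surjective b
    obtain ⟨ρ, rfl⟩ := mk_surjective c
    exact mk_eq_zero_iff.mpr (.ax (.a2 φ ψ ρ))
  sub_sub_comm_self a b := by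
    obtain ⟨φ, rfl⟩ := mk_surjective a
    obtain ⟨ψ, rfl⟩ := mk_surjective b
    exact mk_eq_mk_iff.mpr ⟨.ax (.a3 φ ψ), .ax (.a3 ψ φ)⟩
  sub_sub_compl a b := by
    obtain ⟨φ, rfl⟩ := mk_surjective a
    obtain ⟨ψ, rfl⟩ := mk_surjective b
    exact mk_eq_zero_iff.mpr (.ax (.a4 φ ψ))

instance : HalvingAlgebra (Lindenbaum Γ) where
  half := Quotient.lift (fun φ => mk Γ (half φ)) fun φ ψ h => by
    have heq : mk Γ φ = mk Γ ψ := Quotient.sound h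
    exact TruncSubAlgebra.eq_of_sub_eq_self (mk_sub_mk_half φ) (heq ▸ mk_sub_mk_half ψ)
  sub_half a := by
    obtain ⟨φ, rfl⟩ := mk_surjective a
    exact mk_sub_mk_half φ

theorem mk_half (φ : CFormula α) : mk Γ (half φ) = HalvingAlgebra.half (mk Γ φ) := rfl

open TruncSubAlgebra

/-- A local deduction theorem. -/
theorem exists_iterate_sub_eq_zero (h : Deduces (insert ψ Γ) φ) :
    ∃ n : ℕ, (· - mk Γ ψ)^[n] (mk Γ φ) = 0 := by
  induction h with
  | ax h => exact ⟨0, mk_eq_zero_iff.mpr (.ax h)⟩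
  | prem hm =>
    rcases hm with rfl | hm
    · exact ⟨1, sub_self_eq _⟩
    · exact ⟨0, mk_eq_zero_iff.mpr (.prem hm)⟩
  | @mp φ χ _ _ ih₁ ih₂ =>
    obtain ⟨n, hn⟩ := ih₁
    obtain ⟨m, hm⟩ := ih₂
    refine ⟨n + m, ?_⟩
    rw [mk_sub, iterate_sub_sub] at hm
    rw [Function.iterate_add_apply, ← le_zero_iff', ← hn]
    exact iterate_sub_mono _ n hm

/-- Premises maximal among those not deducing a given formula have a totally ordered Lindenbaum
algebra. -/
theorem le_total_of_maximal (hΓ : Maximal (fun Δ => ¬ Deduces Δ φ) Γ) (a b : Lindenbaum Γ) :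
    a ≤ b ∨ b ≤ a := by
  obtain ⟨ψ, rfl⟩ := mk_surjective a
  obtain ⟨χ, rfl⟩ := mk_surjective b
  by_contra! hcon
  have key : ∀ ρ : CFormula α, mk Γ ρ ≠ 0 → Deduces (insert ρ Γ) φ := by
    intro ρ hρ
    by_contra hnot
    exact hρ (mk_eq_zero_iff.mpr
      (.prem (hΓ.le_of_ge hnot (Set.subset_insert _ _) (Set.mem_insert _ _))))
  obtain ⟨n, hn⟩ := exists_iterate_sub_eq_zero (key (sub ψ χ) hcon.1)
  obtain ⟨m, hm⟩ := exists_iterate_sub_eq_zero (key (sub χ ψ) hcon.2)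
  exact hΓ.prop (mk_eq_zero_iff.mp
    (eq_zero_of_iterate_sub (prelinear (mk Γ ψ) (mk Γ χ)) n m _ hn hm))

end Lindenbaum

/-- A formula that is not deducible stays so over some maximal set of premises. -/
theorem exists_maximal_not_deduces (h : ¬ Deduces Γ φ) :
    ∃ Δ, Γ ⊆ Δ ∧ Maximal (fun Δ => ¬ Deduces Δ φ) Δ :=
  zorn_subset_nonempty {Δ | ¬ Deduces Δ φ}
    (fun c hc hchain hne => ⟨⋃₀ c, fun hd => by
      obtain ⟨Δ, hΔ, hd⟩ := Deduces.exists_of_sUnion hchain hne hd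
      exact hc hΔ hd, fun _ => Set.subset_sUnion_of_mem⟩) Γ h

/-- The extension of an assignment of the atoms to all formulas. -/
noncomputable def eval (v : α → ℝ) : CFormula α → ℝ
  | atom x => v x
  | neg φ => 1 - eval v φ
  | half φ => eval v φ / 2
  | sub φ ψ => max (eval v φ - eval v ψ) 0

theorem isTruthAssignment_eval {v : α → ℝ} (hv : ∀ x, v x ∈ Set.Icc (0 : ℝ) 1) :
    IsTruthAssignment (eval v) := by
  refine ⟨fun φ => ?_, fun _ => rfl, fun _ => rfl, fun _ _ => rfl⟩
  induction φ with
  | atom x => exact hv x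
  | neg φ ih => exact ⟨sub_nonneg.mpr ih.2, sub_le_self _ ih.1⟩
  | half φ ih =>
    obtain ⟨h₀, h₁⟩ := ih
    constructor <;> simp only [eval] <;> linarith
  | sub φ ψ ih₁ ih₂ =>
    exact ⟨le_max_right _ _, max_le (by linarith [ih₁.2, ih₂.1]) zero_le_one⟩

/-- The set of subformulas of a formula. -/
def subformulas : CFormula α → Set (CFormula α)
  | atom x => {atom x}
  | neg φ => insert (neg φ) φ.subformulas
  | half φ => insert (half φ) φ.subformulas
  | sub φ ψ => insert (sub φ ψ) (φ.subformulas ∪ ψ.subformulas)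

theorem mem_subformulas_self (φ : CFormula α) : φ ∈ φ.subformulas := by
  cases φ <;> simp [subformulas]

theorem finite_subformulas (φ : CFormula α) : φ.subformulas.Finite := by
  induction φ with
  | atom x => exact Set.finite_singleton _
  | neg φ ih => exact ih.insert _
  | half φ ih => exact ih.insert _
  | sub φ ψ ih₁ ih₂ => exact (ih₁.union ih₂).insert _

theorem Deduces.sound (h : Deduces Γ φ) {v : CFormula α → ℝ} (hv : IsTruthAssignment v)
    (hΓ : ∀ ψ ∈ Γ, v ψ = 0) : v φ = 0 := by
  obtain ⟨hmem, hneg, hhalf, hsub⟩ := hv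
  induction h with
  | ax h =>
    have hle : ∀ φ ψ, v φ ≤ v ψ → v (sub φ ψ) = 0 := fun φ ψ h =>
      (hsub φ ψ).trans (max_eq_right (sub_nonpos.mpr h))
    cases h with
    | a1 φ ψ =>
      refine hle _ _ ?_
      rw [hsub]
      exact max_le (sub_le_self _ (hmem ψ).1) (hmem φ).1
    | a2 φ ψ ρ =>
      refine hle _ _ ?_
      simp only [hsub]
      refine max_le ?_ (le_max_right _ _)
      rw [sub_le_iff_le_add]
      refine max_le ?_ (add_nonneg (le_max_right _ _) (le_max_right _ _))
      linarith [le_max_left (v ψ - v φ) 0, le_max_left (v ρ - v ψ) 0]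
    | a3 φ ψ =>
      have hland : ∀ φ ψ, v (land φ ψ) = min (v φ) (v ψ) := by
        intro φ ψ
        have h₁ := (hmem φ).1
        have h₂ := (hmem ψ).1
        simp only [land, hsub]
        grind
      exact hle _ _ (by rw [hland, hland, min_comm])
    | a4 φ ψ => exact hle _ _ (by rw [hsub, hsub, hneg, hneg, sub_sub_sub_cancel_left])
    | a5 φ =>
      refine hle _ _ ?_
      rw [hsub, hhalf]
      exact le_max_of_le_left (by linarith)
    | a6 φ =>
      refine hle _ _ ?_
      rw [hsub, hhalf]
      exact max_le (by linarith) (by linarith [(hmem φ).1])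
  | prem hm => exact hΓ _ hm
  | @mp φ ψ _ _ ih₁ ih₂ =>
    rw [hsub, ih₁, sub_zero, max_eq_left (hmem ψ).1] at ih₂
    exact ih₂

open TruncSubAlgebra in
/-- Every totally ordered Lindenbaum algebra is matched on finitely many formulas by a truth
assignment. -/
theorem exists_truthAssignment_of_total [Inhabited (CFormula α)]
    (htot : ∀ a b : Lindenbaum Γ, a ≤ b ∨ b ≤ a) (hφ : ¬ Deduces Γ φ) (Δ : Set (CFormula α))
    (hfin : Δ.Finite) :
    ∃ v : CFormula α → ℝ, IsTruthAssignment v ∧ ∀ ψ ∈ Δ, (v ψ = 0 ↔ Deduces Γ ψ) := by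
  obtain ⟨w, whalf, wsub, wlt⟩ := HalvingAlgebra.exists_real_map htot
    ({0, 1} ∪ Lindenbaum.mk Γ '' ⋃ ψ ∈ Δ, ψ.subformulas)
    ((Set.toFinite _).union ((hfin.biUnion fun ψ _ => finite_subformulas ψ).image _))
  set s : Set (Lindenbaum Γ) := {0, 1} ∪ Lindenbaum.mk Γ '' ⋃ ψ ∈ Δ, ψ.subformulas with hs
  have zero_mem : (0 : Lindenbaum Γ) ∈ s := by simp [hs]
  have one_mem : (1 : Lindenbaum Γ) ∈ s := by simp [hs]
  have w_zero : w 0 = 0 := by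
    have h := wsub 0 0 le_rfl
    rw [sub_self_eq] at h
    linarith
  have w_mono : ∀ a ∈ s, ∀ b ∈ s, a ≤ b → w a ≤ w b := fun a ha b hb h =>
    h.eq_or_lt.elim (fun h => h ▸ le_rfl) fun h => (wlt a ha b hb h).le
  have w_one_pos : 0 < w 1 := by
    rw [← w_zero]
    refine wlt 0 zero_mem 1 one_mem ((zero_le' _).lt_of_ne fun h => hφ ?_)
    rw [← Lindenbaum.mk_eq_zero_iff, ← le_zero_iff', h]
    exact le_one' _
  have w_nonneg : ∀ a ∈ s, 0 ≤ w a := fun a ha => w_zero ▸ w_mono 0 zero_mem a ha (zero_le' a)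
  let v : α → ℝ := fun x => max 0 (min 1 (w (Lindenbaum.mk Γ (atom x)) / w 1))
  have eval_eq : ∀ ψ : CFormula α, Lindenbaum.mk Γ '' ψ.subformulas ⊆ s →
      eval v ψ = w (Lindenbaum.mk Γ ψ) / w 1 := by
    intro ψ hψ
    have mem : ∀ {χ : CFormula α}, Lindenbaum.mk Γ '' χ.subformulas ⊆ s → Lindenbaum.mk Γ χ ∈ s :=
      fun h => h (Set.mem_image_of_mem _ (mem_subformulas_self _))
    induction ψ with
    | atom x =>
      have hle := w_mono _ (mem hψ) 1 one_mem (le_one' _)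
      have h₁ := (div_le_one w_one_pos).mpr hle
      have h₀ := div_nonneg (w_nonneg _ (mem hψ)) w_one_pos.le
      simp only [eval, v, min_eq_right h₁, max_eq_right h₀]
    | neg ψ ih =>
      have h := wsub 1 (Lindenbaum.mk Γ ψ) (le_one' _)
      rw [eval, ih ((Set.image_mono (Set.subset_insert _ _)).trans hψ), Lindenbaum.mk_neg,
        ← TruncSubAlgebra.one_sub, eq_sub_of_add_eq h, sub_div, div_self w_one_pos.ne']
    | half ψ ih =>
      rw [eval, ih ((Set.image_mono (Set.subset_insert _ _)).trans hψ), Lindenbaum.mk_half,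
        ← whalf (Lindenbaum.mk Γ ψ)]
      ring
    | sub ψ χ ih₁ ih₂ =>
      have hψ' := (Set.image_mono (Set.subset_union_left.trans (Set.subset_insert _ _))).trans hψ
      have hχ' := (Set.image_mono (Set.subset_union_right.trans (Set.subset_insert _ _))).trans hψ
      rw [eval, ih₁ hψ', ih₂ hχ', Lindenbaum.mk_sub, ← sub_div]
      rcases htot (Lindenbaum.mk Γ ψ) (Lindenbaum.mk Γ χ) with h | h
      · rw [le_iff_sub.mp h, w_zero, zero_div, max_eq_right]
        exact div_nonpos_of_nonpos_of_nonneg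
          (sub_nonpos.mpr (w_mono _ (mem hψ') _ (mem hχ') h)) w_one_pos.le
      · rw [eq_sub_of_add_eq (wsub _ _ h), max_eq_left]
        exact div_nonneg (sub_nonneg.mpr (w_mono _ (mem hχ') _ (mem hψ') h)) w_one_pos.le
  refine ⟨eval v, isTruthAssignment_eval fun x =>
    ⟨le_max_left _ _, max_le zero_le_one (min_le_left _ _)⟩, fun ψ hψ => ?_⟩
  have hsub : Lindenbaum.mk Γ '' ψ.subformulas ⊆ s :=
    (Set.image_mono (Set.subset_biUnion_of_mem hψ)).trans Set.subset_union_right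
  rw [eval_eq ψ hsub, div_eq_zero_iff, or_iff_left w_one_pos.ne', ← Lindenbaum.mk_eq_zero_iff]
  refine ⟨fun h => ?_, fun h => h ▸ w_zero⟩
  by_contra hne
  have hpos := wlt 0 zero_mem _ (hsub (Set.mem_image_of_mem _ (mem_subformulas_self ψ)))
    ((zero_le' _).lt_of_ne (Ne.symm hne))
  rw [w_zero, h] at hpos
  exact hpos.false

end CFormula

/-- Completeness for free continuous propositional logics with finitely many premises:
for finite `Γ`, `Γ ⊨ φ` if and only if `Γ ⊢ φ` (in the deduction system A1–A6 with MP). -/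
theorem completeness_finite_premises {α : Type*} (Γ : Set (CFormula α)) (hΓ : Γ.Finite)
    (φ : CFormula α) :
    (∀ v : CFormula α → ℝ, IsTruthAssignment v → (∀ ψ ∈ Γ, v ψ = 0) → v φ = 0) ↔
      Deduces Γ φ := by
  refine ⟨fun h => ?_, fun h v hv hΓ => h.sound hv hΓ⟩
  by_contra hnot
  have : Inhabited (CFormula α) := ⟨φ⟩
  obtain ⟨Δ, hΓΔ, hmax⟩ := exists_maximal_not_deduces hnot
  obtain ⟨v, hv, hiff⟩ := exists_truthAssignment_of_total (Lindenbaum.le_total_of_maximal hmax)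
    hmax.prop (insert φ Γ) (hΓ.insert φ)
  refine hmax.prop ((hiff φ (Set.mem_insert _ _)).mp (h v hv fun ψ hψ => ?_))
  exact (hiff ψ (Set.mem_insert_of_mem _ hψ)).mpr (.prem (hΓΔ hψ))

end Stmt5
end

section
/- Let S be a continuous propositional logic, Σ ⊆ S and φ ∈ S. Then Σ ⊨ φ if and only if Σ ⊢ φ ∸ 2^{−n} for every natural number n, where 2⁰ denotes ¬(φ₀∸φ₀) for a fixed φ₀ ∈ S and 2^{−(n+1)} = ½(2^{−n}). -/
namespace Stmt8

/-- A continuous propositional logic: a set equipped with a binary operation `∸` and unary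
operations `¬` and `½` (no axioms imposed). -/
structure CPL (S : Type*) where
  sub : S → S → S
  neg : S → S
  half : S → S

variable {S : Type*}

/-- A truth assignment on a continuous propositional logic: a map into `[0,1]` respecting
the connectives. -/
def CPL.IsTruthAssignment (L : CPL S) (v : S → ℝ) : Prop :=
  (∀ φ : S, v φ ∈ Set.Icc (0 : ℝ) 1) ∧
  (∀ φ : S, v (L.neg φ) = 1 - v φ) ∧
  (∀ φ : S, v (L.half φ) = v φ / 2) ∧
  (∀ φ ψ : S, v (L.sub φ ψ) = max (v φ - v ψ) 0)

/-- `φ ∧ ψ` abbreviates `φ ∸ (φ ∸ ψ)`. -/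
def CPL.land (L : CPL S) (φ ψ : S) : S := L.sub φ (L.sub φ ψ)

/-- The axiom schemes A1–A6 of continuous propositional logic. -/
inductive CPL.Axiom (L : CPL S) : S → Prop where
  | a1 (φ ψ : S) : CPL.Axiom L (L.sub (L.sub φ ψ) φ)
  | a2 (φ ψ ρ : S) : CPL.Axiom L (L.sub (L.sub (L.sub ρ φ) (L.sub ρ ψ)) (L.sub ψ φ))
  | a3 (φ ψ : S) : CPL.Axiom L (L.sub (L.land φ ψ) (L.land ψ φ))
  | a4 (φ ψ : S) : CPL.Axiom L (L.sub (L.sub φ ψ) (L.sub (L.neg ψ) (L.neg φ)))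
  | a5 (φ : S) : CPL.Axiom L (L.sub (L.half φ) (L.sub φ (L.half φ)))
  | a6 (φ : S) : CPL.Axiom L (L.sub (L.sub φ (L.half φ)) (L.half φ))

/-- Formal deduction from a set of premises `Γ`, using the axiom schemes A1–A6 and
Modus Ponens (from `φ` and `ψ ∸ φ` infer `ψ`). -/
inductive CPL.Deduces (L : CPL S) (Γ : Set S) : S → Prop where
  | ax {φ : S} : CPL.Axiom L φ → CPL.Deduces L Γ φ
  | prem {φ : S} : φ ∈ Γ → CPL.Deduces L Γ φ
  | mp {φ ψ : S} : CPL.Deduces L Γ φ → CPL.Deduces L Γ (L.sub ψ φ) → CPL.Deduces L Γ ψ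

/-- `2⁰` is `¬(φ₀ ∸ φ₀)` for a fixed formula `φ₀`, and `2^{-(n+1)} = ½ 2^{-n}`. -/
def CPL.twoPowNeg (L : CPL S) (φ₀ : S) : ℕ → S
  | 0 => L.neg (L.sub φ₀ φ₀)
  | n + 1 => L.half (L.twoPowNeg φ₀ n)

/-- A theory: a set of formulas containing the axioms and closed under Modus Ponens. The relation
`L.sub a b ∈ T` is the preorder `a ≤ b` of its Lindenbaum algebra, and `a ∈ T` says `a = 0`. -/
structure CPL.IsTheory (L : CPL S) (T : Set S) : Prop where
  ax : ∀ {a : S}, CPL.Axiom L a → a ∈ T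
  mp : ∀ {a b : S}, a ∈ T → L.sub b a ∈ T → b ∈ T

namespace CPL.IsTheory

variable {L : CPL S} {T : Set S}

/-! ### The preorder of a theory -/

theorem sub_le (hT : L.IsTheory T) (a b : S) : L.sub (L.sub a b) a ∈ T :=
  hT.ax (.a1 a b)

theorem trans (hT : L.IsTheory T) {a b c : S} (hab : L.sub a b ∈ T) (hbc : L.sub b c ∈ T) :
    L.sub a c ∈ T :=
  hT.mp hab (hT.mp hbc (hT.ax (.a2 c b a)))

theorem sub_le_sub_left (hT : L.IsTheory T) {a b : S} (h : L.sub b a ∈ T) (c : S) :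
    L.sub (L.sub c a) (L.sub c b) ∈ T :=
  hT.mp h (hT.ax (.a2 a b c))

theorem land_comm (hT : L.IsTheory T) (a b : S) :
    L.sub (L.sub a (L.sub a b)) (L.sub b (L.sub b a)) ∈ T :=
  hT.ax (.a3 a b)

theorem land_le_right (hT : L.IsTheory T) (a b : S) : L.sub (L.sub a (L.sub a b)) b ∈ T :=
  hT.trans (hT.land_comm a b) (hT.sub_le _ _)

theorem sub_right_comm (hT : L.IsTheory T) (a b c : S) :
    L.sub (L.sub (L.sub a b) c) (L.sub (L.sub a c) b) ∈ T :=
  hT.trans (hT.sub_le_sub_left (hT.land_le_right a c) _) (hT.ax (.a2 b (L.sub a c) a))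

theorem mem_right_comm (hT : L.IsTheory T) {a b c : S} (h : L.sub (L.sub a b) c ∈ T) :
    L.sub (L.sub a c) b ∈ T :=
  hT.mp h (hT.sub_right_comm a c b)

theorem sub_self (hT : L.IsTheory T) (a : S) : L.sub a a ∈ T :=
  hT.mp (hT.sub_le a a) (hT.mem_right_comm (hT.sub_le a (L.sub (L.sub a a) a)))

theorem le_of_mem (hT : L.IsTheory T) {a : S} (h : a ∈ T) (b : S) : L.sub a b ∈ T :=
  hT.mp h (hT.sub_le a b)

theorem le_sub_of_mem (hT : L.IsTheory T) {b : S} (h : b ∈ T) (a : S) :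
    L.sub a (L.sub a b) ∈ T :=
  hT.mp h (hT.land_le_right a b)

theorem sub_le_sub_right (hT : L.IsTheory T) {a b : S} (h : L.sub a b ∈ T) (c : S) :
    L.sub (L.sub a c) (L.sub b c) ∈ T :=
  hT.mp h (hT.mem_right_comm (hT.ax (.a2 c b a)))

theorem le_land_of_le (hT : L.IsTheory T) {a c : S} (h : L.sub a c ∈ T) :
    L.sub a (L.sub c (L.sub c a)) ∈ T :=
  hT.trans (hT.le_sub_of_mem h a) (hT.land_comm a c)

theorem le_land (hT : L.IsTheory T) {a b c : S} (ha : L.sub c a ∈ T) (hb : L.sub c b ∈ T) :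
    L.sub c (L.sub a (L.sub a b)) ∈ T :=
  hT.trans (hT.le_land_of_le ha) (hT.sub_le_sub_left (hT.sub_le_sub_left hb a) a)

/-! ### Negation -/

theorem le_neg_neg (hT : L.IsTheory T) (a : S) : L.sub a (L.neg (L.neg a)) ∈ T :=
  hT.trans (hT.le_sub_of_mem (hT.sub_self a) a)
    (hT.trans (hT.ax (.a4 _ _)) (hT.trans (hT.ax (.a4 _ _)) (hT.sub_le _ _)))

theorem neg_neg_le (hT : L.IsTheory T) (a : S) : L.sub (L.neg (L.neg a)) a ∈ T :=
  hT.mp (hT.le_neg_neg (L.neg a)) (hT.ax (.a4 _ _))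

theorem neg_sub_neg_le (hT : L.IsTheory T) (a b : S) :
    L.sub (L.sub (L.neg b) (L.neg a)) (L.sub a b) ∈ T :=
  hT.trans (hT.ax (.a4 _ _)) (hT.trans (hT.sub_le_sub_right (hT.neg_neg_le a) _)
    (hT.sub_le_sub_left (hT.le_neg_neg b) _))

theorem neg_le_neg (hT : L.IsTheory T) {a b : S} (h : L.sub a b ∈ T) :
    L.sub (L.neg b) (L.neg a) ∈ T :=
  hT.mp h (hT.neg_sub_neg_le a b)

theorem neg_neg_mem (hT : L.IsTheory T) {a : S} (h : a ∈ T) : L.neg (L.neg a) ∈ T :=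
  hT.mp h (hT.neg_neg_le a)

theorem le_neg_of_mem (hT : L.IsTheory T) {z : S} (hz : z ∈ T) (a : S) :
    L.sub a (L.neg z) ∈ T :=
  hT.mp (hT.le_of_mem (hT.neg_neg_mem hz) _) (hT.ax (.a4 _ _))

theorem one_sub_le_neg (hT : L.IsTheory T) (z a : S) :
    L.sub (L.sub (L.neg z) a) (L.neg a) ∈ T :=
  hT.trans (hT.ax (.a4 _ _)) (hT.sub_le _ _)

theorem neg_le_one_sub (hT : L.IsTheory T) {z : S} (hz : z ∈ T) (a : S) :
    L.sub (L.neg a) (L.sub (L.neg z) a) ∈ T :=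
  hT.trans (hT.le_sub_of_mem (hT.neg_neg_mem hz) _) (hT.neg_sub_neg_le _ _)

theorem sub_le_sub_sub_sub_left (hT : L.IsTheory T) {y c : S} (h : L.sub y c ∈ T) (x : S) :
    L.sub (L.sub y x) (L.sub (L.sub c x) (L.sub c y)) ∈ T :=
  hT.trans (hT.sub_le_sub_right (hT.le_land_of_le h) x) (hT.sub_right_comm _ _ _)

theorem sub_le_sub_sub_sub_right (hT : L.IsTheory T) {u b : S} (h : L.sub u b ∈ T) (a : S) :
    L.sub (L.sub a b) (L.sub (L.sub a u) (L.sub b u)) ∈ T :=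
  hT.trans (hT.ax (.a4 a b)) (hT.trans (hT.sub_le_sub_sub_sub_left (hT.neg_le_neg h) (L.neg a))
    (hT.trans (hT.sub_le_sub_right (hT.neg_sub_neg_le a u) _)
      (hT.sub_le_sub_left (hT.ax (.a4 b u)) _)))

theorem neg_le_neg_sub (hT : L.IsTheory T) {a m t : S} (hm : L.sub m a ∈ T)
    (ht : L.sub t (L.sub a m) ∈ T) : L.sub (L.neg a) (L.sub (L.neg m) t) ∈ T :=
  hT.trans (hT.le_land_of_le (hT.neg_le_neg hm))
    (hT.sub_le_sub_left (hT.trans ht (hT.ax (.a4 _ _))) _)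

/-- Prelinearity: the infimum of `a ∸ b` and `b ∸ a` is zero. -/
theorem mem_of_le_sub_of_le_sub (hT : L.IsTheory T) {a b t : S}
    (hab : L.sub t (L.sub a b) ∈ T) (hba : L.sub t (L.sub b a) ∈ T) : t ∈ T := by
  set m := L.sub a (L.sub a b)
  have hma : L.sub m a ∈ T := hT.sub_le _ _
  have hmb : L.sub m b ∈ T := hT.land_le_right _ _
  have hta : L.sub t (L.sub a m) ∈ T := hT.trans hab (hT.sub_le_sub_left hmb _)
  have htb : L.sub t (L.sub b m) ∈ T := hT.trans hba (hT.sub_le_sub_left hma _)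
  have hle : ∀ {c : S}, L.sub m c ∈ T → L.sub t (L.sub c m) ∈ T →
      L.sub (L.neg (L.sub (L.neg m) t)) c ∈ T := fun h h' =>
    hT.trans (hT.neg_le_neg (hT.neg_le_neg_sub h h')) (hT.neg_neg_le _)
  have hsum : L.sub (L.neg m) (L.sub (L.neg m) t) ∈ T :=
    hT.trans (hT.neg_le_neg (hT.le_land (hle hma hta) (hle hmb htb))) (hT.neg_neg_le _)
  have htm : L.sub t (L.neg m) ∈ T :=
    hT.trans hta (hT.trans (hT.ax (.a4 _ _)) (hT.sub_le _ _))
  exact hT.mp hsum (hT.le_land_of_le htm)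

/-! ### Iterated subtraction -/

theorem iterate_sub_mono (hT : L.IsTheory T) (u : S) (k : ℕ) {a b : S} (h : L.sub a b ∈ T) :
    L.sub ((L.sub · u)^[k] a) ((L.sub · u)^[k] b) ∈ T := by
  induction k with
  | zero => exact h
  | succ k ih =>
    simp only [Function.iterate_succ_apply']
    exact hT.sub_le_sub_right ih u

theorem iterate_sub_le (hT : L.IsTheory T) (u : S) (k : ℕ) (a : S) :
    L.sub ((L.sub · u)^[k] a) a ∈ T := by
  induction k with
  | zero => exact hT.sub_self a
  | succ k ih =>
    simp only [Function.iterate_succ_apply']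
    exact hT.trans (hT.sub_le _ _) ih

theorem sub_iterate_right_comm (hT : L.IsTheory T) (u : S) (k : ℕ) (a b : S) :
    L.sub (L.sub ((L.sub · u)^[k] a) b) ((L.sub · u)^[k] (L.sub a b)) ∈ T := by
  induction k with
  | zero => exact hT.sub_self _
  | succ k ih =>
    simp only [Function.iterate_succ_apply']
    exact hT.trans (hT.sub_right_comm _ _ _) (hT.sub_le_sub_right ih u)

theorem mem_of_iterate_sub_mem (hT : L.IsTheory T) {x y : S}
    (hxy : ∀ c, L.sub c x ∈ T → L.sub c y ∈ T → c ∈ T) (m n : ℕ) (c : S)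
    (hm : (L.sub · x)^[m] c ∈ T) (hn : (L.sub · y)^[n] c ∈ T) : c ∈ T := by
  induction m generalizing n c with
  | zero => exact hm
  | succ m ihm =>
    induction n generalizing c with
    | zero => exact hn
    | succ n ihn =>
      have hle : ∀ z, L.sub (L.sub c z) c ∈ T := hT.sub_le c
      refine hxy c (ihm (n + 1) _ hm (hT.mp hn (hT.iterate_sub_mono y _ (hle x)))) (ihn _ ?_ hn)
      exact hT.mp hm (hT.iterate_sub_mono x _ (hle y))

/-! ### Prime extensions -/

/-- The theory generated by a theory `T` and a formula `x`. -/
theorem adjoin (hT : L.IsTheory T) (x : S) :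
    L.IsTheory {a | ∃ n : ℕ, (L.sub · x)^[n] a ∈ T} where
  ax h := ⟨0, hT.ax h⟩
  mp := by
    rintro a b ⟨n, hn⟩ ⟨m, hm⟩
    refine ⟨n + m, ?_⟩
    rw [Function.iterate_add_apply]
    exact hT.mp hn (hT.iterate_sub_mono x n (hT.mp hm (hT.sub_iterate_right_comm x m b a)))

theorem sUnion {C : Set (Set S)} (hC : ∀ U ∈ C, L.IsTheory U) (hchain : IsChain (· ⊆ ·) C)
    (hne : C.Nonempty) : L.IsTheory (⋃₀ C) where
  ax h := by
    obtain ⟨U, hU⟩ := hne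
    exact ⟨U, hU, (hC U hU).ax h⟩
  mp := by
    rintro a b ⟨U, hU, ha⟩ ⟨V, hV, hb⟩
    rcases hchain.total hU hV with h | h
    · exact ⟨V, hV, (hC V hV).mp (h ha) hb⟩
    · exact ⟨U, hU, (hC U hU).mp ha (h hb)⟩

theorem exists_prime_extension (hT : L.IsTheory T) {c : S} (hc : c ∉ T) :
    ∃ U, T ⊆ U ∧ L.IsTheory U ∧ c ∉ U ∧ ∀ a b, L.sub a b ∈ U ∨ L.sub b a ∈ U := by
  obtain ⟨U, hTU, hU⟩ := zorn_subset_nonempty {U | L.IsTheory U ∧ c ∉ U}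
    (fun C hC hchain hne => ⟨⋃₀ C, ⟨sUnion (fun V hV => (hC hV).1) hchain hne,
      fun ⟨V, hV, hcV⟩ => (hC hV).2 hcV⟩, fun V hV => Set.subset_sUnion_of_mem hV⟩) T ⟨hT, hc⟩
  have hUT : L.IsTheory U := hU.prop.1
  have key : ∀ x, x ∉ U → ∃ n : ℕ, (L.sub · x)^[n] c ∈ U := by
    intro x hx
    by_contra h
    exact hx (hU.le_of_ge (y := {a | ∃ n : ℕ, (L.sub · x)^[n] a ∈ U}) ⟨hUT.adjoin x, h⟩
      (fun a ha => ⟨0, ha⟩) ⟨1, hUT.sub_self x⟩)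
  refine ⟨U, hTU, hUT, hU.prop.2, fun a b => ?_⟩
  by_contra! h
  obtain ⟨m, hm⟩ := key _ h.1
  obtain ⟨n, hn⟩ := key _ h.2
  exact hU.prop.2 (hUT.mem_of_iterate_sub_mem
    (fun _ => hUT.mem_of_le_sub_of_le_sub) m n c hm hn)

end CPL.IsTheory

/-! ### Counting how often a formula can be subtracted -/

/-- The least number of subtractions of `u` that bring `a` into `T`. -/
noncomputable def CPL.subCount (L : CPL S) (T : Set S) (u a : S) : ℕ :=
  sInf {k | (L.sub · u)^[k] a ∈ T}

namespace CPL.IsTheory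

variable {L : CPL S} {T : Set S} {u : S}

theorem subCount_le_iff (hT : L.IsTheory T) {a : S} (hu : ∃ k, (L.sub · u)^[k] a ∈ T) {k : ℕ} :
    L.subCount T u a ≤ k ↔ (L.sub · u)^[k] a ∈ T := by
  refine ⟨fun h => ?_, fun h => Nat.sInf_le h⟩
  obtain ⟨d, rfl⟩ := Nat.exists_eq_add_of_le' h
  rw [Function.iterate_add_apply]
  exact hT.mp (Nat.sInf_mem hu) (hT.iterate_sub_le u d _)

theorem iterate_subCount_mem {a : S} (hu : ∃ k, (L.sub · u)^[k] a ∈ T) :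
    (L.sub · u)^[L.subCount T u a] a ∈ T :=
  Nat.sInf_mem hu

theorem subCount_mono (hT : L.IsTheory T) (hu : ∀ a, ∃ k, (L.sub · u)^[k] a ∈ T) {a b : S}
    (h : L.sub a b ∈ T) : L.subCount T u a ≤ L.subCount T u b :=
  (hT.subCount_le_iff (hu a)).2
    (hT.mp (iterate_subCount_mem (hu b)) (hT.iterate_sub_mono u _ h))

theorem subCount_le_add (hT : L.IsTheory T) (hu : ∀ a, ∃ k, (L.sub · u)^[k] a ∈ T) (a b : S) :
    L.subCount T u a ≤ L.subCount T u b + L.subCount T u (L.sub a b) := by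
  rw [hT.subCount_le_iff (hu a), Function.iterate_add_apply]
  have h := hT.mp (iterate_subCount_mem (hu (L.sub a b))) (hT.sub_iterate_right_comm u _ a b)
  exact hT.mp (iterate_subCount_mem (hu b)) (hT.iterate_sub_mono u _ h)

theorem sub_le_iterate_sub (hT : L.IsTheory T) (htot : ∀ a b, L.sub a b ∈ T ∨ L.sub b a ∈ T)
    (k : ℕ) {a b : S} (hk : (L.sub · u)^[k] b ∉ T) :
    L.sub (L.sub a b) ((L.sub · u)^[k] a) ∈ T := by
  induction k generalizing a b with
  | zero => exact hT.sub_le a b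
  | succ k ih =>
    rw [Function.iterate_succ_apply] at hk ⊢
    have hub : L.sub u b ∈ T := (htot u b).resolve_right fun h =>
      hk (hT.mp h (hT.iterate_sub_le u k _))
    exact hT.trans (hT.sub_le_sub_sub_sub_right hub a) (ih hk)

theorem subCount_add_le (hT : L.IsTheory T) (htot : ∀ a b, L.sub a b ∈ T ∨ L.sub b a ∈ T)
    (hu : ∀ a, ∃ k, (L.sub · u)^[k] a ∈ T) {a b : S} (hba : L.sub b a ∈ T) :
    L.subCount T u b + L.subCount T u (L.sub a b) ≤ L.subCount T u a + 1 := by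
  have hb := hT.subCount_mono hu hba
  have hc := hT.subCount_mono hu (hT.sub_le a b)
  by_contra! h
  obtain ⟨j, hj⟩ : ∃ j, L.subCount T u b = j + 1 := Nat.exists_eq_succ_of_ne_zero (by omega)
  obtain ⟨k, hk⟩ : ∃ k, L.subCount T u (L.sub a b) = k + 1 :=
    Nat.exists_eq_succ_of_ne_zero (by omega)
  have hj' : (L.sub · u)^[j] b ∉ T := fun hmem => by
    have := (hT.subCount_le_iff (hu b)).2 hmem
    omega
  have hmem : (L.sub · u)^[k] ((L.sub · u)^[j] a) ∈ T := by
    rw [← Function.iterate_add_apply, ← hT.subCount_le_iff (hu a)]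
    omega
  have := (hT.subCount_le_iff (hu (L.sub a b))).2
    (hT.mp hmem (hT.iterate_sub_mono u k (hT.sub_le_iterate_sub htot j hj')))
  omega

theorem subCount_eq_zero {a : S} (h : a ∈ T) : L.subCount T u a = 0 :=
  Nat.le_zero.1 (Nat.sInf_le h)

/-! ### Dyadic constants -/

theorem half_le (hT : L.IsTheory T) (a : S) : L.sub (L.half a) a ∈ T :=
  hT.trans (hT.ax (.a5 a)) (hT.sub_le _ _)

theorem sub_half_sub_half_le (hT : L.IsTheory T) (a b : S) :
    L.sub (L.sub (L.sub a (L.half b)) (L.half b)) (L.sub a b) ∈ T :=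
  hT.mem_right_comm (hT.trans (hT.ax (.a2 _ _ _)) (hT.ax (.a6 b)))

theorem sub_le_sub_half_sub_half (hT : L.IsTheory T) (a b : S) :
    L.sub (L.sub a b) (L.sub (L.sub a (L.half b)) (L.half b)) ∈ T :=
  hT.trans (hT.sub_le_sub_sub_sub_right (hT.half_le b) a) (hT.sub_le_sub_left (hT.ax (.a5 b)) _)

theorem iterate_sub_half_le (hT : L.IsTheory T) (u : S) (k : ℕ) (a : S) :
    L.sub ((L.sub · (L.half u))^[2 * k] a) ((L.sub · u)^[k] a) ∈ T := by
  induction k with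
  | zero => exact hT.sub_self a
  | succ k ih =>
    rw [mul_add_one, Function.iterate_succ_apply', Function.iterate_succ_apply',
      Function.iterate_succ_apply']
    exact hT.trans (hT.sub_half_sub_half_le _ u) (hT.sub_le_sub_right ih u)

theorem iterate_sub_le_half (hT : L.IsTheory T) (u : S) (k : ℕ) (a : S) :
    L.sub ((L.sub · u)^[k] a) ((L.sub · (L.half u))^[2 * k] a) ∈ T := by
  induction k with
  | zero => exact hT.sub_self a
  | succ k ih =>
    rw [mul_add_one, Function.iterate_succ_apply', Function.iterate_succ_apply',
      Function.iterate_succ_apply']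
    exact hT.trans (hT.sub_le_sub_right ih u) (hT.sub_le_sub_half_sub_half _ u)

theorem iterate_twoPowNeg_mem (hT : L.IsTheory T) (φ₀ : S) (n : ℕ) (a : S) :
    (L.sub · (L.twoPowNeg φ₀ n))^[2 ^ n] a ∈ T := by
  induction n with
  | zero => exact hT.le_neg_of_mem (hT.sub_self φ₀) a
  | succ n ih =>
    rw [pow_succ']
    exact hT.mp ih (hT.iterate_sub_half_le _ _ a)

theorem exists_iterate_twoPowNeg_mem (hT : L.IsTheory T) (φ₀ : S) (n : ℕ) (a : S) :
    ∃ k, (L.sub · (L.twoPowNeg φ₀ n))^[k] a ∈ T :=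
  ⟨_, hT.iterate_twoPowNeg_mem φ₀ n a⟩

theorem twoPowNeg_le_iterate (hT : L.IsTheory T) (φ₀ : S) (n : ℕ) :
    L.sub (L.twoPowNeg φ₀ n)
      ((L.sub · (L.twoPowNeg φ₀ n))^[2 ^ n - 1] (L.twoPowNeg φ₀ 0)) ∈ T := by
  induction n with
  | zero => exact hT.sub_self _
  | succ n ih =>
    have hpow : 2 ^ (n + 1) - 1 = 2 * (2 ^ n - 1) + 1 := by
      have := Nat.one_le_two_pow (n := n)
      rw [pow_succ']
      omega
    rw [hpow, Function.iterate_succ_apply']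
    exact hT.trans (hT.ax (.a5 _))
      (hT.sub_le_sub_right (hT.trans ih (hT.iterate_sub_le_half _ _ _)) _)

theorem twoPowNeg_notMem (hT : L.IsTheory T) (φ₀ : S) {c : S} (hc : c ∉ T) (n : ℕ) :
    L.twoPowNeg φ₀ n ∉ T := by
  induction n with
  | zero => exact fun h => hc (hT.mp h (hT.le_neg_of_mem (hT.sub_self φ₀) c))
  | succ n ih => exact fun h => ih (hT.mp h (hT.mp h (hT.ax (.a6 _))))

theorem subCount_one (hT : L.IsTheory T) (φ₀ : S) {c : S} (hc : c ∉ T) (n : ℕ) :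
    L.subCount T (L.twoPowNeg φ₀ n) (L.twoPowNeg φ₀ 0) = 2 ^ n := by
  have hfin := hT.exists_iterate_twoPowNeg_mem φ₀ n (L.twoPowNeg φ₀ 0)
  refine le_antisymm ((hT.subCount_le_iff hfin).2 (hT.iterate_twoPowNeg_mem φ₀ n _)) ?_
  by_contra! h
  exact hT.twoPowNeg_notMem φ₀ hc n
    (hT.mp ((hT.subCount_le_iff hfin).1 (Nat.le_sub_one_of_lt h)) (hT.twoPowNeg_le_iterate φ₀ n))

theorem subCount_succ_le (hT : L.IsTheory T) (φ₀ : S) (n : ℕ) (a : S) :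
    L.subCount T (L.twoPowNeg φ₀ (n + 1)) a ≤ 2 * L.subCount T (L.twoPowNeg φ₀ n) a := by
  rw [hT.subCount_le_iff (hT.exists_iterate_twoPowNeg_mem φ₀ (n + 1) a)]
  exact hT.mp (iterate_subCount_mem (hT.exists_iterate_twoPowNeg_mem φ₀ n a))
    (hT.iterate_sub_half_le _ _ a)

theorem sub_twoPowNeg_le_iterate (hT : L.IsTheory T) (φ₀ : S) (n m : ℕ) (a : S) :
    L.sub (L.sub a (L.twoPowNeg φ₀ n)) ((L.sub · (L.twoPowNeg φ₀ (n + m)))^[2 ^ m] a) ∈ T := by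
  induction m with
  | zero => exact hT.sub_self _
  | succ m ih =>
    rw [pow_succ']
    exact hT.trans ih (hT.iterate_sub_le_half _ _ a)

end CPL.IsTheory

/-! ### The truth assignment of a prime theory -/

/-- The value of a formula in the real interval, approximated by dyadic rationals from above. -/
noncomputable def CPL.value (L : CPL S) (T : Set S) (φ₀ a : S) : ℝ :=
  ⨅ n : ℕ, (L.subCount T (L.twoPowNeg φ₀ n) a : ℝ) / 2 ^ n

namespace CPL.IsTheory

open Filter Topology

variable {L : CPL S} {T : Set S}

theorem tendsto_value (hT : L.IsTheory T) (φ₀ a : S) :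
    Tendsto (fun n : ℕ => (L.subCount T (L.twoPowNeg φ₀ n) a : ℝ) / 2 ^ n) atTop
      (𝓝 (L.value T φ₀ a)) := by
  refine tendsto_atTop_ciInf (antitone_nat_of_succ_le fun n => ?_)
    ⟨0, by rintro _ ⟨n, rfl⟩; positivity⟩
  have h : (L.subCount T (L.twoPowNeg φ₀ (n + 1)) a : ℝ) ≤
      2 * L.subCount T (L.twoPowNeg φ₀ n) a := by
    exact_mod_cast hT.subCount_succ_le φ₀ n a
  rw [pow_succ, div_le_div_iff₀ (by positivity) (by positivity)]
  nlinarith [pow_pos (two_pos : (0 : ℝ) < 2) n]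

theorem value_nonneg (L : CPL S) (T : Set S) (φ₀ a : S) : 0 ≤ L.value T φ₀ a :=
  Real.iInf_nonneg fun n => by positivity

theorem value_mono (hT : L.IsTheory T) (φ₀ : S) {a b : S} (h : L.sub a b ∈ T) :
    L.value T φ₀ a ≤ L.value T φ₀ b := by
  refine le_of_tendsto_of_tendsto' (hT.tendsto_value φ₀ a) (hT.tendsto_value φ₀ b) fun n => ?_
  have := hT.subCount_mono (hT.exists_iterate_twoPowNeg_mem φ₀ n) h
  gcongr

theorem value_eq_zero (φ₀ : S) {a : S} (h : a ∈ T) :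
    L.value T φ₀ a = 0 := by
  simp [CPL.value, subCount_eq_zero h]

theorem value_one (hT : L.IsTheory T) (φ₀ : S) {c : S} (hc : c ∉ T) :
    L.value T φ₀ (L.twoPowNeg φ₀ 0) = 1 := by
  simp [CPL.value, hT.subCount_one φ₀ hc]

theorem value_sub_of_le (hT : L.IsTheory T) (htot : ∀ a b, L.sub a b ∈ T ∨ L.sub b a ∈ T)
    (φ₀ : S) {a b : S} (h : L.sub b a ∈ T) :
    L.value T φ₀ (L.sub a b) = L.value T φ₀ a - L.value T φ₀ b := by
  have hsum := (hT.tendsto_value φ₀ b).add (hT.tendsto_value φ₀ (L.sub a b))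
  have hpow : Tendsto (fun n : ℕ => (1 : ℝ) / 2 ^ n) atTop (𝓝 0) := by
    simpa using tendsto_pow_atTop_nhds_zero_of_lt_one (r := (2 : ℝ)⁻¹) (by norm_num) (by norm_num)
  have hle : L.value T φ₀ a ≤ L.value T φ₀ b + L.value T φ₀ (L.sub a b) := by
    refine le_of_tendsto_of_tendsto' (hT.tendsto_value φ₀ a) hsum fun n => ?_
    have := hT.subCount_le_add (hT.exists_iterate_twoPowNeg_mem φ₀ n) a b
    rw [← add_div]
    gcongr
    exact_mod_cast this
  have hge : L.value T φ₀ b + L.value T φ₀ (L.sub a b) ≤ L.value T φ₀ a + 0 := by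
    refine le_of_tendsto_of_tendsto' hsum ((hT.tendsto_value φ₀ a).add hpow) fun n => ?_
    have := hT.subCount_add_le htot (hT.exists_iterate_twoPowNeg_mem φ₀ n) h
    rw [← add_div, ← add_div]
    exact div_le_div_of_nonneg_right (by exact_mod_cast this) (by positivity)
  linarith

theorem isTruthAssignment_value (hT : L.IsTheory T)
    (htot : ∀ a b, L.sub a b ∈ T ∨ L.sub b a ∈ T) (φ₀ : S) {c : S} (hc : c ∉ T) :
    L.IsTruthAssignment (L.value T φ₀) := by
  have hzero : L.sub φ₀ φ₀ ∈ T := hT.sub_self φ₀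
  have hone := hT.value_one φ₀ hc
  have hle_one : ∀ a, L.sub a (L.twoPowNeg φ₀ 0) ∈ T := hT.le_neg_of_mem hzero
  refine ⟨fun a => ⟨value_nonneg L T φ₀ a, hone ▸ hT.value_mono φ₀ (hle_one a)⟩,
    fun a => ?_, fun a => ?_, fun a b => ?_⟩
  · rw [← hone, ← hT.value_sub_of_le htot φ₀ (hle_one a)]
    exact le_antisymm (hT.value_mono φ₀ (hT.neg_le_one_sub hzero a))
      (hT.value_mono φ₀ (hT.one_sub_le_neg _ a))
  · have h := hT.value_sub_of_le htot φ₀ (hT.half_le a)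
    have h₁ := hT.value_mono φ₀ (hT.ax (.a5 a))
    have h₂ := hT.value_mono φ₀ (hT.ax (.a6 a))
    linarith
  · rcases htot a b with h | h
    · rw [value_eq_zero φ₀ h, max_eq_right (sub_nonpos.2 (hT.value_mono φ₀ h))]
    · rw [hT.value_sub_of_le htot φ₀ h, max_eq_left (sub_nonneg.2 (hT.value_mono φ₀ h))]

theorem value_ne_zero (hT : L.IsTheory T) (φ₀ : S) {a : S} {n : ℕ}
    (h : L.sub a (L.twoPowNeg φ₀ n) ∉ T) : L.value T φ₀ a ≠ 0 := by
  have hlim := (tendsto_add_atTop_iff_nat n).2 (hT.tendsto_value φ₀ a)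
  have hle : 1 / 2 ^ n ≤ L.value T φ₀ a := by
    refine ge_of_tendsto' hlim fun m => ?_
    have hlt : 2 ^ m < L.subCount T (L.twoPowNeg φ₀ (m + n)) a := by
      by_contra! hcon
      rw [hT.subCount_le_iff (hT.exists_iterate_twoPowNeg_mem φ₀ _ a), add_comm m n] at hcon
      exact h (hT.mp hcon (hT.sub_twoPowNeg_le_iterate φ₀ n m a))
    have hlt' : (2 : ℝ) ^ m ≤ L.subCount T (L.twoPowNeg φ₀ (m + n)) a := by
      exact_mod_cast hlt.le
    rw [pow_add, div_le_div_iff₀ (by positivity) (by positivity)]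
    nlinarith [pow_pos (two_pos : (0 : ℝ) < 2) n]
  exact ((by positivity : (0 : ℝ) < 1 / 2 ^ n).trans_le hle).ne'

end CPL.IsTheory

theorem CPL.isTheory_deduces (L : CPL S) (Γ : Set S) : L.IsTheory {a | L.Deduces Γ a} where
  ax h := .ax h
  mp ha hb := .mp ha hb

/-! ### Soundness -/

namespace CPL.IsTruthAssignment

variable {L : CPL S} {v : S → ℝ}

theorem eq_zero_of_ax (hv : L.IsTruthAssignment v) {a : S} (h : L.Axiom a) : v a = 0 := by
  obtain ⟨hI, hn, hh, hs⟩ := hv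
  have hle : ∀ {x : ℝ}, x ≤ 0 → max x 0 = 0 := max_eq_right
  have hnonneg : ∀ φ, 0 ≤ v φ := fun φ => (hI φ).1
  cases h with
  | a1 φ ψ =>
    simp only [hs]
    refine hle (sub_nonpos.2 (max_le ?_ (hnonneg φ)))
    linarith [hnonneg ψ]
  | a2 φ ψ ρ =>
    simp only [hs]
    generalize v φ = x, v ψ = y, v ρ = z
    clear * -
    grind
  | a3 φ ψ =>
    simp only [CPL.land, hs]
    have hx := hnonneg φ
    have hy := hnonneg ψ
    generalize v φ = x, v ψ = y at hx hy ⊢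
    clear * - hx hy
    grind
  | a4 φ ψ =>
    simp [hs, hn]
  | a5 φ =>
    simp only [hs, hh]
    exact hle (sub_nonpos.2 (le_max_of_le_left (by linarith)))
  | a6 φ =>
    simp only [hs, hh]
    exact hle (sub_nonpos.2 (max_le (by linarith) (by linarith [hnonneg φ])))

theorem eq_zero_of_deduces (hv : L.IsTruthAssignment v) {Γ : Set S} (hΓ : ∀ ψ ∈ Γ, v ψ = 0)
    {a : S} (h : L.Deduces Γ a) : v a = 0 := by
  induction h with
  | ax h => exact hv.eq_zero_of_ax h
  | prem h => exact hΓ _ h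
  | mp _ _ ih₁ ih₂ =>
    rw [hv.2.2.2, ih₁, sub_zero] at ih₂
    exact le_antisymm (max_eq_right_iff.1 ih₂) (hv.1 _).1

theorem apply_twoPowNeg (hv : L.IsTruthAssignment v) (φ₀ : S) (n : ℕ) :
    v (L.twoPowNeg φ₀ n) = (1 / 2) ^ n := by
  induction n with
  | zero => simp [CPL.twoPowNeg, hv.2.1, hv.2.2.2]
  | succ n ih => rw [CPL.twoPowNeg, hv.2.2.1, ih, pow_succ]; ring

end CPL.IsTruthAssignment

/-- Approximated completeness: `Γ ⊨ φ` if and only if `Γ ⊢ φ ∸ 2^{-n}` for every `n`. -/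
theorem entails_iff_deduces_approx [Nonempty S] (L : CPL S) (Γ : Set S) (φ φ₀ : S) :
    (∀ v : S → ℝ, L.IsTruthAssignment v → (∀ ψ ∈ Γ, v ψ = 0) → v φ = 0) ↔
      ∀ n : ℕ, CPL.Deduces L Γ (L.sub φ (L.twoPowNeg φ₀ n)) := by
  constructor
  · intro h n
    by_contra hn
    obtain ⟨T, hΓT, hT, hnT, htot⟩ := (L.isTheory_deduces Γ).exists_prime_extension hn
    exact hT.value_ne_zero φ₀ hnT (h _ (hT.isTruthAssignment_value htot φ₀ hnT)
      fun ψ hψ => CPL.IsTheory.value_eq_zero φ₀ (hΓT (.prem hψ)))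
  · intro h v hv hΓ
    refine le_antisymm (ge_of_tendsto' (tendsto_pow_atTop_nhds_zero_of_lt_one
      (r := (1 / 2 : ℝ)) (by norm_num) (by norm_num)) fun n => ?_) (hv.1 φ).1
    have hn := hv.eq_zero_of_deduces hΓ (h n)
    rw [hv.2.2.2, hv.apply_twoPowNeg, max_eq_right_iff] at hn
    linarith

end Stmt8
end

section
/- Let M be a model of RV and let a, b ∈ M. Then: (1) d(a, a∸b) = E(a∧b) ≤ E(b), and a∸0 = a; (2) a∸a = 0; (3) a∸½a = ½a, ½a∸a = 0, and E(½a) = ½·E(a); (4) defining 2⁰ = ¬0 and 2^{−(n+1)} = ½(2^{−n}), one has E(2^{−n}) = 2^{−n} for all n; (5) a = b if and only if v(a) = v(b) for every truth assignment v : M → [0,1], i.e. every map v with v(¬x) = 1 − v(x), v(½x) = v(x)/2 and v(x∸y) = max(v(x)−v(y), 0). -/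
namespace Stmt12

/-- An `L_RV`-structure: a metric space with a distinguished element `0`, unary operations
`¬` and `½`, and a binary operation `∸`. -/
structure RVStruct (M : Type*) where
  zero : M
  neg : M → M
  half : M → M
  sub : M → M → M

namespace RVStruct

variable {M : Type*}

/-- `E(x) = d(x, 0)`, the expectation. -/
noncomputable def E [MetricSpace M] (L : RVStruct M) (x : M) : ℝ := dist x L.zero

/-- `x ∧ y` abbreviates `x ∸ (x ∸ y)`. -/
def land (L : RVStruct M) (x y : M) : M := L.sub x (L.sub x y)

/-- Formal terms built from `n` variables, the constant `0` and the operations `¬`, `½`, `∸`. -/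
inductive Term (n : ℕ) : Type where
  | var : Fin n → Term n
  | zero : Term n
  | neg : Term n → Term n
  | half : Term n → Term n
  | sub : Term n → Term n → Term n

/-- The standard interpretation of a term as a real-valued function
(`¬t = 1 - t`, `½t = t/2`, `s ∸ t = max (s - t) 0`, constant `0`). -/
noncomputable def Term.evalR {n : ℕ} (v : Fin n → ℝ) : Term n → ℝ
  | .var i => v i
  | .zero => 0
  | .neg t => 1 - Term.evalR v t
  | .half t => Term.evalR v t / 2
  | .sub s t => max (Term.evalR v s - Term.evalR v t) 0

/-- The interpretation of a term in an `L_RV`-structure. -/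
def evalM {n : ℕ} (L : RVStruct M) (a : Fin n → M) : Term n → M
  | .var i => a i
  | .zero => L.zero
  | .neg t => L.neg (evalM L a t)
  | .half t => L.half (evalM L a t)
  | .sub s t => L.sub (evalM L a s) (evalM L a t)

/-- The axioms RV1–RV4 of the theory `RV` of `[0,1]`-valued random variables:
RV1: `E(x) = E(x∸y) + E(y∧x)`; RV2: `E(1) = 1` where `1 = ¬0`;
RV3: `d(x,y) = E(x∸y) + E(y∸x)`;
RV4: `τ(ā) = 0` for every term `τ` whose standard interpretation on `[0,1]ⁿ` vanishes
identically. -/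
def IsRV [MetricSpace M] (L : RVStruct M) : Prop :=
  (∀ x y : M, L.E x = L.E (L.sub x y) + L.E (L.land y x)) ∧
  (L.E (L.neg L.zero) = 1) ∧
  (∀ x y : M, dist x y = L.E (L.sub x y) + L.E (L.sub y x)) ∧
  (∀ (n : ℕ) (τ : Term n),
    (∀ v : Fin n → ℝ, (∀ i, v i ∈ Set.Icc (0 : ℝ) 1) → Term.evalR v τ = 0) →
    ∀ a : Fin n → M, evalM L a τ = L.zero)

end RVStruct

open RVStruct

/-- `2⁰ = ¬0` and `2^{-(n+1)} = ½ 2^{-n}`. -/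
def RVStruct.twoPow {M : Type*} (L : RVStruct M) : ℕ → M
  | 0 => L.neg L.zero
  | n + 1 => L.half (L.twoPow n)

/-- A truth assignment on an `L_RV`-structure: a map into `[0,1]` with `v(¬x) = 1 - v(x)`,
`v(½x) = v(x)/2` and `v(x∸y) = max (v(x) - v(y)) 0`. -/
def RVStruct.IsTruthAssignment {M : Type*} (L : RVStruct M) (v : M → ℝ) : Prop :=
  (∀ x : M, v x ∈ Set.Icc (0 : ℝ) 1) ∧
  (∀ x : M, v (L.neg x) = 1 - v x) ∧
  (∀ x : M, v (L.half x) = v x / 2) ∧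
  (∀ x y : M, v (L.sub x y) = max (v x - v y) 0)

namespace RVStruct

variable {M : Type*}

/-- Substitution of variables for variables in a term. -/
def Term.rename {n m : ℕ} (r : Fin n → Fin m) : Term n → Term m
  | .var i => .var (r i)
  | .zero => .zero
  | .neg t => .neg (t.rename r)
  | .half t => .half (t.rename r)
  | .sub s t => .sub (s.rename r) (t.rename r)

theorem Term.evalR_rename {n m : ℕ} (r : Fin n → Fin m) (v : Fin m → ℝ) (τ : Term n) :
    (τ.rename r).evalR v = τ.evalR (v ∘ r) := by
  induction τ <;> simp_all [Term.rename, Term.evalR]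

theorem evalM_rename (L : RVStruct M) {n m : ℕ} (r : Fin n → Fin m) (c : Fin m → M)
    (τ : Term n) : L.evalM c (τ.rename r) = L.evalM (c ∘ r) τ := by
  induction τ <;> simp_all [Term.rename, evalM]

theorem Term.evalR_mem_Icc {n : ℕ} {v : Fin n → ℝ} (hv : ∀ i, v i ∈ Set.Icc (0 : ℝ) 1)
    (τ : Term n) : τ.evalR v ∈ Set.Icc (0 : ℝ) 1 := by
  induction τ with
  | var i => exact hv i
  | zero => simp [Term.evalR]
  | neg t ih =>
    obtain ⟨h0, h1⟩ := ih
    constructor <;> simp only [Term.evalR] <;> linarith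
  | half t ih =>
    obtain ⟨h0, h1⟩ := ih
    constructor <;> simp only [Term.evalR] <;> linarith
  | sub s t ihs iht =>
    exact ⟨le_max_right _ _, max_le (by linarith [ihs.2, iht.1]) zero_le_one⟩

theorem Term.continuous_evalR {n : ℕ} (τ : Term n) :
    Continuous fun v : Fin n → ℝ => τ.evalR v := by
  induction τ <;> simp only [Term.evalR] <;> fun_prop

/-- `L.Represents f x` says that some term, with elements of `M` substituted for its variables,
evaluates to `x` in `M` and to `f v` in `[0,1]` under every valuation `v` of the elements of `M`. -/
def Represents (L : RVStruct M) (f : (M → Set.Icc (0 : ℝ) 1) → ℝ) (x : M) : Prop :=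
  ∃ (n : ℕ) (τ : Term n) (c : Fin n → M),
    (∀ v, f v = τ.evalR fun i => (v (c i) : ℝ)) ∧ x = L.evalM c τ

namespace Represents

variable {L : RVStruct M} {f g : (M → Set.Icc (0 : ℝ) 1) → ℝ} {x y : M}

theorem var (L : RVStruct M) (x : M) : L.Represents (fun v => v x) x :=
  ⟨1, .var 0, fun _ => x, fun _ => rfl, rfl⟩

theorem zero (L : RVStruct M) : L.Represents (fun _ => 0) L.zero :=
  ⟨0, .zero, Fin.elim0, fun _ => rfl, rfl⟩

theorem neg (hf : L.Represents f x) : L.Represents (fun v => 1 - f v) (L.neg x) := by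
  obtain ⟨n, τ, c, hv, rfl⟩ := hf
  exact ⟨n, .neg τ, c, fun v => by simp only [hv, Term.evalR], rfl⟩

theorem half (hf : L.Represents f x) : L.Represents (fun v => f v / 2) (L.half x) := by
  obtain ⟨n, τ, c, hv, rfl⟩ := hf
  exact ⟨n, .half τ, c, fun v => by simp only [hv, Term.evalR], rfl⟩

theorem sub (hf : L.Represents f x) (hg : L.Represents g y) :
    L.Represents (fun v => max (f v - g v) 0) (L.sub x y) := by
  obtain ⟨n, τ, c, hv, rfl⟩ := hf
  obtain ⟨m, σ, d, hw, rfl⟩ := hg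
  refine ⟨n + m, .sub (τ.rename (Fin.castAdd m)) (σ.rename (Fin.natAdd n)), Fin.append c d,
    fun v => ?_, ?_⟩
  · simp [hv, hw, Term.evalR, Term.evalR_rename, Function.comp_def]
  · simp [evalM, evalM_rename, Function.comp_def]

theorem twoPow (L : RVStruct M) (n : ℕ) :
    L.Represents (fun _ => (1 / 2 : ℝ) ^ n) (L.twoPow n) := by
  induction n with
  | zero => simpa [RVStruct.twoPow] using (Represents.zero L).neg
  | succ n ih => simpa [RVStruct.twoPow, pow_succ, div_eq_mul_inv] using ih.half

theorem mem_Icc (hf : L.Represents f x) (v : M → Set.Icc (0 : ℝ) 1) :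
    f v ∈ Set.Icc (0 : ℝ) 1 := by
  obtain ⟨n, τ, c, hv, rfl⟩ := hf
  rw [hv]
  exact τ.evalR_mem_Icc fun i => (v (c i)).2

theorem continuous (hf : L.Represents f x) : Continuous f := by
  obtain ⟨n, τ, c, hv, rfl⟩ := hf
  rw [funext hv]
  exact τ.continuous_evalR.comp (by fun_prop)

end Represents

namespace IsRV

variable [MetricSpace M] {L : RVStruct M} {f g : (M → Set.Icc (0 : ℝ) 1) → ℝ} {x y : M}

theorem E_zero (L : RVStruct M) : L.E L.zero = 0 := dist_self _

theorem E_nonneg (L : RVStruct M) (x : M) : 0 ≤ L.E x := dist_nonneg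

theorem eq_zero_of_represents (h : L.IsRV) (hf : L.Represents f x) (h0 : ∀ v, f v = 0) :
    x = L.zero := by
  obtain ⟨n, τ, c, hv, rfl⟩ := hf
  -- RV4 applies to tuples without repetition, so identify variables with equal values.
  obtain ⟨m, ⟨e⟩⟩ := Finite.exists_equiv_fin (Set.range c)
  let r : Fin n → Fin m := fun i => e ⟨c i, i, rfl⟩
  let d : Fin m → M := fun j => e.symm j
  have hd : Function.Injective d := Subtype.val_injective.comp e.symm.injective
  have hdr : d ∘ r = c := by ext i; simp [d, r]
  have key := h.2.2.2 m (τ.rename r) (fun w hw => ?_) d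
  · rwa [evalM_rename, hdr] at key
  · let v : M → Set.Icc (0 : ℝ) 1 := Function.extend d (fun j => ⟨w j, hw j⟩) fun _ => 0
    have hvc : (fun i => (v (c i) : ℝ)) = w ∘ r := by
      ext i
      have : c i = d (r i) := (congrFun hdr i).symm
      simp [v, this, hd.extend_apply]
    rw [Term.evalR_rename, ← hvc, ← hv, h0]

theorem sub_eq_zero_of_represents (h : L.IsRV) (hf : L.Represents f x) (hg : L.Represents g y)
    (hfg : ∀ v, f v ≤ g v) : L.sub x y = L.zero :=
  h.eq_zero_of_represents (hf.sub hg) fun v => max_eq_right (by linarith [hfg v])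

theorem eq_of_represents (h : L.IsRV) (hf : L.Represents f x) (hg : L.Represents g y)
    (hfg : ∀ v, f v = g v) : x = y := by
  rw [← dist_eq_zero, h.2.2.1, h.sub_eq_zero_of_represents hf hg fun v => (hfg v).le,
    h.sub_eq_zero_of_represents hg hf fun v => (hfg v).ge, E_zero, add_zero]

theorem sub_self (h : L.IsRV) (x : M) : L.sub x x = L.zero :=
  h.sub_eq_zero_of_represents (.var L x) (.var L x) fun _ => le_rfl

theorem sub_zero (h : L.IsRV) (x : M) : L.sub x L.zero = x :=
  h.eq_of_represents ((Represents.var L x).sub (.zero L)) (.var L x) fun v => by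
    simpa using (v x).2.1

theorem neg_neg_zero (h : L.IsRV) : L.neg (L.neg L.zero) = L.zero :=
  h.eq_zero_of_represents (Represents.zero L).neg.neg fun _ => by norm_num

theorem dist_sub (h : L.IsRV) (x y : M) : dist x (L.sub x y) = L.E (L.land x y) := by
  rw [h.2.2.1, h.sub_eq_zero_of_represents ((Represents.var L x).sub (.var L y)) (.var L x)
    fun v => ?_, E_zero, add_zero, land]
  exact max_le (by linarith [(v y).2.1]) (v x).2.1

theorem E_land_le (h : L.IsRV) (x y : M) : L.E (L.land x y) ≤ L.E y := by
  linarith [h.1 y x, E_nonneg L (L.sub y x)]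

theorem E_le_of_sub_eq_zero (h : L.IsRV) (hxy : L.sub x y = L.zero) : L.E x ≤ L.E y := by
  have key := h.1 x y
  rw [hxy, E_zero, zero_add] at key
  have hy := h.1 y (L.sub y x)
  rw [key]
  change L.E y = L.E (L.land y x) + _ at hy
  linarith [E_nonneg L (L.land (L.sub y x) y)]

theorem sub_half (h : L.IsRV) (x : M) : L.sub x (L.half x) = L.half x :=
  h.eq_of_represents ((Represents.var L x).sub (Represents.var L x).half)
    (Represents.var L x).half fun v => by
      rw [max_eq_left] <;> linarith [(v x).2.1]

theorem half_sub (h : L.IsRV) (x : M) : L.sub (L.half x) x = L.zero :=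
  h.sub_eq_zero_of_represents (Represents.var L x).half (.var L x) fun v => by
    linarith [(v x).2.1]

theorem E_half (h : L.IsRV) (x : M) : L.E (L.half x) = L.E x / 2 := by
  have := h.1 x (L.half x)
  rw [land, h.half_sub, h.sub_zero, h.sub_half] at this
  linarith

theorem E_twoPow (h : L.IsRV) (n : ℕ) : L.E (L.twoPow n) = (1 / 2 : ℝ) ^ n := by
  induction n with
  | zero => simpa [twoPow] using h.2.1
  | succ n ih => rw [twoPow, h.E_half, ih, pow_succ]; ring

theorem represents_sub_nsmul (h : L.IsRV) (hf : L.Represents f L.zero) (hg : L.Represents g x)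
    (N : ℕ) : L.Represents (fun v => max (g v - N * f v) 0) x := by
  induction N with
  | zero =>
    convert hg using 2 with v
    simpa using (hg.mem_Icc v).1
  | succ N ih =>
    have key := ih.sub hf
    rw [h.sub_zero] at key
    convert key using 2 with v
    have hfv := (hf.mem_Icc v).1
    rw [← max_sub_sub_right, max_assoc, max_eq_right (show 0 - f v ≤ 0 by linarith)]
    push_cast
    ring_nf

theorem isTruthAssignment_of_forall_represents_zero (h : L.IsRV) (v : M → Set.Icc (0 : ℝ) 1)
    (hv : ∀ f, L.Represents f L.zero → f v = 0) :
    L.IsTruthAssignment fun x => (v x : ℝ) := by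
  have hle : ∀ {x : M} {f g : (M → Set.Icc (0 : ℝ) 1) → ℝ}, L.Represents f x →
      L.Represents g x → f v ≤ g v := fun {x} {f} {g} hf hg => by
    have key := hv _ (h.sub_self x ▸ hf.sub hg)
    linarith [le_max_left (f v - g v) 0]
  have heq : ∀ {x : M} {f : (M → Set.Icc (0 : ℝ) 1) → ℝ}, L.Represents f x →
      (v x : ℝ) = f v := fun hf => le_antisymm (hle (.var L _) hf) (hle hf (.var L _))
  exact ⟨fun x => (v x).2, fun x => heq (Represents.var L x).neg,
    fun x => heq (Represents.var L x).half,
    fun x y => heq ((Represents.var L x).sub (.var L y))⟩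

theorem exists_isTruthAssignment_le_sub (h : L.IsRV) {k : ℕ}
    (hk : (1 / 2 : ℝ) ^ k < L.E (L.sub x y)) :
    ∃ v, L.IsTruthAssignment v ∧ (1 / 2 : ℝ) ^ k ≤ v x - v y := by
  by_contra! hcon
  let K : Set (M → Set.Icc (0 : ℝ) 1) := {v | (1 / 2 : ℝ) ^ k ≤ v x - v y}
  have hK : IsCompact K := (isClosed_le (by fun_prop) (by fun_prop)).isCompact
  let ι := {f : (M → Set.Icc (0 : ℝ) 1) → ℝ // L.Represents f L.zero}
  have : Nonempty ι := ⟨⟨_, .zero L⟩⟩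
  obtain ⟨⟨f, hf⟩, hfK⟩ := hK.elim_directed_family_closed (fun f : ι => {v | f.1 v = 0})
    (fun f => isClosed_eq f.2.continuous continuous_const) (by
      rw [Set.eq_empty_iff_forall_notMem]
      rintro v ⟨hvK, hv⟩
      simp only [Set.mem_iInter] at hv
      exact (hcon _ (h.isTruthAssignment_of_forall_represents_zero v
        fun f hf => hv ⟨f, hf⟩)).not_ge hvK) (by
      rintro ⟨f, hf⟩ ⟨g, hg⟩
      have hsum := (hf.neg.sub hg).neg
      rw [h.sub_zero, h.neg_neg_zero] at hsum
      have hzero : ∀ v, 1 - max (1 - f v - g v) 0 = 0 → f v = 0 ∧ g v = 0 := fun v hv => by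
        have h0 := (hf.mem_Icc v).1
        have h1 := (hg.mem_Icc v).1
        rcases max_choice (1 - f v - g v) 0 with hm | hm <;> rw [hm] at hv <;>
          constructor <;> linarith
      exact ⟨⟨_, hsum⟩, fun v hv => (hzero v hv).1, fun v hv => (hzero v hv).2⟩)
  obtain ⟨δ, hδ, hδK⟩ : ∃ δ > 0, ∀ v ∈ K, δ ≤ f v := by
    refine hK.exists_forall_le' hf.continuous.continuousOn fun v hv => ?_
    exact lt_of_le_of_ne (hf.mem_Icc v).1 fun h0 =>
      Set.eq_empty_iff_forall_notMem.1 hfK v ⟨hv, h0.symm⟩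
  obtain ⟨N, hN⟩ := exists_nat_gt (1 / δ)
  rw [div_lt_iff₀ hδ] at hN
  have hzero := h.eq_zero_of_represents (h.represents_sub_nsmul hf
    (((Represents.var L x).sub (.var L y)).sub (.twoPow L k)) N) fun v => by
      have hfv := (hf.mem_Icc v).1
      have hpow : (0 : ℝ) < (1 / 2) ^ k := by positivity
      refine max_eq_right (sub_nonpos.2 (max_le ?_ (by positivity)))
      by_cases hv : v ∈ K
      · have := mul_le_mul_of_nonneg_left (hδK v hv) N.cast_nonneg
        have : max ((v x : ℝ) - v y) 0 ≤ 1 :=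
          max_le (by linarith [(v x).2.2, (v y).2.1]) zero_le_one
        linarith
      · have hv' : (v x : ℝ) - v y < (1 / 2) ^ k := not_le.1 hv
        have := max_le hv'.le hpow.le
        have : 0 ≤ N * f v := by positivity
        linarith
  exact (h.E_twoPow k ▸ h.E_le_of_sub_eq_zero hzero).not_gt hk

theorem sub_eq_zero_of_forall_isTruthAssignment (h : L.IsRV)
    (hv : ∀ v, L.IsTruthAssignment v → v x ≤ v y) : L.sub x y = L.zero := by
  by_contra hne
  obtain ⟨k, hk⟩ := exists_pow_lt_of_lt_one (dist_pos.2 hne) (show (1 / 2 : ℝ) < 1 by norm_num)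
  obtain ⟨v, hva, hle⟩ := h.exists_isTruthAssignment_le_sub hk
  have hpow : (0 : ℝ) < (1 / 2) ^ k := by positivity
  linarith [hv v hva]

end IsRV

end RVStruct

/-- Basic consequences of the axioms `RV`, for a model `M` of `RV` and `a, b ∈ M`. -/
theorem consequences_of_RV {M : Type*} [MetricSpace M] [CompleteSpace M]
    (L : RVStruct M) (h : L.IsRV) (a b : M) :
    (dist a (L.sub a b) = L.E (L.land a b) ∧ L.E (L.land a b) ≤ L.E b ∧
      L.sub a L.zero = a) ∧
    L.sub a a = L.zero ∧
    (L.sub a (L.half a) = L.half a ∧ L.sub (L.half a) a = L.zero ∧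
      L.E (L.half a) = L.E a / 2) ∧
    (∀ n : ℕ, L.E (L.twoPow n) = (1 / 2 : ℝ) ^ n) ∧
    (a = b ↔ ∀ v : M → ℝ, L.IsTruthAssignment v → v a = v b) := by
  refine ⟨⟨h.dist_sub a b, h.E_land_le a b, h.sub_zero a⟩, h.sub_self a,
    ⟨h.sub_half a, h.half_sub a, h.E_half a⟩, h.E_twoPow, ?_, fun hv => ?_⟩
  · rintro rfl v -
    rfl
  · rw [← dist_eq_zero, h.2.2.1,
      h.sub_eq_zero_of_forall_isTruthAssignment fun v hva => (hv v hva).le,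
      h.sub_eq_zero_of_forall_isTruthAssignment fun v hva => (hv v hva).ge, IsRV.E_zero, add_zero]

end Stmt12
end

section
/- Let X be a compact Hausdorff space and let E : C(X, [0,1]) → [0,1] satisfy E(f) = E(f∸g) + E(g∸(g∸f)) for all f, g ∈ C(X, [0,1]) (where f∸g = max(f−g, 0) pointwise), and assume E is continuous with respect to the pseudometric d(f, g) = E(f∸g) + E(g∸f). Then: (1) if f, g ∈ C(X, [0,1]) and f + g ∈ C(X, [0,1]) (i.e. f + g ≤ 1 pointwise), then E(f+g) = E(f) + E(g); (2) if r ∈ ℝ, r ≥ 0, f ∈ C(X, [0,1]) and r·f ∈ C(X, [0,1]) (i.e. r·sup f ≤ 1), then E(r·f) = r·E(f). -/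
namespace Stmt14

open Set

/-- The pointwise truncated subtraction `f ∸ g = max (f - g) 0` on `C(X, ℝ)`. -/
noncomputable def tsub {X : Type*} [TopologicalSpace X] (f g : C(X, ℝ)) : C(X, ℝ) :=
  ⟨fun x => max (f x - g x) 0, ((f.continuous.sub g.continuous).max continuous_const)⟩

/-- A function bounded by `0` and `1` on the unit interval and additive there is linear there. -/
theorem eq_mul_one_of_additive_unitInterval (φ : ℝ → ℝ)
    (hφ : ∀ r ∈ Icc (0 : ℝ) 1, φ r ∈ Icc (0 : ℝ) 1)
    (hadd : ∀ r s : ℝ, 0 ≤ r → 0 ≤ s → r + s ≤ 1 → φ (r + s) = φ r + φ s)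
    {r : ℝ} (hr : r ∈ Icc (0 : ℝ) 1) : φ r = r * φ 1 := by
  have hzero : φ 0 = 0 := by
    have := hadd 0 0 le_rfl le_rfl (by norm_num)
    rw [add_zero] at this
    linarith
  have hnsmul : ∀ (k : ℕ) (t : ℝ), 0 ≤ t → k * t ≤ 1 → φ (k * t) = k * φ t := by
    intro k t ht
    induction k with
    | zero => intro _; simp [hzero]
    | succ k ih =>
      intro hk
      push_cast at hk ⊢
      rw [add_mul, one_mul] at hk ⊢
      rw [hadd _ _ (by positivity) ht hk, ih (by linarith)]
      ring
  have hbound : ∀ n : ℕ, |φ r - r * φ 1| ≤ 1 / ((n : ℝ) + 1) := by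
    intro n
    have hm : (0 : ℝ) < (n : ℝ) + 1 := by positivity
    set m : ℝ := (n : ℝ) + 1
    have hcast : ((n + 1 : ℕ) : ℝ) = m := by push_cast; rfl
    have hk₁ : (⌊r * m⌋₊ : ℝ) ≤ r * m := Nat.floor_le (mul_nonneg hr.1 hm.le)
    have hk₂ : r * m < (⌊r * m⌋₊ : ℝ) + 1 := Nat.lt_floor_add_one _
    set k : ℕ := ⌊r * m⌋₊
    obtain ⟨s, hs⟩ : ∃ s, s = r - k * (1 / m) := ⟨_, rfl⟩
    have hms : m * s = r * m - k := by rw [hs]; field_simp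
    have hs₀ : 0 ≤ s := nonneg_of_mul_nonneg_right (by linarith) hm
    have hrs : r = k * (1 / m) + s := by linarith
    have hφr : φ r = k * φ (1 / m) + φ s := by
      rw [← hnsmul k (1 / m) (by positivity) (by linarith [hr.2]), ← hadd _ _ (by positivity) hs₀
        (by linarith [hr.2]), ← hrs]
    have hφone : φ 1 = m * φ (1 / m) := by
      have := hnsmul (n + 1) (1 / m) (by positivity)
      rw [hcast, mul_one_div_cancel hm.ne'] at this
      exact this le_rfl
    have hφs : φ (m * s) = m * φ s := by
      have := hnsmul (n + 1) s hs₀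
      rw [hcast] at this
      exact this (by linarith)
    have hφms := hφ (m * s) ⟨by positivity, by linarith⟩
    have hφ₁ := hφ 1 ⟨by norm_num, le_rfl⟩
    have hdiff : m * (φ r - r * φ 1) = φ (m * s) - m * s * φ 1 := by
      have hmr : m * r = k + m * s := by linarith
      calc m * (φ r - r * φ 1) = k * (m * φ (1 / m)) + m * φ s - m * r * φ 1 := by rw [hφr]; ring
        _ = φ (m * s) - m * s * φ 1 := by rw [← hφone, ← hφs, hmr]; ring
    have hprod₀ : 0 ≤ m * s * φ 1 := mul_nonneg (by positivity) hφ₁.1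
    have hprod₁ : m * s * φ 1 ≤ 1 := mul_le_one₀ (by linarith) hφ₁.1 hφ₁.2
    rw [le_div_iff₀ hm, mul_comm, ← abs_of_pos hm, ← abs_mul, hdiff, abs_le]
    exact ⟨by linarith [hφms.1], by linarith [hφms.2]⟩
  have hle : |φ r - r * φ 1| ≤ 0 :=
    ge_of_tendsto' tendsto_one_div_add_atTop_nhds_zero_nat hbound
  exact sub_eq_zero.1 (abs_nonpos_iff.1 hle)

/-- Let `X` be compact Hausdorff and let `E : C(X,[0,1]) → [0,1]` satisfy axiom RV1,
`E(f) = E(f∸g) + E(g∧f)` where `g∧f = g∸(g∸f)`, and be continuous with respect to the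
pseudometric `d(f,g) = E(f∸g) + E(g∸f)`. Then `E` is additive (`E(f+g) = E(f) + E(g)`
whenever `f`, `g`, `f+g` are `[0,1]`-valued) and positively homogeneous
(`E(r·f) = r·E(f)` whenever `r ≥ 0` and `f`, `r·f` are `[0,1]`-valued). -/
theorem linearity_of_expectation {X : Type*} [TopologicalSpace X] [CompactSpace X]
    [T2Space X] (E : C(X, ℝ) → ℝ)
    (hrange : ∀ f : C(X, ℝ), (∀ x, f x ∈ Icc (0 : ℝ) 1) → E f ∈ Icc (0 : ℝ) 1)
    (hRV1 : ∀ f g : C(X, ℝ), (∀ x, f x ∈ Icc (0 : ℝ) 1) → (∀ x, g x ∈ Icc (0 : ℝ) 1) →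
      E f = E (tsub f g) + E (tsub g (tsub g f)))
    (hcont : ∀ f : C(X, ℝ), (∀ x, f x ∈ Icc (0 : ℝ) 1) → ∀ ε : ℝ, 0 < ε →
      ∃ δ : ℝ, 0 < δ ∧ ∀ g : C(X, ℝ), (∀ x, g x ∈ Icc (0 : ℝ) 1) →
        E (tsub f g) + E (tsub g f) < δ → |E f - E g| < ε) :
    (∀ f g : C(X, ℝ), (∀ x, f x ∈ Icc (0 : ℝ) 1) → (∀ x, g x ∈ Icc (0 : ℝ) 1) →
      (∀ x, f x + g x ∈ Icc (0 : ℝ) 1) → E (f + g) = E f + E g) ∧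
    (∀ (r : ℝ) (f : C(X, ℝ)), 0 ≤ r → (∀ x, f x ∈ Icc (0 : ℝ) 1) →
      (∀ x, r * f x ∈ Icc (0 : ℝ) 1) → E (r • f) = r * E f) := by
  have hadd : ∀ f g : C(X, ℝ), (∀ x, f x ∈ Icc (0 : ℝ) 1) → (∀ x, g x ∈ Icc (0 : ℝ) 1) →
      (∀ x, f x + g x ∈ Icc (0 : ℝ) 1) → E (f + g) = E f + E g := by
    intro f g hf hg hfg
    have hsub : tsub (f + g) g = f := by
      ext x
      simp [tsub, (hf x).1]
    have hinf : tsub g (tsub g (f + g)) = g := by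
      ext x
      simp [tsub, (hf x).1, (hg x).1]
    rw [hRV1 (f + g) g hfg hg, hsub, hinf]
  have hscale : ∀ (r : ℝ) (f : C(X, ℝ)), r ∈ Icc (0 : ℝ) 1 → (∀ x, f x ∈ Icc (0 : ℝ) 1) →
      E (r • f) = r * E f := by
    intro r f hr hf
    have hmem : ∀ t ∈ Icc (0 : ℝ) 1, ∀ x, (t • f) x ∈ Icc (0 : ℝ) 1 := fun t ht x =>
      ⟨mul_nonneg ht.1 (hf x).1, mul_le_one₀ ht.2 (hf x).1 (hf x).2⟩
    have := eq_mul_one_of_additive_unitInterval (fun t => E (t • f))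
      (fun t ht => hrange _ (hmem t ht))
      (fun s t hs ht hst => by
        simp only [add_smul]
        refine hadd _ _ (hmem s ⟨hs, by linarith⟩) (hmem t ⟨ht, by linarith⟩) fun x => ?_
        have := hmem (s + t) ⟨by linarith, hst⟩ x
        rwa [add_smul] at this) hr
    simpa using this
  refine ⟨hadd, fun r f hr hf hrf => ?_⟩
  rcases le_total r 1 with h | h
  · exact hscale r f ⟨hr, h⟩ hf
  · have hr₀ : r ≠ 0 := by positivity
    have := hscale r⁻¹ (r • f) ⟨by positivity, inv_le_one_of_one_le₀ h⟩ hrf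
    rw [inv_smul_smul₀ hr₀] at this
    rw [this, mul_inv_cancel_left₀ hr₀]

end Stmt14
end
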